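/- arXiv:1911.08887 — 2 statements merged into one kernel-verified Lean document; each statement's English description precedes it below -/
import Mathlib

section
/- For every integer k ≥ 2 and every constant γ > 0 there exists n₀ ∈ ℕ such that for all n ≥ n₀, every (n,k,γ)-graph G is tight Hamilton-connected: for any two ordered (k−1)-tuples S, T of distinct vertices with underlying sets disjoint, there is a tight Hamilton path of G which connects S and T. -/
open scoped Classical

namespace TightHamilton

/-- Every `r + 1` consecutive entries of `l` form an edge of `E`; entries may repeat. -/
def Tight {V : Type} [DecidableEq V] (E : Finset (Finset V)) (r : ℕ) (l : List V) : Prop :=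
  ∀ w, w <:+: l → w.length = r + 1 → w.toFinset ∈ E

/-- The vertices completing `A` to an edge of `E`. -/
def nb {V : Type} [Fintype V] [DecidableEq V] (E : Finset (Finset V)) (A : Finset V) : Finset V :=
  Finset.univ.filter fun x => x ∉ A ∧ insert x A ∈ E

/-- Every `r`-set has at least `c` neighbours in `U`. -/
def Cod {V : Type} [Fintype V] [DecidableEq V] (E : Finset (Finset V)) (r : ℕ) (U : Finset V)
    (c : ℝ) : Prop :=
  ∀ A : Finset V, A.card = r → c ≤ ((nb E A ∩ U).card : ℝ)

section Tight

variable {V : Type} [DecidableEq V] {E : Finset (Finset V)} {r : ℕ}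

theorem Tight.infix {l l' : List V} (h : Tight E r l) (hl : l' <:+: l) : Tight E r l' :=
  fun w hw => h w (hw.trans hl)

theorem Tight.reverse {l : List V} (h : Tight E r l) : Tight E r l.reverse := by
  intro w hw hlen
  have h1 : w.reverse <:+: l := by
    have := List.reverse_infix.mpr hw
    simpa using this
  simpa using h _ h1 (by simpa using hlen)

theorem tight_iff {l : List V} :
    Tight E r l ↔ ∀ i, i + (r + 1) ≤ l.length → ((l.drop i).take (r + 1)).toFinset ∈ E := by
  constructor
  · intro h i hi
    refine h _ ((List.take_prefix _ _).isInfix.trans (List.drop_suffix _ _).isInfix) ?_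
    simp; omega
  · rintro h w ⟨a, b, rfl⟩ hw
    have := h a.length (by simp; omega)
    rwa [List.append_assoc, List.drop_left, ← hw, List.take_left] at this

theorem tight_of_length_le {l : List V} (h : l.length ≤ r) : Tight E r l := by
  intro w hw hlen
  have := hw.length_le
  omega

theorem tight_of_toFinset_mem {l : List V} (h : l.length = r + 1) (hl : l.toFinset ∈ E) :
    Tight E r l := by
  intro w hw hlen
  rwa [hw.eq_of_length (by omega)]

theorem Tight.glue {a m b : List V} (hm : r ≤ m.length) (h1 : Tight E r (a ++ m))
    (h2 : Tight E r (m ++ b)) : Tight E r (a ++ m ++ b) := by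
  rw [tight_iff] at *
  intro i hi
  by_cases hc : i + (r + 1) ≤ (a ++ m).length
  · have := h1 i hc
    rw [List.drop_append_of_le_length (by omega),
      List.take_append_of_le_length (by simp at *; omega)]
    exact this
  · have hi' : a.length ≤ i := by simp at hc; omega
    have := h2 (i - a.length) (by simp at *; omega)
    rw [List.append_assoc, List.drop_append, List.drop_of_length_le hi']
    simpa using this

theorem Tight.step {p l : List V} {x : V} (hr : 1 ≤ r) (hp : p.length = r)
    (hx : insert x p.toFinset ∈ E) (h : Tight E r (p.tail ++ x :: l)) :
    Tight E r (p ++ x :: l) := by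
  cases p with
  | nil => simp at hp; omega
  | cons y p =>
    have := Tight.glue (E := E) (r := r) (a := [y]) (m := p ++ [x]) (b := l)
      (by simp at *; omega)
      (tight_of_toFinset_mem (by simp at *; omega) (by
        convert hx using 1; ext; simp; tauto)) (by simpa using h)
    simpa using this

theorem tight_replace {a c : List V} {x y : V} (hlen : a.length + c.length = r)
    (hx : (a ++ x :: c).toFinset ∈ E) (hy : (a ++ y :: c).toFinset ∈ E) :
    Tight E r ((a ++ x :: c) ++ (a ++ y :: c)) := by
  rw [tight_iff]
  intro i hi
  simp at hi
  by_cases hc : i ≤ a.length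
  · convert hx using 1
    have h1 : (a ++ x :: c ++ (a ++ y :: c)).drop i
        = (a.drop i ++ x :: c) ++ (a ++ y :: c) := by
      rw [List.append_assoc, List.drop_append_of_le_length hc]; simp
    have h2 : r + 1 = (a.drop i ++ x :: c).length + i := by simp; omega
    rw [h1, h2, List.take_length_add_append, List.take_append_of_le_length hc]
    ext z
    have : z ∈ a ↔ z ∈ a.take i ∨ z ∈ a.drop i := by
      rw [← List.mem_append, List.take_append_drop]
    simp only [List.mem_toFinset, List.mem_append, List.mem_cons, this]
    tauto
  · convert hy using 1
    obtain ⟨j, rfl⟩ : ∃ j, i = a.length + 1 + j := ⟨i - (a.length + 1), by omega⟩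
    have hj : j ≤ c.length := by omega
    have h1 : (a ++ x :: c ++ (a ++ y :: c)).drop (a.length + 1 + j)
        = c.drop j ++ (a ++ [y]) ++ c := by
      have : a ++ x :: c ++ (a ++ y :: c) = (a ++ [x]) ++ (c ++ (a ++ y :: c)) := by simp
      rw [this, show a.length + 1 + j = (a ++ [x]).length + j by simp,
        List.drop_length_add_append, List.drop_append_of_le_length hj]
      simp
    have h2 : r + 1 = (c.drop j ++ (a ++ [y])).length + j := by simp; omega
    rw [h1, h2, List.take_length_add_append]
    ext z
    have : z ∈ c ↔ z ∈ c.take j ∨ z ∈ c.drop j := by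
      rw [← List.mem_append, List.take_append_drop]
    simp only [List.mem_toFinset, List.mem_append, List.mem_cons, this]
    simp
    tauto

theorem tight_insert_between {a b : List V} {v : V} (ha : a.length = r) (hb : b.length = r)
    (H : ∀ w, w <:+: a ++ b → w.length = r → insert v w.toFinset ∈ E) :
    Tight E r (a ++ v :: b) := by
  rw [tight_iff]
  intro i hi
  simp at hi
  have hi' : i ≤ a.length := by omega
  have h2 : r + 1 = (a.drop i ++ [v]).length + i := by simp; omega
  have h3 : (a.drop i ++ v :: b) = (a.drop i ++ [v]) ++ b := by simp
  rw [List.drop_append_of_le_length hi', h3, h2, List.take_length_add_append]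
  have := H (a.drop i ++ b.take i) ⟨a.take i, b.drop i, by
    rw [← List.append_assoc, List.take_append_drop, List.append_assoc, List.take_append_drop]⟩
    (by simp; omega)
  convert this using 1
  ext z; simp

end Tight

section Nb

variable {V : Type} [Fintype V] [DecidableEq V] {E : Finset (Finset V)} {r : ℕ}

theorem mem_nb {A : Finset V} {x : V} : x ∈ nb E A ↔ x ∉ A ∧ insert x A ∈ E := by
  simp [nb]

theorem Cod.two {U : Finset V} {c : ℝ} (h : Cod E r U c) {P Q : Finset V} (hP : P.card = r)
    (hQ : Q.card = r) : 2 * c - U.card ≤ ((nb E P ∩ nb E Q ∩ U).card : ℝ) := by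
  have h1 := h P hP
  have h2 := h Q hQ
  have h3 := Finset.card_union_add_card_inter (nb E P ∩ U) (nb E Q ∩ U)
  have h4 : ((nb E P ∩ U) ∪ (nb E Q ∩ U)).card ≤ U.card := by
    apply Finset.card_le_card; intro x; simp; tauto
  have h5 : (nb E P ∩ U) ∩ (nb E Q ∩ U) = nb E P ∩ nb E Q ∩ U := by
    grind
  rw [h5] at h3
  have h3' : (((nb E P ∩ U) ∪ (nb E Q ∩ U)).card : ℝ) + (nb E P ∩ nb E Q ∩ U).card
    = (nb E P ∩ U).card + (nb E Q ∩ U).card := by exact_mod_cast h3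
  have h4' : (((nb E P ∩ U) ∪ (nb E Q ∩ U)).card : ℝ) ≤ U.card := by exact_mod_cast h4
  linarith

theorem Cod.sdiff {U W : Finset V} {c d : ℝ} (h : Cod E r U c) (hd : d + W.card ≤ c) :
    Cod E r (U \ W) d := by
  intro A hA
  have h1 := h A hA
  have h2 : (nb E A ∩ U).card ≤ (nb E A ∩ (U \ W)).card + W.card := by
    rw [← Finset.card_union_add_card_inter]
    refine le_trans (Finset.card_le_card ?_) (Nat.le_add_right _ _)
    intro x; simp; tauto
  have h2' : ((nb E A ∩ U).card : ℝ) ≤ (nb E A ∩ (U \ W)).card + W.card := by exact_mod_cast h2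
  linarith

end Nb

section Rich

variable {V : Type}

/-- A list of length `m` satisfying `P` can be chosen from `U` entry by entry, with at least `d`
choices for each entry. -/
def Rich (U : Finset V) (d : ℝ) : ℕ → (List V → Prop) → Prop
  | 0, P => P []
  | m + 1, P => ∃ X ⊆ U, d ≤ (X.card : ℝ) ∧ ∀ x ∈ X, Rich U d m fun l => P (x :: l)

theorem Rich.mono {U : Finset V} {d : ℝ} {m : ℕ} {P Q : List V → Prop} (h : Rich U d m P)
    (hPQ : ∀ l, l.length = m → P l → Q l) : Rich U d m Q := by
  induction m generalizing P Q with
  | zero => exact hPQ [] rfl h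
  | succ m ih =>
    obtain ⟨X, hX, hd, h⟩ := h
    exact ⟨X, hX, hd, fun x hx => ih (h x hx) fun l hl hp => hPQ _ (by simp [hl]) hp⟩

theorem Rich.bind {U : Finset V} {d : ℝ} {m m' : ℕ} {P Q : List V → Prop} (h : Rich U d m P)
    (hPQ : ∀ l, l.length = m → P l → Rich U d m' fun l' => Q (l ++ l')) :
    Rich U d (m + m') Q := by
  induction m generalizing P Q with
  | zero => simpa using hPQ [] rfl h
  | succ m ih =>
    obtain ⟨X, hX, hd, h⟩ := h
    rw [show m + 1 + m' = m + m' + 1 by omega]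
    exact ⟨X, hX, hd, fun x hx => ih (h x hx) fun l hl hp => hPQ (x :: l) (by simp [hl]) hp⟩

theorem Rich.avoid [DecidableEq V] {U : Finset V} {d d' : ℝ} {m : ℕ} {P : List V → Prop}
    (h : Rich U d m P) (F : Finset V) (hd' : d' + F.card + m ≤ d) :
    Rich U d' m fun l => P l ∧ l.Nodup ∧ ∀ x ∈ l, x ∉ F := by
  induction m generalizing P F with
  | zero => exact ⟨h, by simp⟩
  | succ m ih =>
    obtain ⟨X, hX, hd, h⟩ := h
    push_cast at hd'
    refine ⟨X \ F, Finset.sdiff_subset.trans hX, ?_, fun x hx => ?_⟩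
    · have : X.card ≤ (X \ F).card + F.card := by
        rw [← Finset.card_union_add_card_inter]
        refine le_trans (Finset.card_le_card ?_) (Nat.le_add_right _ _)
        intro x; simp; tauto
      have : (X.card : ℝ) ≤ (X \ F).card + F.card := by exact_mod_cast this
      have : (0 : ℝ) ≤ m := by positivity
      linarith
    · rw [Finset.mem_sdiff] at hx
      refine (ih (h x hx.1) (insert x F) ?_).mono ?_
      · have : ((insert x F).card : ℝ) ≤ F.card + 1 := by
          exact_mod_cast Finset.card_insert_le _ _
        linarith
      · rintro l - ⟨h1, h2, h3⟩
        refine ⟨h1, ?_, ?_⟩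
        · rw [List.nodup_cons]
          exact ⟨fun h => h3 x h (Finset.mem_insert_self _ _), h2⟩
        · intro y hy
          rcases List.mem_cons.mp hy with rfl | hy
          · exact hx.2
          · exact fun h => h3 y hy (Finset.mem_insert_of_mem h)

/-- The lists of length `m` with entries in `U`. -/
def lists [DecidableEq V] (U : Finset V) : ℕ → Finset (List V)
  | 0 => {[]}
  | m + 1 => (U ×ˢ lists U m).image fun p => p.1 :: p.2

theorem mem_lists [DecidableEq V] {U : Finset V} {m : ℕ} {l : List V} :
    l ∈ lists U m ↔ l.length = m ∧ ∀ x ∈ l, x ∈ U := by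
  induction m generalizing l with
  | zero => simp [lists]; rintro rfl; simp
  | succ m ih =>
    cases l with
    | nil => simp [lists]
    | cons x l => simp [lists, ih]; tauto

theorem card_lists_filter_succ [DecidableEq V] (U : Finset V) (m : ℕ) (P : List V → Prop) :
    ((lists U (m + 1)).filter P).card
      = ∑ x ∈ U, ((lists U m).filter fun l => P (x :: l)).card := by
  simp only [Finset.card_filter, lists]
  rw [Finset.sum_image, Finset.sum_product]
  rintro ⟨a, b⟩ - ⟨c, d⟩ - h
  simpa using h

theorem card_lists [DecidableEq V] (U : Finset V) (m : ℕ) : (lists U m).card = U.card ^ m := by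
  induction m with
  | zero => simp [lists]
  | succ m ih =>
    have := card_lists_filter_succ U m fun _ => True
    simp only [Finset.filter_true] at this
    rw [this, Finset.sum_const, ih, pow_succ]
    simp [mul_comm]

theorem Rich.le_card [DecidableEq V] {U : Finset V} {d : ℝ} (hd : 0 ≤ d) {m : ℕ}
    {P : List V → Prop} (h : Rich U d m P) : d ^ m ≤ (((lists U m).filter P).card : ℝ) := by
  induction m generalizing P with
  | zero =>
    have : P [] := h
    simp [lists, Finset.filter_singleton, this]
  | succ m ih =>
    obtain ⟨X, hX, hdX, h⟩ := h
    rw [card_lists_filter_succ]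
    push_cast
    calc d ^ (m + 1) = d * d ^ m := by ring
      _ ≤ X.card * d ^ m := by gcongr
      _ = ∑ x ∈ X, d ^ m := by simp
      _ ≤ ∑ x ∈ X, (((lists U m).filter fun l => P (x :: l)).card : ℝ) :=
          Finset.sum_le_sum fun x hx => ih (h x hx)
      _ ≤ _ := Finset.sum_le_sum_of_subset_of_nonneg hX fun _ _ _ => by positivity

end Rich

section Box

variable {V β : Type} [DecidableEq V]

theorem exists_common_of_degree (U : Finset V) (Y : Finset β) (R : V → β → Prop) {η : ℝ}
    (h0 : 0 < η) (h1 : η ≤ 1) (hdeg : ∀ l ∈ Y, η * U.card ≤ ((U.filter fun x => R x l).card : ℝ))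
    (t : ℕ) (ht : (t : ℝ) ≤ η / 2 * U.card) :
    ∃ ys : List V, ys.length = t ∧ ys.Nodup ∧ (∀ x ∈ ys, x ∈ U) ∧
      (η / 2) ^ t * Y.card ≤ ((Y.filter fun l => ∀ x ∈ ys, R x l).card : ℝ) := by
  induction t with
  | zero => exact ⟨[], by simp⟩
  | succ t ih =>
    push_cast at ht
    obtain ⟨ys, hlen, hnd, hU, hcard⟩ := ih (by linarith)
    set Y' := Y.filter fun l => ∀ x ∈ ys, R x l with hY'
    have hys : (ys.toFinset.card : ℝ) = t := by rw [List.toFinset_card_of_nodup hnd, hlen]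
    have hUp : (0 : ℝ) < U.card := by
      by_contra h
      have : η / 2 * U.card ≤ 0 := mul_nonpos_of_nonneg_of_nonpos (by positivity) (by linarith)
      have : (0 : ℝ) ≤ t := by positivity
      linarith
    have hsd : (U.card : ℝ) ≤ (U \ ys.toFinset).card + t := by
      rw [← hys]
      have : U.card ≤ (U \ ys.toFinset).card + ys.toFinset.card := by
        rw [← Finset.card_union_add_card_inter]
        refine le_trans (Finset.card_le_card ?_) (Nat.le_add_right _ _)
        intro x; simp; tauto
      exact_mod_cast this
    have hne : (U \ ys.toFinset).Nonempty := by
      rw [← Finset.card_pos, ← Nat.cast_pos (α := ℝ)]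
      nlinarith
    have hsum : ∑ x ∈ U \ ys.toFinset, η / 2 * (Y'.card : ℝ)
        ≤ ∑ x ∈ U \ ys.toFinset, ((Y'.filter fun l => R x l).card : ℝ) := by
      have e1 : ∑ x ∈ U \ ys.toFinset, ((Y'.filter fun l => R x l).card : ℝ)
          = ∑ l ∈ Y', (((U \ ys.toFinset).filter fun x => R x l).card : ℝ) := by
        exact_mod_cast Finset.sum_card_bipartiteAbove_eq_sum_card_bipartiteBelow R
      rw [e1]
      calc ∑ x ∈ U \ ys.toFinset, η / 2 * (Y'.card : ℝ)
          = (U \ ys.toFinset).card * (η / 2 * Y'.card) := by simp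
        _ ≤ U.card * (η / 2 * Y'.card) := by
            gcongr
            exact Finset.sdiff_subset
        _ = ∑ l ∈ Y', η / 2 * U.card := by simp; ring
        _ ≤ _ := by
            refine Finset.sum_le_sum fun l hl => ?_
            have hl' := hdeg l (Finset.mem_filter.mp hl).1
            have : (U.filter fun x => R x l).card
                ≤ ((U \ ys.toFinset).filter fun x => R x l).card + ys.toFinset.card := by
              rw [← Finset.card_union_add_card_inter]
              refine le_trans (Finset.card_le_card ?_) (Nat.le_add_right _ _)
              intro x; simp; tauto
            have : ((U.filter fun x => R x l).card : ℝ)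
                ≤ ((U \ ys.toFinset).filter fun x => R x l).card + ys.toFinset.card := by
              exact_mod_cast this
            linarith
    obtain ⟨x, hx, hle⟩ := Finset.exists_le_of_sum_le hne hsum
    rw [Finset.mem_sdiff, List.mem_toFinset] at hx
    refine ⟨x :: ys, by simp [hlen], by simp [hnd, hx.2], ?_, ?_⟩
    · intro y hy
      rcases List.mem_cons.mp hy with rfl | hy
      exacts [hx.1, hU y hy]
    · have e : (Y.filter fun l => ∀ y ∈ x :: ys, R y l) = Y'.filter fun l => R x l := by
        ext l; simp [hY']; tauto
      rw [e]
      calc (η / 2) ^ (t + 1) * Y.card = η / 2 * ((η / 2) ^ t * Y.card) := by ring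
        _ ≤ η / 2 * Y'.card := by gcongr
        _ ≤ _ := hle

theorem exists_common (U : Finset V) (Y : Finset β) (R : V → β → Prop) {δ : ℝ}
    (h0 : 0 < δ) (h1 : δ ≤ 1)
    (hsum : δ * U.card * Y.card ≤ ∑ x ∈ U, ((Y.filter fun l => R x l).card : ℝ))
    (t : ℕ) (hU : 0 < U.card) (ht : (t : ℝ) ≤ δ / 4 * U.card) :
    ∃ ys : List V, ys.length = t ∧ ys.Nodup ∧ (∀ x ∈ ys, x ∈ U) ∧
      (δ / 4) ^ t * (δ / 2) * Y.card ≤ ((Y.filter fun l => ∀ x ∈ ys, R x l).card : ℝ) := by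
  set Y₁ := Y.filter fun l => δ / 2 * U.card ≤ ((U.filter fun x => R x l).card : ℝ) with hY₁
  have hU' : (0 : ℝ) < U.card := by exact_mod_cast hU
  have hbig : δ / 2 * Y.card ≤ (Y₁.card : ℝ) := by
    have e1 : ∑ x ∈ U, ((Y.filter fun l => R x l).card : ℝ)
        = ∑ l ∈ Y, ((U.filter fun x => R x l).card : ℝ) := by
      exact_mod_cast Finset.sum_card_bipartiteAbove_eq_sum_card_bipartiteBelow R
    have e2 : ∑ l ∈ Y, ((U.filter fun x => R x l).card : ℝ)
        ≤ ∑ l ∈ Y, (δ / 2 * U.card + if l ∈ Y₁ then (U.card : ℝ) else 0) := by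
      refine Finset.sum_le_sum fun l hl => ?_
      split_ifs with h
      · have : ((U.filter fun x => R x l).card : ℝ) ≤ U.card := by
          exact_mod_cast Finset.card_filter_le _ _
        have : 0 ≤ δ / 2 * U.card := by positivity
        linarith
      · have : ¬ δ / 2 * U.card ≤ ((U.filter fun x => R x l).card : ℝ) := fun h' =>
          h (Finset.mem_filter.mpr ⟨hl, h'⟩)
        linarith
    have e3 : ∑ l ∈ Y, (δ / 2 * U.card + if l ∈ Y₁ then (U.card : ℝ) else 0)
        = Y.card * (δ / 2 * U.card) + Y₁.card * U.card := by
      rw [Finset.sum_add_distrib, Finset.sum_ite_mem, Finset.inter_eq_right.mpr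
        (Finset.filter_subset _ _), Finset.sum_const, Finset.sum_const, nsmul_eq_mul, nsmul_eq_mul]
    rw [e1] at hsum
    have : δ / 2 * Y.card * U.card ≤ Y₁.card * U.card := by linarith
    exact le_of_mul_le_mul_right this hU'
  obtain ⟨ys, hl, hn, hm, hc⟩ := exists_common_of_degree U Y₁ R (η := δ / 2) (by positivity)
    (by linarith) (fun l hl => (Finset.mem_filter.mp hl).2) t (by linarith)
  refine ⟨ys, hl, hn, hm, ?_⟩
  calc (δ / 4) ^ t * (δ / 2) * Y.card = (δ / 4) ^ t * (δ / 2 * Y.card) := by ring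
    _ ≤ (δ / 4) ^ t * Y₁.card := by gcongr
    _ = (δ / 2 / 2) ^ t * Y₁.card := by ring_nf
    _ ≤ _ := hc
    _ ≤ _ := by
      exact_mod_cast Finset.card_le_card (Finset.filter_subset_filter _ (Finset.filter_subset _ _))

/-- A positive proportion of the `m`-tuples contains all transversals of `m` sets of size `t`. -/
theorem exists_box (m t : ℕ) (δ : ℝ) (h0 : 0 < δ) (h1 : δ ≤ 1) :
    ∃ N₀ : ℕ, ∀ {V : Type} [DecidableEq V] (U : Finset V), N₀ ≤ U.card →
      ∀ P : List V → Prop, δ * (U.card : ℝ) ^ m ≤ (((lists U m).filter P).card : ℝ) →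
      ∃ X : ℕ → ℕ → V, (∀ i a, X i a ∈ U) ∧ (∀ i < m, Set.InjOn (X i) (Set.Iio t)) ∧
        ∀ f : ℕ → ℕ, (∀ i, f i < t) → P ((List.range m).map fun i => X i (f i)) := by
  induction m generalizing δ with
  | zero =>
    refine ⟨1, fun {V} _ U hU P hP => ?_⟩
    obtain ⟨u, hu⟩ := Finset.card_pos.mp hU
    refine ⟨fun _ _ => u, fun _ _ => hu, by simp, fun f _ => ?_⟩
    have : 0 < ((lists U 0).filter P).card := by
      rw [← Nat.cast_pos (α := ℝ)]
      simp at hP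
      linarith
    obtain ⟨l, hl⟩ := Finset.card_pos.mp this
    simp [lists] at hl
    simpa [hl.1] using hl.2
  | succ m ih =>
    have h0' : 0 < (δ / 4) ^ t * (δ / 2) := by positivity
    have h1' : (δ / 4) ^ t * (δ / 2) ≤ 1 :=
      mul_le_one₀ (pow_le_one₀ (by positivity) (by linarith)) (by positivity) (by linarith)
    obtain ⟨N₁, hN₁⟩ := ih _ h0' h1'
    refine ⟨max N₁ (⌈4 / δ * t⌉₊ + 1), fun {V} _ U hU P hP => ?_⟩
    have hUN : N₁ ≤ U.card := le_trans (le_max_left _ _) hU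
    have hUt : ⌈4 / δ * t⌉₊ + 1 ≤ U.card := le_trans (le_max_right _ _) hU
    have hUt' : (t : ℝ) ≤ δ / 4 * U.card := by
      have h : ⌈4 / δ * t⌉₊ ≤ U.card := by omega
      have : 4 / δ * t ≤ U.card := (Nat.le_ceil _).trans (Nat.cast_le.mpr h)
      calc (t : ℝ) = δ / 4 * (4 / δ * t) := by field_simp
        _ ≤ _ := by gcongr
    obtain ⟨u, hu⟩ := Finset.card_pos.mp (show 0 < U.card by omega)
    rw [card_lists_filter_succ] at hP
    obtain ⟨ys, hl, hn, hm, hc⟩ := exists_common U (lists U m) (fun x l => P (x :: l)) h0 h1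
      (by rw [card_lists]; push_cast at hP ⊢; rw [pow_succ] at hP; linarith) t (by omega) hUt'
    rw [card_lists] at hc
    push_cast at hc
    obtain ⟨X, hX1, hX2, hX3⟩ := hN₁ U hUN (fun l => ∀ x ∈ ys, P (x :: l))
      (by convert hc)
    have hget : ∀ a, a < t → ys.getD a u ∈ ys := by
      intro a ha
      rw [List.getD_eq_getElem _ _ (by omega)]
      exact List.getElem_mem _
    refine ⟨fun i => Nat.casesOn i (fun a => ys.getD a u) X, ?_, ?_, ?_⟩
    · rintro (_ | i) a
      · by_cases ha : a < t
        · exact hm _ (hget a ha)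
        · have : ys.getD a u = u := List.getD_eq_default _ _ (by omega)
          change ys.getD a u ∈ U
          rwa [this]
      · exact hX1 i a
    · rintro (_ | i) hi
      · intro a ha b hb hab
        simp only [Set.mem_Iio] at ha hb
        change ys.getD a u = ys.getD b u at hab
        rw [List.getD_eq_getElem _ _ (by omega), List.getD_eq_getElem _ _ (by omega)] at hab
        exact (List.Nodup.getElem_inj_iff hn).mp hab
      · exact hX2 i (by omega)
    · intro f hf
      have := hX3 (fun i => f (i + 1)) (fun i => hf _) _ (hget _ (hf 0))
      rw [List.range_succ_eq_map]
      simpa [Function.comp_def] using this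

end Box

section Lift

variable {V : Type} [DecidableEq V] {E : Finset (Finset V)} {r t : ℕ}

theorem nodup_of_card_toFinset {l : List V} (h : l.toFinset.card = l.length) : l.Nodup := by
  rw [List.card_toFinset] at h
  rw [← (List.dedup_sublist l).eq_of_length h]
  exact List.nodup_dedup l

theorem nodup_of_mem_edges (hE : ∀ e ∈ E, e.card = r + 1) {l : List V} (hl : l.length = r + 1)
    (h : l.toFinset ∈ E) : l.Nodup :=
  nodup_of_card_toFinset (by rw [hE _ h, hl])

/-- If a walk is tight for every choice of representatives, then its entries may be replaced by
pairwise different representatives. -/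
theorem tight_lift (hE : ∀ e ∈ E, e.card = r + 1) (X : ℕ → ℕ → V) (ht : 0 < t)
    (Z : List ((ℕ × ℕ) ⊕ V)) (hZ : ∀ i b, Sum.inl (i, b) ∈ Z → b < t)
    (h : ∀ f : ℕ → ℕ, (∀ i, f i < t) →
      Tight E r (Z.map (Sum.elim (fun p => X p.1 (f p.1)) id))) :
    Tight E r (Z.map (Sum.elim (fun p => X p.1 p.2) id)) := by
  rw [tight_iff]
  intro i hi
  rw [← List.map_drop, ← List.map_take]
  set z := (Z.drop i).take (r + 1) with hz
  have hzZ : z ⊆ Z := fun p hp => List.mem_of_mem_drop (List.mem_of_mem_take hp)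
  have hzl : z.length = r + 1 := by
    rw [List.length_map] at hi
    rw [hz, List.length_take, List.length_drop]; omega
  let f : ℕ → ℕ := fun j => if hj : ∃ b, Sum.inl (j, b) ∈ z then hj.choose else 0
  have hf : ∀ j, f j < t := by
    intro j
    by_cases hj : ∃ b, (Sum.inl (j, b) : (ℕ × ℕ) ⊕ V) ∈ z
    · simp only [f, dif_pos hj]; exact hZ _ _ (hzZ hj.choose_spec)
    · simp only [f, dif_neg hj]; exact ht
  have hmem := (tight_iff.mp (h f hf)) i (by simpa using hi)
  rw [← List.map_drop, ← List.map_take, ← hz] at hmem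
  have hnd : (z.map (Sum.elim (fun p => X p.1 (f p.1)) id)).Nodup := by
    refine nodup_of_card_toFinset ?_
    rw [hE _ hmem, List.length_map, hzl]
  have hinj := List.inj_on_of_nodup_map hnd
  have : z.map (Sum.elim (fun p => X p.1 (f p.1)) id)
      = z.map (Sum.elim (fun p => X p.1 p.2) id) := by
    refine List.map_congr_left ?_
    rintro (⟨j, b⟩ | v) hp
    · have hj : ∃ b, (Sum.inl (j, b) : (ℕ × ℕ) ⊕ V) ∈ z := ⟨b, hp⟩
      have h1 : f j = hj.choose := by simp only [f, dif_pos hj]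
      have := hinj hp hj.choose_spec (by simp)
      simp at this
      simp [h1, ← this]
    · rfl
  rwa [← this]

end Lift

section Walk

/-- For lists `c`, `d`, `zs` of equal length, the walk that starts with `a ++ c`, replaces the
entries of `c` one by one by those of `zs`, and then those of `zs` by the entries of `d`. -/
def walk {α : Type} : List α → List α → List α → List α → List α
  | a, x :: c, y :: d, z :: zs => (a ++ x :: c) ++ (walk (a ++ [z]) c d zs ++ (a ++ y :: d))
  | a, _, _, _ => a

variable {α : Type}

theorem walk_map {β : Type} (g : α → β) (a c d zs : List α) :
    walk (a.map g) (c.map g) (d.map g) (zs.map g) = (walk a c d zs).map g := by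
  induction c generalizing a d zs with
  | nil => simp [walk]
  | cons x c ih =>
    rcases d with _ | ⟨y, d⟩ <;> rcases zs with _ | ⟨z, zs⟩ <;> simp [walk]
    rw [← ih]; simp

theorem mem_walk {a c d zs : List α} {u : α} (h : u ∈ walk a c d zs) :
    u ∈ a ∨ u ∈ c ∨ u ∈ d ∨ u ∈ zs := by
  induction c generalizing a d zs with
  | nil => simp [walk] at h; exact Or.inl h
  | cons x c ih =>
    rcases d with _ | ⟨y, d⟩ <;> rcases zs with _ | ⟨z, zs⟩ <;> simp [walk] at h
    · exact Or.inl h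
    · exact Or.inl h
    · exact Or.inl h
    · rcases h with h | h | h | h | h | h | h
      · simp [h]
      · simp [h]
      · simp [h]
      · have := ih h; simp at this ⊢; tauto
      · simp [h]
      · simp [h]
      · simp [h]

theorem walk_eq_append {a c d zs : List α} (h1 : c.length = d.length) (h2 : c.length = zs.length) :
    (∃ p, walk a c d zs = (a ++ c) ++ p) ∧ ∃ s, walk a c d zs = s ++ (a ++ d) := by
  rcases c with _ | ⟨x, c⟩ <;> rcases d with _ | ⟨y, d⟩ <;> rcases zs with _ | ⟨z, zs⟩ <;>
    simp at h1 h2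
  · simp [walk]
  · refine ⟨⟨walk (a ++ [z]) c d zs ++ (a ++ y :: d), rfl⟩,
      ⟨(a ++ x :: c) ++ walk (a ++ [z]) c d zs, ?_⟩⟩
    simp [walk]

variable {V : Type} [Fintype V] [DecidableEq V] {E : Finset (Finset V)} {r : ℕ}

theorem rich_walk (hE : ∀ e ∈ E, e.card = r + 1) {U : Finset V} {c₀ d₀ : ℝ}
    (hcod : Cod E r U c₀) (hd : d₀ ≤ 2 * c₀ - U.card) (a c d : List V)
    (hcd : c.length = d.length) (hac : a.length + c.length = r + 1)
    (hc : (a ++ c).toFinset ∈ E) (hd' : (a ++ d).toFinset ∈ E) :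
    Rich U d₀ c.length fun zs => Tight E r (walk a c d zs) := by
  induction c generalizing a d with
  | nil =>
    change Tight E r (walk a [] d [])
    simp only [walk]
    exact tight_of_toFinset_mem (by simpa using hac) (by simpa using hc)
  | cons x c ih =>
    obtain _ | ⟨y, d⟩ := d
    · simp at hcd
    simp at hcd hac
    have key : ∀ (w : V) (e : List V), e.length = c.length → (a ++ w :: e).toFinset ∈ E →
        (a ++ e).toFinset.card = r := by
      intro w e he hw
      have := nodup_of_mem_edges hE (by simp; omega) hw
      have h2 : (a ++ e).Nodup :=
        this.sublist (List.Sublist.append_left (List.sublist_cons_self _ _) _)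
      rw [List.toFinset_card_of_nodup h2]; simp; omega
    refine ⟨nb E (a ++ c).toFinset ∩ nb E (a ++ d).toFinset ∩ U, Finset.inter_subset_right,
      hd.trans (hcod.two (key x c rfl hc) (key y d hcd.symm hd')), fun z hz => ?_⟩
    simp only [Finset.mem_inter, mem_nb] at hz
    have hzc : (a ++ z :: c).toFinset ∈ E := by
      convert hz.1.1.2 using 1; ext; simp
    have hzd : (a ++ z :: d).toFinset ∈ E := by
      convert hz.1.2.2 using 1; ext; simp
    refine (ih (a ++ [z]) d hcd (by simp; omega) (by simpa using hzc) (by simpa using hzd)).mono ?_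
    intro zs hzs ht
    obtain ⟨⟨p, hp⟩, ⟨s, hs⟩⟩ := walk_eq_append (a := a ++ [z]) hcd hzs.symm
    have h1 : Tight E r ((a ++ x :: c) ++ walk (a ++ [z]) c d zs) := by
      rw [hp] at ht ⊢
      rw [← List.append_assoc]
      refine Tight.glue (by simp; omega) ?_ ht
      simpa using tight_replace (by omega) hc hzc
    have h2 : Tight E r (walk (a ++ [z]) c d zs ++ (a ++ y :: d)) := by
      rw [hs] at ht ⊢
      refine Tight.glue (by simp; omega) ht ?_
      simpa using tight_replace (by omega) hzd hd'
    simp only [walk]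
    rw [← List.append_assoc]
    refine Tight.glue ?_ h1 h2
    rw [hp]; simp; omega

theorem rich_two (hr : 1 ≤ r) {U : Finset V} {c₀ d₀ : ℝ}
    (hcod : Cod E r U c₀) (hd : d₀ ≤ 2 * c₀ - U.card) (m : ℕ) (p q : List V)
    (hp : p.length = r) (hq : q.length = r) (hpn : p.Nodup) (hqn : q.Nodup) :
    Rich U d₀ m fun l => Tight E r (p ++ l) ∧ Tight E r (q ++ l) := by
  induction m generalizing p q with
  | zero => exact ⟨tight_of_length_le (by simp [hp]), tight_of_length_le (by simp [hq])⟩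
  | succ m ih =>
    refine ⟨nb E p.toFinset ∩ nb E q.toFinset ∩ U, Finset.inter_subset_right,
      hd.trans (hcod.two (by rw [List.toFinset_card_of_nodup hpn, hp])
        (by rw [List.toFinset_card_of_nodup hqn, hq])), fun x hx => ?_⟩
    simp only [Finset.mem_inter, mem_nb, List.mem_toFinset] at hx
    have key : ∀ s : List V, s.length = r → s.Nodup → x ∉ s →
        (s.tail ++ [x]).length = r ∧ (s.tail ++ [x]).Nodup := by
      intro s h1 h2 h3
      refine ⟨by simp; omega, ?_⟩
      rw [List.nodup_append]
      refine ⟨h2.sublist (List.tail_sublist _), by simp, ?_⟩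
      intro u hu v hv
      simp at hv
      rintro rfl
      exact h3 (hv ▸ List.mem_of_mem_tail hu)
    obtain ⟨h1, h2⟩ := key p hp hpn hx.1.1.1
    obtain ⟨h3, h4⟩ := key q hq hqn hx.1.2.1
    refine (ih _ _ h1 h3 h2 h4).mono ?_
    rintro l - ⟨h5, h6⟩
    exact ⟨Tight.step hr hp hx.1.1.2 (by simpa using h5),
      Tight.step hr hq hx.1.2.2 (by simpa using h6)⟩

/-- The walk determined by the list of `3 * k` vertices. -/
def walkOf (k : ℕ) (l : List α) : List α :=
  walk [] (l.take k) ((l.drop k).take k).reverse (l.drop (k + k))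

theorem walkOf_map {β : Type} (k : ℕ) (g : α → β) (l : List α) :
    walkOf k (l.map g) = (walkOf k l).map g := by
  simp [walkOf, ← walk_map, List.map_take, List.map_drop]

theorem mem_of_mem_walkOf {k : ℕ} {l : List α} {u : α} (h : u ∈ walkOf k l) : u ∈ l := by
  rcases mem_walk h with h | h | h | h
  · simp at h
  · exact List.mem_of_mem_take h
  · exact List.mem_of_mem_drop (List.mem_of_mem_take (List.mem_reverse.mp h))
  · exact List.mem_of_mem_drop h

theorem rich_walkOf (hE : ∀ e ∈ E, e.card = r + 1) (hr : 1 ≤ r) {U : Finset V} {c₀ d₀ : ℝ}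
    (hcod : Cod E r U c₀) (hd : d₀ ≤ 2 * c₀ - U.card) (s t : List V)
    (hs : s.length = r) (ht : t.length = r) (hsn : s.Nodup) (htn : t.Nodup) :
    Rich U d₀ ((r + 1) + (r + 1) + (r + 1)) fun l => Tight E r (s ++ walkOf (r + 1) l ++ t) := by
  have H1 : Rich U d₀ ((r + 1) + (r + 1)) fun l =>
      Tight E r (s ++ l.take (r + 1)) ∧ Tight E r (t.reverse ++ l.drop (r + 1)) := by
    refine (rich_two hr hcod hd (r + 1) s s hs hs hsn hsn).bind ?_
    rintro c hc ⟨hc1, -⟩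
    refine (rich_two hr hcod hd (r + 1) t.reverse t.reverse (by simpa) (by simpa) (by simpa)
      (by simpa)).mono ?_
    rintro d hd ⟨hd1, -⟩
    rw [← hc, List.take_left, List.drop_left]
    exact ⟨hc1, hd1⟩
  refine H1.bind ?_
  rintro l hl ⟨h1, h2⟩
  set c := l.take (r + 1) with hc
  set d := (l.drop (r + 1)).reverse with hdd
  have hcl : c.length = r + 1 := by rw [hc, List.length_take]; omega
  have hdl : d.length = r + 1 := by rw [hdd, List.length_reverse, List.length_drop]; omega
  have h2' : Tight E r (d ++ t) := by simpa [hdd] using h2.reverse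
  have hcE := h1 c (List.suffix_append _ _).isInfix hcl
  have hdE := h2' d (List.prefix_append _ _).isInfix hdl
  have := rich_walk hE hcod hd [] c d (by omega) (by simpa using hcl) (by simpa) (by simpa)
  rw [hcl] at this
  refine this.mono ?_
  intro zs hzs hw
  have e : walkOf (r + 1) (l ++ zs) = walk [] c d zs := by
    have e1 : (l ++ zs).take (r + 1) = c := List.take_append_of_le_length (by omega)
    have e2 : ((l ++ zs).drop (r + 1)).take (r + 1) = l.drop (r + 1) := by
      rw [List.drop_append_of_le_length (by omega)]
      exact List.take_left' (by rw [List.length_drop]; omega)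
    have e3 : (l ++ zs).drop (r + 1 + (r + 1)) = zs := List.drop_left' hl
    rw [walkOf, e1, e2, e3]
  rw [e]
  obtain ⟨⟨p, hp⟩, ⟨q, hq⟩⟩ := walk_eq_append (a := []) (c := c) (d := d) (zs := zs)
    (by omega) (by omega)
  have h3 : Tight E r (s ++ walk [] c d zs) := by
    rw [hp] at hw ⊢
    rw [← List.append_assoc]
    exact Tight.glue (by simp; omega) (by simpa using h1) hw
  have h4 : Tight E r (walk [] c d zs ++ t) := by
    rw [hq] at hw ⊢
    exact Tight.glue (by simp; omega) hw (by simpa using h2')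
  refine Tight.glue ?_ h3 h4
  rw [hp]; simp; omega

/-- In a dense hypergraph, any two `r`-tuples are connected by a tight path with a bounded number
of inner vertices. -/
theorem exists_connection (hr : 1 ≤ r) {γ : ℝ} (hγ : 0 < γ) :
    ∃ C N₀ : ℕ, ∀ {V : Type} [Fintype V] [DecidableEq V] (E : Finset (Finset V)),
      (∀ e ∈ E, e.card = r + 1) → ∀ U : Finset V, N₀ ≤ U.card →
      Cod E r U ((1 / 2 + γ) * U.card) → ∀ s t : List V, s.length = r → t.length = r →
      s.Nodup → t.Nodup → ∃ m : List V, m.length = C ∧ m.Nodup ∧ (∀ x ∈ m, x ∈ U) ∧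
        Tight E r (s ++ m ++ t) := by
  set k := r + 1 with hk
  set W := walkOf k (List.range (k + k + k)) with hW
  set δ := min 1 (γ ^ (k + k + k)) with hδ
  have hδ0 : 0 < δ := lt_min one_pos (by positivity)
  obtain ⟨N₁, hbox⟩ := exists_box (k + k + k) (W.length + 1) δ hδ0 (min_le_left _ _)
  refine ⟨W.length, max N₁ ⌈(k + k + k) / γ⌉₊, ?_⟩
  intro V _ _ E hE U hU hcod s t hs ht hsn htn
  have hU1 : N₁ ≤ U.card := (le_max_left _ _).trans hU
  have hU2 : ((k : ℝ) + k + k) ≤ γ * U.card := by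
    have h : ⌈((k : ℝ) + k + k) / γ⌉₊ ≤ U.card := (le_max_right _ _).trans hU
    have := (Nat.le_ceil _).trans (Nat.cast_le (α := ℝ).mpr h)
    rw [div_le_iff₀ hγ] at this
    linarith
  have hrich := (rich_walkOf hE hr hcod le_rfl s t hs ht hsn htn).avoid (d' := γ * U.card) ∅
    (by push_cast [← hk] at hU2 ⊢; simp only [Finset.card_empty]; push_cast; linarith)
  have hcount := hrich.le_card (by positivity)
  obtain ⟨X, hXU, hXinj, hX⟩ := hbox U hU1
    (fun l => Tight E r (s ++ walkOf k l ++ t) ∧ l.Nodup ∧ ∀ x ∈ l, x ∉ (∅ : Finset V)) (by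
      refine le_trans ?_ hcount
      rw [mul_pow]
      gcongr
      exact min_le_right _ _)
  have hWlt : ∀ i ∈ W, i < k + k + k := fun i hi => List.mem_range.mp (mem_of_mem_walkOf hi)
  have hzip : ∀ i b, (i, b) ∈ W.zipIdx → i < k + k + k ∧ b < W.length + 1 := by
    intro i b h
    have := List.mem_zipIdx h
    refine ⟨hWlt i ?_, by omega⟩
    rw [this.2.2]; exact List.getElem_mem _
  refine ⟨W.zipIdx.map fun p => X p.1 p.2, by simp, ?_, ?_, ?_⟩
  · refine List.Nodup.map_on ?_ ?_
    · rintro ⟨i, b⟩ h1 ⟨i', b'⟩ h2 h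
      obtain ⟨hi, hb⟩ := hzip _ _ h1
      obtain ⟨hi', hb'⟩ := hzip _ _ h2
      by_cases hii : i = i'
      · subst hii
        rw [hXinj i hi hb hb' h]
      · exfalso
        have := (hX (fun j => if j = i then b else b') (by intro j; split_ifs <;> assumption)).2.1
        have h3 := List.inj_on_of_nodup_map this (List.mem_range.mpr hi) (List.mem_range.mpr hi')
        simp only [if_true, if_neg (Ne.symm hii)] at h3
        exact hii (h3 h)
    · refine List.Nodup.of_map Prod.snd ?_
      rw [List.zipIdx_map_snd]
      exact List.nodup_range'
  · intro x hx
    obtain ⟨p, -, rfl⟩ := List.mem_map.mp hx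
    exact hXU _ _
  · have := tight_lift hE X (t := W.length + 1) (by omega)
      (s.map Sum.inr ++ W.zipIdx.map Sum.inl ++ t.map Sum.inr) (by
        intro i b h
        simp at h
        exact (hzip i b h).2) (by
        intro f hf
        have := (hX f hf).1
        rw [walkOf_map, ← hW] at this
        convert this using 1
        simp only [List.map_append, List.map_map]
        congr 1
        · congr 1
          · simp
          · conv_rhs => rw [← List.zipIdx_map_fst 0 W, List.map_map]
            rfl
        · simp)
    simpa [Function.comp_def] using this

end Walk

section DensePath

variable {V : Type} [Fintype V] [DecidableEq V] {ρ : ℕ}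

theorem exists_subset_degree (D : ℕ) (S : Finset (Finset V)) (H : Finset (Finset V))
    (hS : ∀ s : Finset V, s.card = ρ → (nb H s).Nonempty → s ∈ S) (hD : D * S.card < H.card) :
    ∃ H' ⊆ H, H'.Nonempty ∧ ∀ s : Finset V, s.card = ρ → (nb H' s).Nonempty →
      D < (nb H' s).card := by
  induction hc : S.card generalizing S H with
  | zero =>
    refine ⟨H, subset_rfl, Finset.card_pos.mp (by omega), fun s hs hne => ?_⟩
    have := hS s hs hne
    rw [Finset.card_eq_zero.mp hc] at this
    simp at this
  | succ m ih =>
    by_cases hH : ∀ s : Finset V, s.card = ρ → (nb H s).Nonempty → D < (nb H s).card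
    · exact ⟨H, subset_rfl, Finset.card_pos.mp (by omega), hH⟩
    · push Not at hH
      obtain ⟨s, hs, hne, hle⟩ := hH
      have hsS := hS s hs hne
      set H₁ := H \ (nb H s).image (fun x => insert x s) with hH₁
      have hcard : H.card ≤ H₁.card + (nb H s).card := by
        have h1 : H.card - ((nb H s).image (fun x => insert x s)).card ≤ H₁.card := by
          convert Finset.le_card_sdiff ((nb H s).image (fun x => insert x s)) H
        have h2 : ((nb H s).image (fun x => insert x s)).card ≤ (nb H s).card :=
          Finset.card_image_le
        omega
      have hsub : ∀ t, nb H₁ t ⊆ nb H t := by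
        intro t x
        simp only [mem_nb, hH₁, Finset.mem_sdiff]
        tauto
      have hse : (S.erase s).card = m := by rw [Finset.card_erase_of_mem hsS]; omega
      obtain ⟨H', h1, h2, h3⟩ := ih (S.erase s) H₁ (by
        intro t ht hne'
        rw [Finset.mem_erase]
        refine ⟨?_, hS t ht (hne'.mono (hsub t))⟩
        rintro rfl
        obtain ⟨x, hx⟩ := hne'
        have hx' := hsub _ hx
        rw [mem_nb, hH₁, Finset.mem_sdiff] at hx
        exact hx.2.2 (Finset.mem_image_of_mem _ hx')) (by
        rw [hse]; rw [hc] at hD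
        have : D * (m + 1) = D * m + D := by ring
        omega) hse
      exact ⟨H', h1.trans Finset.sdiff_subset, h2, h3⟩

theorem exists_tight_of_degree (D : ℕ) {L : Finset V} {H : Finset (Finset V)}
    (hH : ∀ e ∈ H, e.card = ρ + 1 ∧ e ⊆ L) (hne : H.Nonempty)
    (hdeg : ∀ s : Finset V, s.card = ρ → (nb H s).Nonempty → D < (nb H s).card)
    (m : ℕ) (hm : ρ + 1 + m ≤ D) :
    ∃ l : List V, l.length = ρ + 1 + m ∧ l.Nodup ∧ (∀ x ∈ l, x ∈ L) ∧ Tight H ρ l := by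
  induction m with
  | zero =>
    obtain ⟨e, he⟩ := hne
    refine ⟨e.toList, by simp [(hH e he).1], e.nodup_toList, fun x hx =>
      (hH e he).2 (by simpa using hx),
      tight_of_toFinset_mem (by simp [(hH e he).1]) (by simpa using he)⟩
  | succ m ih =>
    obtain ⟨l, hl, hn, hL, ht⟩ := ih (by omega)
    have hA : (l.take ρ).toFinset.card = ρ := by
      rw [List.toFinset_card_of_nodup (hn.sublist (List.take_sublist _ _)), List.length_take]
      omega
    have hnb : (nb H (l.take ρ).toFinset).Nonempty := by
      refine ⟨l[ρ]'(by omega), ?_⟩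
      have h1 := ht (l.take (ρ + 1)) (List.take_prefix _ _).isInfix
        (by rw [List.length_take]; omega)
      have h2 : l.take (ρ + 1) = l.take ρ ++ [l[ρ]'(by omega)] :=
        (List.take_concat_get' l ρ (by omega)).symm
      have h3 : (l.take (ρ + 1)).Nodup := hn.sublist (List.take_sublist _ _)
      rw [h2] at h1 h3
      rw [mem_nb]
      refine ⟨?_, ?_⟩
      · rw [List.mem_toFinset]
        intro hmem
        exact (List.nodup_append.mp h3).2.2 _ hmem _ (List.mem_singleton_self _) rfl
      · convert h1 using 1
        ext z
        rw [List.mem_toFinset, List.mem_append, Finset.mem_insert, List.mem_toFinset,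
          List.mem_singleton, or_comm]
    have hlt := hdeg _ hA hnb
    obtain ⟨x, hx, hxl⟩ := Finset.exists_mem_notMem_of_card_lt_card
      (show l.toFinset.card < (nb H (l.take ρ).toFinset).card by
        have := List.toFinset_card_le l
        omega)
    rw [List.mem_toFinset] at hxl
    rw [mem_nb] at hx
    refine ⟨x :: l, by simp; omega, by simp [hxl, hn], ?_, ?_⟩
    · intro y hy
      rcases List.mem_cons.mp hy with rfl | hy
      · exact (hH _ hx.2).2 (Finset.mem_insert_self _ _)
      · exact hL y hy
    · have := Tight.glue (E := H) (r := ρ) (a := [x]) (m := l.take ρ) (b := l.drop ρ)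
        (by rw [List.length_take]; omega)
        (tight_of_toFinset_mem (by rw [List.length_append, List.length_take]; simp; omega)
          (by simpa using hx.2)) (by rwa [List.take_append_drop])
      simpa using this

theorem exists_tight_of_card (K : ℕ) {L : Finset V} {H : Finset (Finset V)}
    (hH : ∀ e ∈ H, e.card = ρ + 1 ∧ e ⊆ L) (hcard : (K + ρ + 1) * L.card ^ ρ < H.card) :
    ∃ l : List V, l.length = K ∧ l.Nodup ∧ (∀ x ∈ l, x ∈ L) ∧ Tight H ρ l := by
  obtain ⟨H', h1, h2, h3⟩ := exists_subset_degree (ρ := ρ) (K + ρ + 1) (L.powersetCard ρ) H (by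
    rintro s hs ⟨x, hx⟩
    rw [mem_nb] at hx
    rw [Finset.mem_powersetCard]
    exact ⟨(Finset.subset_insert _ _).trans (hH _ hx.2).2, hs⟩) (by
    rw [Finset.card_powersetCard]
    exact lt_of_le_of_lt (Nat.mul_le_mul_left _ (Nat.choose_le_pow _ _)) hcard)
  obtain ⟨l, h4, h5, h6, h7⟩ := exists_tight_of_degree (K + ρ + 1) (fun e he => hH e (h1 he)) h2 h3
    K (by omega)
  refine ⟨l.take K, by rw [List.length_take]; omega, h5.sublist (List.take_sublist _ _),
    fun x hx => h6 x (List.mem_of_mem_take hx), fun w hw hlen => h1 (h7 w ?_ hlen)⟩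
  exact hw.trans (List.take_prefix _ _).isInfix

end DensePath

section Interleave

variable {V : Type}

/-- The list obtained from `l` by inserting the entries of `q`, one after every `r` entries. -/
def interleave (r : ℕ) : List V → List V → List V
  | l, [] => l
  | l, q :: qs => l.take r ++ q :: interleave r (l.drop r) qs

theorem interleave_perm (r : ℕ) (l qs : List V) : (interleave r l qs).Perm (l ++ qs) := by
  induction qs generalizing l with
  | nil => simp [interleave]
  | cons q qs ih =>
    rw [interleave]
    calc (l.take r ++ q :: interleave r (l.drop r) qs).Perm
          (l.take r ++ q :: (l.drop r ++ qs)) := ((ih _).cons q).append_left _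
      _ = l.take r ++ ([q] ++ l.drop r ++ qs) := by simp
      _ |>.Perm (l.take r ++ (l.drop r ++ [q] ++ qs)) :=
          (List.perm_append_comm.append_right _).append_left _
      _ = (l.take r ++ l.drop r) ++ q :: qs := by
          simp only [List.append_assoc, List.singleton_append]
      _ = l ++ q :: qs := by rw [List.take_append_drop]

theorem exists_chunks {K : ℕ} (hK : 1 ≤ K) (l : List V) (hl : K ≤ l.length) :
    ∃ Q : List (List V), Q.flatten = l ∧ ∀ q ∈ Q, K ≤ q.length ∧ q.length < 2 * K := by
  induction hn : l.length using Nat.strong_induction_on generalizing l with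
  | _ n ih =>
    by_cases h : l.length < 2 * K
    · exact ⟨[l], by simp, by simp [hl, h]⟩
    · obtain ⟨Q, h1, h2⟩ := ih (n - K) (by omega) (l.drop K) (by rw [List.length_drop]; omega)
        (by rw [List.length_drop, hn])
      refine ⟨l.take K :: Q, by simp [h1], ?_⟩
      intro q hq
      rcases List.mem_cons.mp hq with rfl | hq
      · rw [List.length_take]; omega
      · exact h2 q hq

variable [DecidableEq V] {E H : Finset (Finset V)} {r : ℕ}

theorem tight_interleave (hr : 1 ≤ r) (l qs : List V) (hl : l.length = (qs.length + 1) * r)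
    (ht : Tight H (r - 1) l) (hE : ∀ A ∈ H, ∀ q ∈ qs, insert q A ∈ E) :
    Tight E r (interleave r l qs) ∧ l.take r <+: interleave r l qs := by
  induction qs generalizing l with
  | nil =>
    simp at hl
    exact ⟨tight_of_length_le (by simp [interleave, hl]), List.take_prefix _ _⟩
  | cons q qs ih =>
    rw [List.length_cons, Nat.add_mul, Nat.one_mul] at hl
    obtain ⟨h1, ⟨s, hs⟩⟩ := ih (l.drop r) (by rw [List.length_drop]; omega)
      (ht.infix (List.drop_suffix _ _).isInfix) (fun A hA p hp => hE A hA p (by simp [hp]))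
    have hge : r ≤ (qs.length + 1) * r := Nat.le_mul_of_pos_left _ (by omega)
    have hb : ((l.drop r).take r).length = r := by
      rw [List.length_take, List.length_drop]; omega
    rw [interleave]
    refine ⟨?_, List.prefix_append _ _⟩
    rw [← hs] at h1 ⊢
    have := Tight.glue (E := E) (r := r) (a := l.take r ++ [q]) (m := (l.drop r).take r) (b := s)
      hb.ge (by
        rw [List.append_assoc]
        refine tight_insert_between (by rw [List.length_take]; omega) hb fun w hw hwl => ?_
        have hin : l.take r ++ (l.drop r).take r <:+: l := by
          rw [← List.take_add]
          exact (List.take_prefix _ _).isInfix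
        exact hE _ (ht w (hw.trans hin) (by omega)) q (by simp)) h1
    simpa using this

end Interleave

section Cover

theorem infix_flatten_of_mem {α : Type} {q : List α} {Q : List (List α)} (h : q ∈ Q) :
    q <:+: Q.flatten := by
  obtain ⟨s, t, rfl⟩ := List.append_of_mem h
  exact ⟨s.flatten, t.flatten, by simp⟩

variable {V : Type} [DecidableEq V] {E : Finset (Finset V)} {r K : ℕ} {U : Finset V}

/-- `Ps` is a family of disjoint tight paths in `U`, each with at least `K` and less than `2 * K`
vertices. -/
def IsPacking (E : Finset (Finset V)) (r : ℕ) (U : Finset V) (K : ℕ) (Ps : List (List V)) : Prop :=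
  Ps.flatten.Nodup ∧ (∀ x ∈ Ps.flatten, x ∈ U) ∧
    ∀ Q ∈ Ps, Tight E r Q ∧ K ≤ Q.length ∧ Q.length < 2 * K

theorem IsPacking.of_perm {Ps Ps' : List (List V)} (h : IsPacking E r U K Ps) (hp : Ps.Perm Ps') :
    IsPacking E r U K Ps' :=
  ⟨hp.flatten.nodup_iff.mp h.1, fun x hx => h.2.1 x (hp.flatten.mem_iff.mpr hx),
    fun Q hQ => h.2.2 Q (hp.mem_iff.mpr hQ)⟩

theorem IsPacking.extend {l : List V} {Ps : List (List V)} (hK : 1 ≤ K)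
    (h : IsPacking E r U K Ps) (hl : Tight E r l) (hn : l.Nodup) (hlen : K ≤ l.length)
    (hlU : ∀ x ∈ l, x ∈ U) (hlP : ∀ x ∈ l, x ∉ Ps.flatten) :
    ∃ Ps', IsPacking E r U K Ps' ∧ Ps'.flatten.length = l.length + Ps.flatten.length := by
  obtain ⟨c, hc, hcl⟩ := exists_chunks hK l hlen
  obtain ⟨h1, h2, h3⟩ := h
  refine ⟨c ++ Ps, ⟨?_, ?_, ?_⟩, ?_⟩
  · rw [List.flatten_append, hc, List.nodup_append]
    refine ⟨hn, h1, ?_⟩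
    rintro a ha b hb rfl
    exact hlP a ha hb
  · intro x hx
    rw [List.flatten_append, hc, List.mem_append] at hx
    rcases hx with hx | hx
    · exact hlU x hx
    · exact h2 x hx
  · intro q hq
    rcases List.mem_append.mp hq with hq | hq
    · refine ⟨hl.infix ?_, hcl q hq⟩
      rw [← hc]
      exact infix_flatten_of_mem hq
    · exact h3 q hq
  · rw [List.flatten_append, hc, List.length_append]

theorem IsPacking.tail {Q : List V} {Ps : List (List V)} (h : IsPacking E r U K (Q :: Ps)) :
    IsPacking E r U K Ps := by
  obtain ⟨h1, h2, h3⟩ := h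
  rw [List.flatten_cons] at h1 h2
  exact ⟨(List.nodup_append.mp h1).2.1, fun x hx => h2 x (List.mem_append_right _ hx),
    fun q hq => h3 q (List.mem_cons_of_mem _ hq)⟩

theorem exists_popular {α : Type} (B : Finset α) (S : Finset V) (f : α → Finset V)
    (hf : ∀ a, f a ⊆ S) {η : ℝ} 
    (h : (1 / 2 + η) * B.card * S.card < ∑ a ∈ B, ((f a).card : ℝ)) :
    ∃ S' ⊆ S, S.card ≤ 2 * S'.card ∧
      η * B.card < 2 ^ S.card * ((B.filter (f · = S')).card : ℝ) := by
  by_contra! hcon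
  set B' := B.filter fun a => S.card ≤ 2 * (f a).card with hB'
  have hηB : (B'.card : ℝ) ≤ η * B.card := by
    have h1 : B'.card = ∑ S' ∈ S.powerset, (B'.filter (f · = S')).card :=
      Finset.card_eq_sum_card_fiberwise fun a _ => by simpa using hf a
    have h2 : ∀ S' ∈ S.powerset, (2 : ℝ) ^ S.card * (B'.filter (f · = S')).card ≤ η * B.card := by
      intro S' hS'
      by_cases hc : S.card ≤ 2 * S'.card
      · refine le_trans ?_ (hcon S' (Finset.mem_powerset.mp hS') hc)
        gcongr
        exact Finset.filter_subset _ _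
      · have h0 : B'.filter (f · = S') = ∅ := by
          rw [Finset.filter_eq_empty_iff]
          rintro a ha rfl
          exact hc (Finset.mem_filter.mp ha).2
        rw [h0]
        have := hcon S subset_rfl (by omega)
        simp only [Finset.card_empty, Nat.cast_zero, mul_zero]
        exact le_trans (by positivity) this
    have h3 := Finset.sum_le_sum h2
    rw [← Finset.mul_sum, Finset.sum_const, Finset.card_powerset, nsmul_eq_mul] at h3
    rw [h1]
    push_cast at h3 ⊢
    exact le_of_mul_le_mul_left h3 (by positivity)
  have h4 : ∑ a ∈ B, ((f a).card : ℝ) ≤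
      ∑ a ∈ B, ((S.card : ℝ) / 2 + if a ∈ B' then (S.card : ℝ) else 0) := by
    refine Finset.sum_le_sum fun a ha => ?_
    split_ifs with hc
    · have : ((f a).card : ℝ) ≤ S.card := by exact_mod_cast Finset.card_le_card (hf a)
      have : (0 : ℝ) ≤ (S.card : ℝ) / 2 := by positivity
      linarith
    · have : ¬ S.card ≤ 2 * (f a).card := fun h' => hc (Finset.mem_filter.mpr ⟨ha, h'⟩)
      have : 2 * ((f a).card : ℝ) ≤ S.card := by exact_mod_cast (by omega : 2 * (f a).card ≤ S.card)
      linarith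
  rw [Finset.sum_add_distrib, Finset.sum_ite_mem, Finset.inter_eq_right.mpr
        (Finset.filter_subset _ _), Finset.sum_const, Finset.sum_const, nsmul_eq_mul,
        nsmul_eq_mul] at h4
  have h5 : (B'.card : ℝ) * S.card ≤ η * B.card * S.card := by gcongr
  linarith

theorem sum_inter_flatten_le {α : Type} (B : Finset α) (f : α → Finset V) (c : ℝ)
    (Ps : List (List V)) (h : ∀ Q ∈ Ps, ∑ a ∈ B, ((f a ∩ Q.toFinset).card : ℝ) ≤ c * Q.length) :
    ∑ a ∈ B, ((f a ∩ Ps.flatten.toFinset).card : ℝ) ≤ c * Ps.flatten.length := by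
  induction Ps with
  | nil => simp
  | cons Q Ps ih =>
    have h1 := h Q (by simp)
    have h2 := ih fun Q' hQ' => h Q' (by simp [hQ'])
    have h3 : ∑ a ∈ B, ((f a ∩ (Q :: Ps).flatten.toFinset).card : ℝ)
        ≤ ∑ a ∈ B, (((f a ∩ Q.toFinset).card : ℝ) + (f a ∩ Ps.flatten.toFinset).card) := by
      refine Finset.sum_le_sum fun a _ => ?_
      rw [List.flatten_cons, List.toFinset_append, Finset.inter_union_distrib_left]
      exact_mod_cast Finset.card_union_le _ _
    rw [Finset.sum_add_distrib] at h3
    refine h3.trans ?_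
    rw [List.flatten_cons, List.length_append]
    push_cast
    linarith

variable [Fintype V]

theorem sum_card_nb_inter_le (hE : ∀ e ∈ E, e.card = r + 1) (L : Finset V) :
    ∑ A ∈ L.powersetCard r, (nb E A ∩ L).card ≤ (r + 1) * (E.filter (· ⊆ L)).card := by
  have h1 : ∑ e ∈ E.filter (· ⊆ L), e.card = (r + 1) * (E.filter (· ⊆ L)).card := by
    rw [Finset.sum_congr rfl fun e he => hE e (Finset.mem_filter.mp he).1, Finset.sum_const,
      smul_eq_mul, mul_comm]
  rw [← h1, ← Finset.card_sigma, ← Finset.card_sigma]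
  refine Finset.card_le_card_of_injOn (fun p => ⟨insert p.2 p.1, p.2⟩) ?_ ?_
  · rintro ⟨A, x⟩ h
    simp only [Finset.coe_sigma, Set.mem_sigma_iff, Finset.mem_coe, Finset.mem_powersetCard,
      Finset.mem_inter, mem_nb, Finset.mem_filter] at h ⊢
    exact ⟨⟨h.2.1.2, Finset.insert_subset h.2.2 h.1.1⟩, Finset.mem_insert_self _ _⟩
  · rintro ⟨A, x⟩ h ⟨B, y⟩ h' heq
    simp only [Finset.coe_sigma, Set.mem_sigma_iff, Finset.mem_coe,
      Finset.mem_inter, mem_nb] at h h'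
    simp only [Sigma.mk.injEq, heq_eq_eq] at heq
    obtain ⟨h1, rfl⟩ := heq
    have : A = B := by
      rw [← Finset.erase_insert h.2.1.1, h1, Finset.erase_insert h'.2.1.1]
    rw [this]

theorem exists_larger_packing (hr : 1 ≤ r) (hK : 1 ≤ K) {γ ε : ℝ} (hγ : 0 < γ) (hε : 0 < ε) :
    ∃ N₀ : ℕ, ∀ {V : Type} [Fintype V] [DecidableEq V] (E : Finset (Finset V)),
      (∀ e ∈ E, e.card = r + 1) → ∀ U : Finset V, N₀ ≤ U.card →
      Cod E r U ((1 / 2 + γ) * U.card) → ∀ Ps, IsPacking E r U K Ps →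
      ε * U.card < ((U \ Ps.flatten.toFinset).card : ℝ) →
      ∃ Ps', IsPacking E r U K Ps' ∧ Ps.flatten.length < Ps'.flatten.length := by
  set c : ℝ := 1 / (2 ^ r * r.factorial) with hc
  have hc0 : 0 < c := by positivity
  set D₂ : ℝ := (2 * K + 1) * r + r with hD₂
  refine ⟨⌈2 * r / ε⌉₊ + ⌈2 * ((r + 1) * (K + r + 1)) / (c * γ)⌉₊ +
    ⌈4 ^ K * D₂ * 4 / (γ * c) / ε⌉₊ + 1, ?_⟩
  intro V _ _ E hE U hU hcod Ps hPs hL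
  set u : ℝ := (U.card : ℝ) with hu
  have hu1 : 2 * r ≤ ε * u := by
    have := (Nat.le_ceil (2 * r / ε)).trans (Nat.cast_le (α := ℝ).mpr (show _ ≤ U.card by omega))
    rw [div_le_iff₀ hε] at this; linarith
  have hu2 : 2 * ((r + 1) * (K + r + 1)) ≤ c * γ * u := by
    have := (Nat.le_ceil (2 * (((r : ℝ) + 1) * (K + r + 1)) / (c * γ))).trans
      (Nat.cast_le (α := ℝ).mpr (show _ ≤ U.card by omega))
    rw [div_le_iff₀ (by positivity)] at this; linarith
  have hu3 : 4 ^ K * D₂ * 4 / (γ * c) ≤ ε * u := by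
    have := (Nat.le_ceil (4 ^ K * D₂ * 4 / (γ * c) / ε)).trans
      (Nat.cast_le (α := ℝ).mpr (show _ ≤ U.card by omega))
    rw [div_le_iff₀ hε] at this; linarith
  have hu0 : 0 < u := by
    rw [hu]; exact_mod_cast (show 0 < U.card by omega)
  set L := U \ Ps.flatten.toFinset with hLdef
  have hLmem : ∀ x ∈ L, x ∈ U ∧ x ∉ Ps.flatten := by
    intro x hx
    rw [hLdef, Finset.mem_sdiff, List.mem_toFinset] at hx
    exact hx
  set n := L.card with hn
  set B := L.powersetCard r with hB
  by_cases hcase : (K + r + 1) * L.card ^ r < (E.filter (· ⊆ L)).card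
  · obtain ⟨l, h1, h2, h3, h4⟩ := exists_tight_of_card (ρ := r) K (L := L) (H := E.filter (· ⊆ L))
      (fun e he => ⟨hE e (Finset.mem_filter.mp he).1, (Finset.mem_filter.mp he).2⟩) hcase
    obtain ⟨Ps', h5, h6⟩ := hPs.extend hK (l := l)
      (fun w hw hl => (Finset.mem_filter.mp (h4 w hw hl)).1) h2 h1.ge
      (fun x hx => (hLmem x (h3 x hx)).1) (fun x hx => (hLmem x (h3 x hx)).2)
    exact ⟨Ps', h5, by omega⟩
  · push Not at hcase
    have hn2 : 2 * r ≤ n := by exact_mod_cast hu1.trans hL.le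
    have hnpos : (0 : ℝ) < n := lt_of_le_of_lt (by positivity) hL
    have hb : c * (n : ℝ) ^ r ≤ B.card := by
      rw [hB, Finset.card_powersetCard, ← hn]
      have h1 := Nat.pow_le_choose (α := ℝ) r n
      rw [div_le_iff₀' (by positivity)] at h1
      have h2 : (n : ℝ) / 2 ≤ ((n + 1 - r : ℕ) : ℝ) := by
        rw [Nat.cast_sub (by omega)]
        have : (2 : ℝ) * r ≤ n := by exact_mod_cast hn2
        push_cast; linarith
      have h3 : ((n : ℝ) / 2) ^ r ≤ r.factorial * n.choose r := by
        refine le_trans ?_ h1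
        gcongr
      rw [div_pow] at h3
      rw [hc, one_div, inv_mul_le_iff₀ (by positivity)]
      rw [div_le_iff₀ (by positivity)] at h3
      linarith
    have hB0 : (0 : ℝ) < B.card := lt_of_lt_of_le (by positivity) hb
    have hsum : (1 / 2 + γ / 2) * B.card * u
        ≤ ∑ A ∈ B, ((nb E A ∩ Ps.flatten.toFinset).card : ℝ) := by
      have h1 : ∑ A ∈ B, ((1 / 2 + γ) * u) ≤ ∑ A ∈ B, (((nb E A ∩ L).card : ℝ)
          + (nb E A ∩ Ps.flatten.toFinset).card) := by
        refine Finset.sum_le_sum fun A hA => (hcod A (Finset.mem_powersetCard.mp hA).2).trans ?_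
        have : nb E A ∩ U ⊆ (nb E A ∩ L) ∪ (nb E A ∩ Ps.flatten.toFinset) := by
          intro x hx
          simp only [hLdef, Finset.mem_union, Finset.mem_inter, Finset.mem_sdiff] at hx ⊢
          tauto
        exact_mod_cast (Finset.card_le_card this).trans (Finset.card_union_le _ _)
      rw [Finset.sum_add_distrib, Finset.sum_const, nsmul_eq_mul] at h1
      have h2 : (∑ A ∈ B, ((nb E A ∩ L).card : ℝ)) ≤ (r + 1) * ((K + r + 1) * (n : ℝ) ^ r) := by
        have := (sum_card_nb_inter_le hE L).trans (Nat.mul_le_mul_left _ hcase)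
        exact_mod_cast this
      have h3 : ((r : ℝ) + 1) * ((K + r + 1) * (n : ℝ) ^ r) ≤ B.card * (γ / 2 * u) := by
        calc ((r : ℝ) + 1) * ((K + r + 1) * (n : ℝ) ^ r)
            = ((r : ℝ) + 1) * (K + r + 1) * (n : ℝ) ^ r := by ring
          _ ≤ (c * γ * u / 2) * (n : ℝ) ^ r := by gcongr; linarith
          _ = (c * (n : ℝ) ^ r) * (γ / 2 * u) := by ring
          _ ≤ _ := by gcongr
      linarith
    obtain ⟨Q, hQ, hQsum⟩ : ∃ Q ∈ Ps, (1 / 2 + γ / 4) * B.card * Q.length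
        < ∑ A ∈ B, ((nb E A ∩ Q.toFinset).card : ℝ) := by
      by_contra! hcon
      have h1 := sum_inter_flatten_le B (nb E) _ Ps hcon
      have h2 : (Ps.flatten.length : ℝ) ≤ u := by
        rw [hu, ← List.toFinset_card_of_nodup hPs.1]
        exact_mod_cast Finset.card_le_card fun x hx => hPs.2.1 x (List.mem_toFinset.mp hx)
      have h3 : (1 / 2 + γ / 4) * B.card * Ps.flatten.length ≤ (1 / 2 + γ / 4) * B.card * u := by
        gcongr
      have h4 : 0 < γ * B.card * u := by positivity
      linarith
    have hperm := List.perm_cons_erase hQ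
    have hPs' := hPs.of_perm hperm
    have hQn : Q.Nodup := by
      have := hPs'.1
      rw [List.flatten_cons, List.nodup_append] at this
      exact this.1
    obtain ⟨hQt, hQK, hQK2⟩ := hPs.2.2 Q hQ
    have hQc := List.toFinset_card_of_nodup hQn
    obtain ⟨S', hS', hS'c, hpop⟩ := exists_popular B Q.toFinset (fun A => nb E A ∩ Q.toFinset)
      (fun _ => Finset.inter_subset_right) (η := γ / 4) (by rwa [hQc])
    set H := B.filter fun A => nb E A ∩ Q.toFinset = S' with hH
    rw [hQc] at hS'c hpop
    set j := S'.card with hj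
    have hj2 : j ≤ 2 * K := by
      have := Finset.card_le_card hS'
      omega
    have hHcard : ((j + 1) * r + (r - 1) + 1) * L.card ^ (r - 1) < H.card := by
      have h1 : γ / 4 * B.card < 4 ^ K * (H.card : ℝ) := by
        refine hpop.trans_le ?_
        gcongr ?_ * _
        rw [show (4 : ℝ) = 2 ^ 2 by norm_num, ← pow_mul]
        exact pow_le_pow_right₀ (by norm_num) hQK2.le
      have h2 : 4 ^ K * (D₂ * (n : ℝ) ^ (r - 1)) ≤ γ / 4 * B.card := by
        calc 4 ^ K * (D₂ * (n : ℝ) ^ (r - 1))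
            = (4 ^ K * D₂ * 4 / (γ * c)) * (γ / 4 * c * (n : ℝ) ^ (r - 1)) := by
              field_simp
          _ ≤ n * (γ / 4 * c * (n : ℝ) ^ (r - 1)) := by
              gcongr
              exact hu3.trans hL.le
          _ = γ / 4 * (c * (n : ℝ) ^ (r - 1 + 1)) := by rw [pow_succ]; ring
          _ ≤ γ / 4 * B.card := by
              rw [Nat.sub_add_cancel hr]
              gcongr
      have h3 : D₂ * (n : ℝ) ^ (r - 1) < H.card :=
        lt_of_mul_lt_mul_left (h2.trans_lt h1) (by positivity)
      have h4 : (j + 1) * r + (r - 1) + 1 ≤ (2 * K + 1) * r + r := by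
        have : (j + 1) * r ≤ (2 * K + 1) * r := by gcongr
        omega
      have h5 : (((j + 1) * r + (r - 1) + 1 : ℕ) : ℝ) ≤ D₂ := by
        rw [hD₂]; exact_mod_cast h4
      have h6 : (((j + 1) * r + (r - 1) + 1 : ℕ) : ℝ) * (n : ℝ) ^ (r - 1) < H.card :=
        lt_of_le_of_lt (by gcongr) h3
      exact_mod_cast h6
    obtain ⟨l, hl1, hl2, hl3, hl4⟩ := exists_tight_of_card (ρ := r - 1) ((j + 1) * r)
      (L := L) (H := H)
      (fun e he => by
        have := Finset.mem_powersetCard.mp (Finset.mem_filter.mp he).1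
        exact ⟨by omega, this.1⟩) hHcard
    have hper := interleave_perm r l S'.toList
    have hSQ : ∀ x ∈ S', x ∈ Q := fun x hx => List.mem_toFinset.mp (hS' hx)
    have hQU : ∀ x ∈ Q, x ∈ Ps.flatten := fun x hx => List.mem_flatten.mpr ⟨Q, hQ, hx⟩
    have hlen : (interleave r l S'.toList).length = (j + 1) * r + j := by
      rw [hper.length_eq, List.length_append, hl1, Finset.length_toList]
    have hQlt : Q.length < (j + 1) * r + j := by
      have : (j + 1) * 1 ≤ (j + 1) * r := by gcongr
      omega
    obtain ⟨Ps', h5, h6⟩ := hPs'.tail.extend hK (l := interleave r l S'.toList)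
      (tight_interleave (H := H) hr l _ (by rw [hl1, Finset.length_toList]) hl4 (by
        intro A hA q hq
        have h1 := (Finset.mem_filter.mp hA).2
        rw [Finset.mem_toList, ← h1, Finset.mem_inter, mem_nb] at hq
        exact hq.1.2)).1
      (hper.nodup_iff.mpr (by
        rw [List.nodup_append]
        refine ⟨hl2, S'.nodup_toList, ?_⟩
        rintro a ha b hb rfl
        exact (hLmem a (hl3 a ha)).2 (hQU _ (hSQ _ (by simpa using hb)))))
      (by omega)
      (fun x hx => by
        rcases List.mem_append.mp (hper.mem_iff.mp hx) with hx | hx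
        · exact (hLmem x (hl3 x hx)).1
        · exact hPs.2.1 x (hQU _ (hSQ _ (by simpa using hx))))
      (fun x hx => by
        rcases List.mem_append.mp (hper.mem_iff.mp hx) with hx | hx
        · exact fun h => (hLmem x (hl3 x hx)).2 (hperm.flatten.mem_iff.mpr
            (by simp only [List.flatten_cons, List.mem_append]; exact Or.inr h))
        · intro h
          have := hPs'.1
          rw [List.flatten_cons, List.nodup_append] at this
          exact this.2.2 x (hSQ _ (by simpa using hx)) x h rfl)
    refine ⟨Ps', h5, ?_⟩
    rw [h6, hlen, hperm.flatten.length_eq, List.flatten_cons, List.length_append]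
    omega

/-- Almost all vertices can be covered by disjoint tight paths of given length. -/
theorem exists_path_cover (hr : 1 ≤ r) (hK : 1 ≤ K) {γ ε : ℝ} (hγ : 0 < γ) (hε : 0 < ε) :
    ∃ N₀ : ℕ, ∀ {V : Type} [Fintype V] [DecidableEq V] (E : Finset (Finset V)),
      (∀ e ∈ E, e.card = r + 1) → ∀ U : Finset V, N₀ ≤ U.card →
      Cod E r U ((1 / 2 + γ) * U.card) → ∃ Ps : List (List V), Ps.flatten.Nodup ∧
      (∀ x ∈ Ps.flatten, x ∈ U) ∧ (∀ Q ∈ Ps, Tight E r Q ∧ K ≤ Q.length) ∧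
      ((U \ Ps.flatten.toFinset).card : ℝ) ≤ ε * U.card := by
  obtain ⟨N₀, hN⟩ := exists_larger_packing hr hK hγ hε
  refine ⟨N₀, fun {V} _ _ E hE U hU hcod => ?_⟩
  by_contra! hcon
  have hall : ∀ Ps, IsPacking E r U K Ps → ∃ Ps', IsPacking E r U K Ps' ∧
      Ps.flatten.length < Ps'.flatten.length := fun Ps hPs =>
    hN E hE U hU hcod Ps hPs
      (hcon Ps hPs.1 hPs.2.1 fun Q hQ => ⟨(hPs.2.2 Q hQ).1, (hPs.2.2 Q hQ).2.1⟩)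
  have hlong : ∀ m, ∃ Ps, IsPacking E r U K Ps ∧ m ≤ Ps.flatten.length := by
    intro m
    induction m with
    | zero => exact ⟨[], ⟨by simp, by simp, by simp⟩, by simp⟩
    | succ m ih =>
      obtain ⟨Ps, h1, h2⟩ := ih
      obtain ⟨Ps', h3, h4⟩ := hall Ps h1
      exact ⟨Ps', h3, by omega⟩
  obtain ⟨Ps, h1, h2⟩ := hlong (U.card + 1)
  have : Ps.flatten.toFinset.card ≤ U.card :=
    Finset.card_le_card fun x hx => h1.2.1 x (List.mem_toFinset.mp hx)
  rw [List.toFinset_card_of_nodup h1.1] at this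
  omega

end Cover

section Sampling

variable {Ω ι : Type}

/-- Every entry of the list is allowed by `C`, given the entries that follow it. -/
def Valid (C : List Ω → Finset Ω) : List Ω → Prop
  | [] => True
  | ω :: h => ω ∈ C h ∧ Valid C h

theorem exists_valid_sum_le (C : List Ω → Finset Ω) (I : Finset ι) (good : ι → Ω → Prop)
    {p c : ℝ} (hc0 : 0 ≤ c) (hc1 : c ≤ 1) (M : ℕ)
    (h : ∀ h, Valid C h → h.length < M → (C h).Nonempty ∧
      ∀ i ∈ I, p * (C h).card ≤ (((C h).filter (good i)).card : ℝ)) :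
    ∃ h, Valid C h ∧ h.length = M ∧
      ∑ i ∈ I, (1 - c) ^ h.countP (good i ·) ≤ I.card * Real.exp (-(c * p)) ^ M := by
  induction M with
  | zero => exact ⟨[], by simp [Valid]⟩
  | succ M ih =>
    obtain ⟨l, hl, hlen, hle⟩ := ih fun l hl hlen => h l hl (by omega)
    obtain ⟨hne, hgood⟩ := h l hl (by omega)
    have hc1' : 0 ≤ 1 - c := by linarith
    have key : ∑ ω ∈ C l, ∑ i ∈ I, (1 - c) ^ (ω :: l).countP (good i ·)
        ≤ ∑ ω ∈ C l, ((1 - c * p) * ∑ i ∈ I, (1 - c) ^ l.countP (good i ·)) := by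
      rw [Finset.sum_comm, Finset.sum_const, nsmul_eq_mul, ← mul_assoc, Finset.mul_sum]
      refine Finset.sum_le_sum fun i hi => ?_
      have h1 : ∀ ω ∈ C l, (1 - c) ^ (ω :: l).countP (good i ·)
          = (1 - c) ^ l.countP (good i ·) * (1 - c * if good i ω then 1 else 0) := by
        intro ω _
        by_cases hg : good i ω <;> simp [hg, pow_succ]
      rw [Finset.sum_congr rfl h1, ← Finset.mul_sum, Finset.sum_sub_distrib, ← Finset.mul_sum,
        Finset.sum_boole, Finset.sum_const, nsmul_eq_mul, mul_one, mul_comm]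
      refine mul_le_mul_of_nonneg_right ?_ (by positivity)
      have := mul_le_mul_of_nonneg_left (hgood i hi) hc0
      linarith
    obtain ⟨ω, hω, hωle⟩ := Finset.exists_le_of_sum_le hne key
    refine ⟨ω :: l, ⟨hω, hl⟩, by simp [hlen], hωle.trans ?_⟩
    have h2 : 1 - c * p ≤ Real.exp (-(c * p)) := by
      have := Real.add_one_le_exp (-(c * p)); linarith
    have h3 : 0 ≤ ∑ i ∈ I, (1 - c) ^ l.countP (good i ·) :=
      Finset.sum_nonneg fun _ _ => by positivity
    calc (1 - c * p) * ∑ i ∈ I, (1 - c) ^ l.countP (good i ·)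
        ≤ Real.exp (-(c * p)) * ∑ i ∈ I, (1 - c) ^ l.countP (good i ·) := by gcongr
      _ ≤ Real.exp (-(c * p)) * (I.card * Real.exp (-(c * p)) ^ M) := by gcongr
      _ = _ := by ring

/-- If at each step a proportion `p` of the allowed choices is good for `i`, then a suitable
sequence of choices is good for each `i` at least a proportion `q < p` of the time. -/
theorem exists_valid {p q : ℝ} (hq : 0 < q) (hqp : q < p) :
    ∃ κ : ℝ, 0 < κ ∧ ∀ {Ω ι : Type} (C : List Ω → Finset Ω) (I : Finset ι) (good : ι → Ω → Prop)
      (M : ℕ), (I.card : ℝ) < Real.exp (κ * M) →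
      (∀ h, Valid C h → h.length < M → (C h).Nonempty ∧
        ∀ i ∈ I, p * (C h).card ≤ (((C h).filter (good i)).card : ℝ)) →
      ∃ h, Valid C h ∧ h.length = M ∧ ∀ i ∈ I, q * M ≤ h.countP (good i ·) := by
  have hp : 0 < p := hq.trans hqp
  set c : ℝ := (p - q) / (2 * p) with hc
  have hc0 : 0 < c := div_pos (by linarith) (by linarith)
  have hc1 : 1 - c = (p + q) / (2 * p) := by rw [hc]; field_simp; ring
  have hc2 : 0 < 1 - c := by rw [hc1]; positivity
  have hκ : 0 < c * p - q * (c / (1 - c)) := by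
    have : c * p - q * (c / (1 - c)) = c * p * ((p - q) / (p + q)) := by
      rw [hc1]; field_simp; ring
    rw [this]
    have : 0 < (p - q) / (p + q) := div_pos (by linarith) (by linarith)
    positivity
  refine ⟨_, hκ, fun {Ω ι} C I good M hI h => ?_⟩
  obtain ⟨l, hl, hlen, hle⟩ := exists_valid_sum_le C I good hc0.le (by linarith) M h
  refine ⟨l, hl, hlen, fun i hi => ?_⟩
  by_contra! hcon
  have h1 : (1 - c) ^ l.countP (good i ·) ≤ I.card * Real.exp (-(c * p)) ^ M :=
    (Finset.single_le_sum (f := fun i => (1 - c) ^ l.countP (good i ·))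
      (fun _ _ => by positivity) hi).trans hle
  have h2 : Real.exp (-(c / (1 - c))) ≤ 1 - c := by
    rw [Real.exp_neg, inv_le_comm₀ (Real.exp_pos _) hc2]
    have h3 := Real.add_one_le_exp (c / (1 - c))
    have h4 : (1 - c)⁻¹ = c / (1 - c) + 1 := by field_simp; ring
    rwa [h4]
  have h3 : Real.exp (-(q * (c / (1 - c)) * M)) ≤ (1 - c) ^ l.countP (good i ·) := by
    refine le_trans ?_ (pow_le_pow_left₀ (Real.exp_pos _).le h2 _)
    rw [← Real.exp_nat_mul]
    refine Real.exp_le_exp.mpr ?_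
    have : (l.countP (good i ·) : ℝ) * (c / (1 - c)) ≤ q * M * (c / (1 - c)) := by
      gcongr
    linarith
  have h4 : (I.card : ℝ) * Real.exp (-(c * p)) ^ M
      < Real.exp ((c * p - q * (c / (1 - c))) * M) * Real.exp (-(c * p)) ^ M := by
    gcongr
  have h5 := (h3.trans h1).trans_lt h4
  rw [← Real.exp_nat_mul, ← Real.exp_add, Real.exp_lt_exp] at h5
  linarith

theorem exists_pow_lt_exp (r : ℕ) {κ : ℝ} (hκ : 0 < κ) :
    ∃ N₀ : ℕ, ∀ n : ℕ, N₀ ≤ n → (n : ℝ) ^ r < Real.exp (κ * n) := by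
  have h := (isLittleO_pow_exp_pos_mul_atTop (k := r) hκ).def (show (0 : ℝ) < 1 / 2 by norm_num)
  have h2 := tendsto_natCast_atTop_atTop (R := ℝ) |>.eventually h
  obtain ⟨N₀, hN⟩ := Filter.eventually_atTop.mp h2
  refine ⟨N₀, fun n hn => ?_⟩
  have := hN n hn
  rw [Real.norm_of_nonneg (by positivity), Real.norm_of_nonneg (Real.exp_pos _).le] at this
  have := Real.exp_pos (κ * n)
  linarith

end Sampling

section Reservoir

variable {r : ℕ}

/-- A set of linear size has a subset of prescribed linear size inheriting the codegree
condition. -/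
theorem exists_reservoir (r : ℕ) {γ ρ : ℝ} (hγ : 0 < γ) (hγ1 : γ ≤ 1) (hρ : 0 < ρ) :
    ∃ N₀ : ℕ, ∀ {V : Type} [Fintype V] [DecidableEq V] (E : Finset (Finset V)),
      N₀ ≤ Fintype.card V → ∀ (U : Finset V) (M : ℕ), ρ * Fintype.card V ≤ M →
      (M : ℝ) ≤ γ / 4 * U.card → Cod E r U ((1 / 2 + γ) * U.card) →
      ∃ R ⊆ U, R.card = M ∧ Cod E r R ((1 / 2 + γ / 2) * M) := by
  obtain ⟨κ, hκ, hval⟩ := exists_valid (q := 1 / 2 + γ / 2) (p := 1 / 2 + 3 * γ / 4) (by linarith)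
    (by linarith)
  obtain ⟨N₀, hN⟩ := exists_pow_lt_exp r (κ := κ * ρ) (by positivity)
  refine ⟨N₀, fun {V} _ _ E hn U M hM1 hM2 hcod => ?_⟩
  obtain ⟨l, hl, hlen, hgood⟩ := hval (fun h : List V => U \ h.toFinset)
    (Finset.univ.powersetCard r) (fun A v => v ∈ nb E A) M (by
      rw [Finset.card_powersetCard, Finset.card_univ]
      calc ((Fintype.card V).choose r : ℝ) ≤ (Fintype.card V : ℝ) ^ r := by
            exact_mod_cast Nat.choose_le_pow _ _
        _ < _ := hN _ hn
        _ ≤ _ := by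
            rw [mul_assoc]
            gcongr) (by
      intro h hh hlen
      have hlen' : (h.length : ℝ) < M := by exact_mod_cast hlen
      have hM0 : (0 : ℝ) < M := lt_of_le_of_lt (by positivity) hlen'
      have hu : (0 : ℝ) < U.card := by
        by_contra hcon
        have : (U.card : ℝ) = 0 := le_antisymm (not_lt.mp hcon) (by positivity)
        rw [this] at hM2
        linarith
      have hh1 : (h.toFinset.card : ℝ) ≤ h.length := by exact_mod_cast List.toFinset_card_le h
      constructor
      · have h1 := Finset.le_card_sdiff h.toFinset U
        rw [← Finset.card_pos]
        have : h.toFinset.card < U.card := by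
          have : (h.toFinset.card : ℝ) < U.card := by nlinarith
          exact_mod_cast this
        omega
      · intro A hA
        have h1 := hcod.sdiff (W := h.toFinset) (d := (1 / 2 + 3 * γ / 4) * U.card)
          (by linarith) A (Finset.mem_powersetCard.mp hA).2
        have h2 : (1 / 2 + 3 * γ / 4) * (U \ h.toFinset).card ≤ (1 / 2 + 3 * γ / 4) * U.card := by
          gcongr
          exact Finset.sdiff_subset
        refine (h2.trans h1).trans (Nat.cast_le.mpr (Finset.card_le_card fun x hx => ?_))
        rw [Finset.mem_inter] at hx
        simp only [Finset.mem_filter]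
        exact ⟨hx.2, hx.1⟩)
  have hlU : ∀ l : List V, Valid (fun h : List V => U \ h.toFinset) l →
      l.Nodup ∧ ∀ x ∈ l, x ∈ U := by
    intro l hl
    induction l with
    | nil => simp
    | cons x l ih =>
      obtain ⟨h1, h2⟩ := hl
      obtain ⟨h3, h4⟩ := ih h2
      rw [Finset.mem_sdiff, List.mem_toFinset] at h1
      refine ⟨List.nodup_cons.mpr ⟨h1.2, h3⟩, fun y hy => ?_⟩
      rcases List.mem_cons.mp hy with rfl | hy
      exacts [h1.1, h4 y hy]
  obtain ⟨hnd, hU⟩ := hlU l hl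
  refine ⟨l.toFinset, fun x hx => hU x (List.mem_toFinset.mp hx), by
    rw [List.toFinset_card_of_nodup hnd, hlen], fun A hA => ?_⟩
  refine (hgood A (Finset.mem_powersetCard.mpr ⟨Finset.subset_univ _, hA⟩)).trans ?_
  rw [List.countP_eq_length_filter, ← List.toFinset_card_of_nodup (hnd.filter _)]
  norm_cast
  refine Finset.card_le_card fun x hx => ?_
  simp only [List.mem_toFinset, List.mem_filter, decide_eq_true_eq] at hx
  simp [hx.1, hx.2]

end Reservoir

section Absorber

/-- The vertex `v` can be inserted in the middle of the tight path `l` on `2 * r` vertices. -/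
def IsAbsorber {V : Type} [DecidableEq V] (E : Finset (Finset V)) (r : ℕ) (v : V) (l : List V) :
    Prop :=
  l.length = 2 * r ∧ v ∉ l ∧ l.Nodup ∧ Tight E r l ∧ Tight E r (l.take r ++ v :: l.drop r)

variable {V : Type} [Fintype V] [DecidableEq V] {E : Finset (Finset V)} {r : ℕ}

theorem rich_isAbsorber (hr : 1 ≤ r) {U : Finset V} {c₀ d : ℝ} (hcod : Cod E r U c₀)
    (hd : d + 3 * r + 1 ≤ 2 * c₀ - U.card) (hc : c₀ ≤ U.card) (v : V) :
    Rich U d (2 * r) (IsAbsorber E r v) := by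
  have htriv : ∀ m, Rich U U.card m fun _ : List V => True := by
    intro m
    induction m with
    | zero => trivial
    | succ m ih => exact ⟨U, subset_rfl, le_rfl, fun _ _ => ih⟩
  have hr' : ((r - 1 : ℕ) : ℝ) = r - 1 := by push_cast [hr]; ring
  have hr0 : (0 : ℝ) ≤ r := by positivity
  have h1 := (htriv (r - 1)).avoid (d' := d + 2 * r + 1) {v} (by
    rw [Finset.card_singleton, hr']; push_cast; linarith)
  have h2 : Rich U (d + 2 * r + 1) (r - 1 + 1) fun A =>
      A.Nodup ∧ v ∉ A ∧ insert v A.toFinset ∈ E := by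
    refine h1.bind ?_
    rintro a ha ⟨-, han, hav⟩
    have hva : v ∉ a := fun h => hav v h (by simp)
    have hcard : (insert v a.toFinset).card = r := by
      rw [Finset.card_insert_of_notMem (by simpa using hva), List.toFinset_card_of_nodup han]
      omega
    refine ⟨nb E (insert v a.toFinset) ∩ U, Finset.inter_subset_right,
      le_trans (by linarith) (hcod _ hcard), fun x hx => ?_⟩
    rw [Finset.mem_inter, mem_nb] at hx
    obtain ⟨⟨hx1, hx2⟩, -⟩ := hx
    simp only [Finset.mem_insert, List.mem_toFinset, not_or] at hx1
    change (a ++ [x]).Nodup ∧ v ∉ a ++ [x] ∧ insert v (a ++ [x]).toFinset ∈ E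
    refine ⟨?_, by simp [hva, Ne.symm hx1.1], ?_⟩
    · rw [List.nodup_append]
      refine ⟨han, by simp, ?_⟩
      rintro y hy z hz rfl
      exact hx1.2 (List.mem_singleton.mp hz ▸ hy)
    · convert hx2 using 1
      ext z
      simp only [Finset.mem_insert, List.mem_toFinset, List.mem_append, List.mem_singleton]
      tauto
  have hRich : Rich U (d + 2 * r + 1) (r - 1 + 1 + r) fun l =>
      Tight E r l ∧ Tight E r (l.take r ++ v :: l.drop r) := by
    refine h2.bind ?_
    rintro A hA ⟨hAn, hAv, hAE⟩
    have hA' : A.length = r := by omega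
    obtain ⟨y, t, rfl⟩ : ∃ y t, A = y :: t := by
      cases A with
      | nil => simp at hA
      | cons y t => exact ⟨y, t, rfl⟩
    rw [List.nodup_cons] at hAn
    simp only [List.mem_cons, not_or] at hAv
    refine (rich_two hr hcod (by linarith) r (y :: t) (t ++ [v]) hA' (by simpa using hA')
      (List.nodup_cons.mpr hAn) (by
        rw [List.nodup_append]
        refine ⟨hAn.2, by simp, ?_⟩
        rintro a ha b hb rfl
        exact hAv.2 (List.mem_singleton.mp hb ▸ ha))).mono ?_
    rintro b hb ⟨h3, h4⟩
    rw [← hA', List.take_left, List.drop_left, hA']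
    refine ⟨h3, ?_⟩
    have := Tight.glue (E := E) (r := r) (a := [y]) (m := t ++ [v]) (b := b)
      (by simp at hA' ⊢; omega) (tight_of_toFinset_mem (by simp at hA' ⊢; omega) (by
        convert hAE using 1
        ext z
        simp only [List.singleton_append, List.mem_toFinset, List.mem_cons, List.mem_append,
          List.toFinset_cons, Finset.mem_insert]
        tauto)) h4
    simpa using this
  rw [show r - 1 + 1 + r = 2 * r by omega] at hRich
  refine (hRich.avoid (d' := d) {v} (by push_cast; simp; linarith)).mono ?_
  rintro l hl ⟨⟨h2, h3⟩, h4, h5⟩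
  exact ⟨hl, fun h => h5 v h (by simp), h4, h2, h3⟩

/-- The entries of each list in the family, and all lists in the family, are disjoint. -/
theorem exists_absorber_family (hr : 1 ≤ r) {γ : ℝ} (hγ : 0 < γ) (hγ1 : γ ≤ 1 / 2) :
    ∃ q : ℝ, 0 < q ∧ ∀ ρ : ℝ, 0 < ρ →
    ∃ N₀ : ℕ, ∀ {V : Type} [Fintype V] [DecidableEq V] (E : Finset (Finset V)),
      N₀ ≤ Fintype.card V → ∀ (U : Finset V) (M : ℕ), Fintype.card V ≤ 2 * U.card →
      ρ * Fintype.card V ≤ M → 2 * r * (M : ℝ) ≤ γ / 2 * U.card →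
      Cod E r U ((1 / 2 + γ) * U.card) →
      ∃ segs : List (List V), segs.length = M ∧ segs.flatten.Nodup ∧
        (∀ x ∈ segs.flatten, x ∈ U) ∧ (∀ s ∈ segs, s.length = 2 * r ∧ Tight E r s) ∧
        ∀ v, q * M ≤ segs.countP (IsAbsorber E r v ·) := by
  set p : ℝ := (γ / 2) ^ (2 * r) with hp
  have hp0 : 0 < p := by positivity
  refine ⟨p / 2, by positivity, fun ρ hρ => ?_⟩
  obtain ⟨κ, hκ, hval⟩ := exists_valid (q := p / 2) (p := p) (by linarith) (by linarith)
  obtain ⟨N₀, hN⟩ := exists_pow_lt_exp 1 (κ := κ * ρ) (by positivity)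
  refine ⟨N₀ + 1 + 2 * ⌈(3 * r + 1) * 2 / γ⌉₊, fun {V} _ _ E hn U M hU hM1 hM2 hcod => ?_⟩
  have hu : 0 < U.card := by omega
  have hu' : (0 : ℝ) < U.card := by exact_mod_cast hu
  have hu2 : (3 * r + 1) * 2 ≤ γ * U.card := by
    have := (Nat.le_ceil ((3 * (r : ℝ) + 1) * 2 / γ)).trans
      (Nat.cast_le (α := ℝ).mpr (show _ ≤ U.card by omega))
    rw [div_le_iff₀ hγ] at this; linarith
  set C : List (List V) → Finset (List V) := fun h =>
    (lists (U \ h.flatten.toFinset) (2 * r)).filter fun l => Tight E r l ∧ l.Nodup with hC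
  have hmem : ∀ h l, l ∈ C h ↔ (l.length = 2 * r ∧ ∀ x ∈ l, x ∈ U ∧ x ∉ h.flatten) ∧
      Tight E r l ∧ l.Nodup := by
    intro h l
    simp only [hC, Finset.mem_filter, mem_lists, Finset.mem_sdiff, List.mem_toFinset]
  have hlU : ∀ h, Valid C h → h.flatten.Nodup ∧ (∀ x ∈ h.flatten, x ∈ U) ∧
      (∀ s ∈ h, s.length = 2 * r ∧ Tight E r s) ∧ h.flatten.length = 2 * r * h.length := by
    intro h hh
    induction h with
    | nil => simp
    | cons l h ih =>
      obtain ⟨h1, h2⟩ := hh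
      obtain ⟨h3, h4, h5, h6⟩ := ih h2
      rw [hmem] at h1
      refine ⟨?_, ?_, ?_, ?_⟩
      · rw [List.flatten_cons, List.nodup_append]
        refine ⟨h1.2.2, h3, ?_⟩
        rintro a ha b hb rfl
        exact (h1.1.2 a ha).2 hb
      · intro x hx
        rw [List.flatten_cons, List.mem_append] at hx
        rcases hx with hx | hx
        exacts [(h1.1.2 x hx).1, h4 x hx]
      · intro s hs
        rcases List.mem_cons.mp hs with rfl | hs
        exacts [⟨h1.1.1, h1.2.1⟩, h5 s hs]
      · rw [List.flatten_cons, List.length_append, h6, h1.1.1, List.length_cons]; ring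
  have hcount : ∀ h, Valid C h → h.length < M → ∀ v,
      p * (U.card : ℝ) ^ (2 * r) ≤ (((C h).filter (IsAbsorber E r v)).card : ℝ) := by
    intro h hh hlen v
    obtain ⟨h3, h4, h5, h6⟩ := hlU h hh
    set W := h.flatten.toFinset with hW
    have hWc : (W.card : ℝ) ≤ γ / 2 * U.card := by
      rw [hW, List.toFinset_card_of_nodup h3, h6]
      refine le_trans ?_ hM2
      push_cast
      gcongr
    have hUW : (U \ W).card + W.card = U.card :=
      Finset.card_sdiff_add_card_eq_card fun x hx => h4 x (List.mem_toFinset.mp hx)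
    have hUW' : ((U \ W).card : ℝ) + W.card = U.card := by exact_mod_cast hUW
    have h7 := hcod.sdiff (W := W) (d := (1 / 2 + γ) * U.card - W.card) (by linarith)
    have h8 := (rich_isAbsorber hr h7 (d := γ / 2 * U.card) (by
      have : (0 : ℝ) ≤ γ * U.card := by positivity
      linarith) (by nlinarith) v).le_card (by positivity)
    rw [mul_pow] at h8
    refine h8.trans (Nat.cast_le.mpr (Finset.card_le_card fun l hl => ?_))
    simp only [Finset.mem_filter, mem_lists, Finset.mem_sdiff, hW, List.mem_toFinset] at hl
    rw [Finset.mem_filter, hmem]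
    exact ⟨⟨hl.1, hl.2.2.2.2.1, hl.2.2.2.1⟩, hl.2⟩
  obtain ⟨l, hl, hlen, hgood⟩ := hval C Finset.univ (fun v l => IsAbsorber E r v l) M (by
      rw [Finset.card_univ]
      have := hN (Fintype.card V) (by omega)
      rw [pow_one] at this
      refine this.trans_le ?_
      rw [mul_assoc]
      gcongr) (by
      intro h hh hlen
      constructor
      · obtain ⟨v, -⟩ := Finset.card_pos.mp hu
        have h1 := hcount h hh hlen v
        have h2 : (0 : ℝ) < (((C h).filter (IsAbsorber E r v)).card : ℝ) :=
          lt_of_lt_of_le (by positivity) h1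
        have h3 : 0 < ((C h).filter (IsAbsorber E r v)).card := by exact_mod_cast h2
        exact (Finset.card_pos.mp h3).mono (Finset.filter_subset _ _)
      · intro v _
        refine le_trans ?_ (hcount h hh hlen v)
        gcongr
        have h1 : (C h).card ≤ (U \ h.flatten.toFinset).card ^ (2 * r) := by
          rw [← card_lists]
          exact Finset.card_filter_le _ _
        have h2 : (U \ h.flatten.toFinset).card ^ (2 * r) ≤ U.card ^ (2 * r) := by
          gcongr
          exact Finset.sdiff_subset
        exact_mod_cast h1.trans h2)
  obtain ⟨h1, h2, h3, -⟩ := hlU l hl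
  exact ⟨l, hlen, h1, h2, h3, fun v => hgood v (Finset.mem_univ v)⟩

end Absorber

section Join

/-- The concatenation of the lists `s :: ts`, with the lists `cs` inserted between them. -/
def join {α : Type} : List α → List (List α) → List (List α) → List α
  | s, t :: ts, c :: cs => s ++ (c ++ join t ts cs)
  | s, _, _ => s

theorem prefix_join {α : Type} (s : List α) (ts cs : List (List α)) : s <+: join s ts cs := by
  rcases ts with _ | ⟨t, ts⟩ <;> rcases cs with _ | ⟨c, cs⟩ <;> simp [join]

theorem suffix_join {α : Type} (s t : List α) (ts cs : List (List α))
    (h : cs.length = ts.length + 1) : t <:+ join s (ts ++ [t]) cs := by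
  induction ts generalizing s cs with
  | nil =>
    obtain ⟨c, rfl⟩ := List.length_eq_one_iff.mp h
    simp [join, ← List.append_assoc]
  | cons t' ts ih =>
    obtain _ | ⟨c, cs⟩ := cs
    · simp at h
    simp only [List.length_cons, Nat.add_right_cancel_iff] at h
    rw [List.cons_append, join, ← List.append_assoc]
    exact (ih t' cs h).trans (List.suffix_append _ _)

theorem join_perm {α : Type} (s : List α) (ts cs : List (List α)) (h : cs.length = ts.length) :
    (join s ts cs).Perm ((s :: ts).flatten ++ cs.flatten) := by
  induction ts generalizing s cs with
  | nil =>
    obtain rfl := List.length_eq_zero_iff.mp h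
    simp [join]
  | cons t ts ih =>
    obtain _ | ⟨c, cs⟩ := cs
    · simp at h
    simp only [List.length_cons, Nat.add_right_cancel_iff] at h
    have h1 := ih t cs h
    rw [List.perm_iff_count] at h1 ⊢
    intro a
    have h2 := h1 a
    simp only [join, List.flatten_cons, List.count_append] at h2 ⊢
    omega

variable {V : Type} [DecidableEq V] {E : Finset (Finset V)} {r : ℕ}

/-- `l'` is a tight path, with the same first `r` and the same last `r` vertices as `l`. -/
def Similar (E : Finset (Finset V)) (r : ℕ) (l l' : List V) : Prop :=
  Tight E r l' ∧
    ∃ a b : List V, a.length = r ∧ b.length = r ∧ a <+: l ∧ a <+: l' ∧ b <:+ l ∧ b <:+ l'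

theorem Similar.refl {l : List V} (h : Tight E r l) (hl : r ≤ l.length) : Similar E r l l :=
  ⟨h, l.take r, l.drop (l.length - r), by simp [hl], by simp; omega, List.take_prefix _ _,
    List.take_prefix _ _, List.drop_suffix _ _, List.drop_suffix _ _⟩

theorem IsAbsorber.similar {v : V} {l : List V} (h : IsAbsorber E r v l) :
    Similar E r l (l.take r ++ v :: l.drop r) := by
  obtain ⟨h1, -, -, -, h2⟩ := h
  exact ⟨h2, l.take r, l.drop r, by rw [List.length_take]; omega, by rw [List.length_drop]; omega,
    List.take_prefix _ _, List.prefix_append _ _, List.drop_suffix _ _,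
    ⟨l.take r ++ [v], by simp⟩⟩

theorem exists_absorb (segs : List (List V)) (L : List V)
    (hs : ∀ s ∈ segs, s.length = 2 * r ∧ Tight E r s)
    (h : ∀ v ∈ L, L.length ≤ segs.countP (IsAbsorber E r v ·)) :
    ∃ segs', List.Forall₂ (Similar E r) segs segs' ∧ segs'.flatten.Perm (L ++ segs.flatten) := by
  induction L generalizing segs with
  | nil =>
    refine ⟨segs, List.forall₂_same.mpr fun s hs' => Similar.refl (hs s hs').2 ?_, by simp⟩
    have := (hs s hs').1
    omega
  | cons v L ih =>
    have hpos : 0 < segs.countP (IsAbsorber E r v ·) := by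
      have := h v (by simp)
      rw [List.length_cons] at this
      omega
    obtain ⟨s, hs1, hs2⟩ := List.countP_pos_iff.mp hpos
    have hs3 : IsAbsorber E r v s := by simpa using hs2
    obtain ⟨p, q, rfl⟩ := List.append_of_mem hs1
    obtain ⟨segs', h1, h2⟩ := ih (p ++ q) (fun s' hs' => hs s' (by
      simp only [List.mem_append, List.mem_cons] at hs' ⊢; tauto)) (fun w hw => by
      have := h w (by simp [hw])
      rw [List.countP_append, List.countP_cons] at this
      rw [List.countP_append]
      rw [List.length_cons] at this
      split_ifs at this <;> omega)
    obtain ⟨p', q', hp, hq, rfl⟩ : ∃ p' q', List.Forall₂ (Similar E r) p p' ∧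
        List.Forall₂ (Similar E r) q q' ∧ segs' = p' ++ q' :=
      ⟨segs'.take p.length, segs'.drop p.length, by
        have := List.forall₂_take p.length h1
        simpa using this, by
        have := List.forall₂_drop p.length h1
        simpa using this, (List.take_append_drop _ _).symm⟩
    refine ⟨p' ++ (s.take r ++ v :: s.drop r) :: q', ?_, ?_⟩
    · exact List.rel_append hp (List.Forall₂.cons hs3.similar hq)
    · have e : s = s.take r ++ s.drop r := (List.take_append_drop _ _).symm
      rw [List.perm_iff_count] at h2 ⊢
      intro a
      have h3 := h2 a
      have h4 : s.count a = (s.take r).count a + (s.drop r).count a := by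
        rw [← List.count_append, ← e]
      simp only [List.flatten_append, List.flatten_cons, List.count_append, List.count_cons] at h3 ⊢
      omega

end Join

section ExistsJoin

variable {r : ℕ}

/-- Tight paths can be joined by disjoint connecting paths. -/
theorem exists_join (hr : 1 ≤ r) {γ : ℝ} (hγ : 0 < γ) (hγ1 : γ ≤ 1) :
    ∃ C N₀ : ℕ, ∀ {V : Type} [Fintype V] [DecidableEq V] (E : Finset (Finset V)),
      (∀ e ∈ E, e.card = r + 1) → ∀ U : Finset V, N₀ ≤ U.card →
      Cod E r U ((1 / 2 + γ) * U.card) → ∀ (ts : List (List V)) (s : List V),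
      (∀ x ∈ s :: ts, r ≤ x.length ∧ x.Nodup) → C * (ts.length : ℝ) ≤ γ / 2 * U.card →
      ∃ cs : List (List V), cs.length = ts.length ∧ cs.flatten.Nodup ∧ (∀ x ∈ cs.flatten, x ∈ U) ∧
        cs.flatten.length = C * ts.length ∧
        ∀ s' ts', Similar E r s s' → List.Forall₂ (Similar E r) ts ts' →
          Similar E r (join s ts cs) (join s' ts' cs) := by
  obtain ⟨C, N₀, hC⟩ := exists_connection hr (γ := γ / 2) (by positivity)
  refine ⟨C, 2 * N₀, fun {V} _ _ E hE U hU hcod ts => ?_⟩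
  induction ts with
  | nil =>
    intro s hs _
    refine ⟨[], by simp, by simp, by simp, by simp, ?_⟩
    rintro s' ts' hs' h
    rw [List.forall₂_nil_left_iff] at h
    subst h
    exact hs'
  | cons t ts ih =>
    intro s hs hlen
    have hs1 := hs s (by simp)
    have ht1 := hs t (by simp)
    obtain ⟨cs, h1, h2, h3, h4, h5⟩ := ih t (fun x hx => hs x (by simp at hx ⊢; tauto)) (by
      refine le_trans ?_ hlen
      gcongr
      simp)
    set W := cs.flatten.toFinset with hW
    have hWc : (W.card : ℝ) ≤ γ / 2 * U.card := by
      rw [hW, List.toFinset_card_of_nodup h2, h4]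
      refine le_trans ?_ hlen
      push_cast
      gcongr
      simp
    have hUW : (U \ W).card + W.card = U.card :=
      Finset.card_sdiff_add_card_eq_card fun x hx => h3 x (List.mem_toFinset.mp hx)
    have hUW' : ((U \ W).card : ℝ) + W.card = U.card := by exact_mod_cast hUW
    have hu0 : (0 : ℝ) ≤ U.card := by positivity
    obtain ⟨c, hc1, hc2, hc3, hc4⟩ := hC E hE (U \ W) (by
        have : (U.card : ℝ) ≤ 2 * (U \ W).card := by nlinarith
        have : U.card ≤ 2 * (U \ W).card := by exact_mod_cast this
        omega) (by
        refine hcod.sdiff ?_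
        have : (0 : ℝ) ≤ W.card := by positivity
        nlinarith) (s.drop (s.length - r)) (t.take r)
      (by rw [List.length_drop]; omega) (by rw [List.length_take]; omega)
      (hs1.2.sublist (List.drop_sublist _ _)) (ht1.2.sublist (List.take_sublist _ _))
    refine ⟨c :: cs, by simp [h1], ?_, ?_, ?_, ?_⟩
    · rw [List.flatten_cons, List.nodup_append]
      refine ⟨hc2, h2, ?_⟩
      rintro a ha b hb rfl
      have := hc3 a ha
      rw [Finset.mem_sdiff, hW, List.mem_toFinset] at this
      exact this.2 hb
    · intro x hx
      rw [List.flatten_cons, List.mem_append] at hx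
      rcases hx with hx | hx
      exacts [(Finset.mem_sdiff.mp (hc3 x hx)).1, h3 x hx]
    · rw [List.flatten_cons, List.length_append, hc1, h4, List.length_cons]; ring
    · intro s' ts'' hs' hts
      obtain ⟨t', ts', ht', hts', rfl⟩ := List.forall₂_cons_left_iff.mp hts
      obtain ⟨g1, a', b', ha', hb', g2, g3, g4, g5⟩ := h5 t' ts' ht' hts'
      obtain ⟨f1, a, b, ha, hb, f2, f3, f4, f5⟩ := hs'
      have ea : t.take r = a' :=
        List.IsPrefix.eq_of_length (List.prefix_of_prefix_length_le
          ((List.take_prefix _ _).trans (prefix_join _ _ _)) g2 (by rw [List.length_take]; omega))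
          (by rw [List.length_take]; omega)
      have eb : s.drop (s.length - r) = b :=
        List.IsSuffix.eq_of_length (List.suffix_of_suffix_length_le
          (List.drop_suffix _ _) f4 (by rw [List.length_drop]; omega))
          (by rw [List.length_drop]; omega)
      rw [ea, eb] at hc4
      refine ⟨?_, a, b', ha, hb', f2.trans (prefix_join _ _ _), f3.trans (prefix_join _ _ _),
        ?_, ?_⟩
      · rw [join]
        obtain ⟨x, rfl⟩ := f5
        obtain ⟨y, hy⟩ := g3
        rw [← hy] at g1 ⊢
        have k1 := Tight.glue ha'.ge hc4 g1
        have k2 := Tight.glue (a := x) (m := b) (b := c ++ (a' ++ y)) hb.ge f1 (by simpa using k1)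
        simpa using k2
      · rw [join, ← List.append_assoc]
        exact g4.trans (List.suffix_append _ _)
      · rw [join, ← List.append_assoc]
        exact g5.trans (List.suffix_append _ _)

end ExistsJoin

section Hamilton

variable {r : ℕ}

theorem Cod.compl {V : Type} [Fintype V] [DecidableEq V] {E : Finset (Finset V)} {γ : ℝ}
    (hγ : 0 < γ) (hγ1 : γ ≤ 1) (h : Cod E r Finset.univ ((1 / 2 + γ) * Fintype.card V))
    {W : Finset V} (hW : (W.card : ℝ) ≤ γ / 2 * Fintype.card V) :
    Cod E r (Finset.univ \ W) ((1 / 2 + γ / 2) * (Finset.univ \ W).card) ∧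
      Fintype.card V ≤ 2 * (Finset.univ \ W).card := by
  have h1 : (Finset.univ \ W).card + W.card = Fintype.card V :=
    Finset.card_sdiff_add_card_eq_card (Finset.subset_univ W)
  have h2 : ((Finset.univ \ W).card : ℝ) + W.card = Fintype.card V := by exact_mod_cast h1
  have h3 : (0 : ℝ) ≤ W.card := by positivity
  have h4 : (0 : ℝ) ≤ Fintype.card V := by positivity
  refine ⟨h.sdiff ?_, ?_⟩
  · nlinarith
  · have : (Fintype.card V : ℝ) ≤ 2 * (Finset.univ \ W).card := by nlinarith
    exact_mod_cast this

theorem exists_forall_le_mul (c : ℝ) {d : ℝ} (hd : 0 < d) :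
    ∃ N : ℕ, ∀ n : ℕ, N ≤ n → c ≤ d * n := by
  refine ⟨⌈c / d⌉₊, fun n hn => ?_⟩
  have := Nat.ceil_le.mp hn
  rwa [div_le_iff₀' hd] at this

theorem le_floor_of_two_le {x : ℝ} (hx : 2 ≤ x) : x / 2 ≤ (⌊x⌋₊ : ℝ) := by
  have := Nat.lt_floor_add_one x
  linarith

/-- A tight path into which any small set of vertices can be inserted. -/
theorem exists_absorbing_path (hr : 1 ≤ r) {γ : ℝ} (hγ : 0 < γ) (hγ1 : γ ≤ 1 / 2) :
    ∃ ν : ℝ, 0 < ν ∧ ∃ N₀ : ℕ, ∀ {V : Type} [Fintype V] [DecidableEq V] (E : Finset (Finset V)),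
      (∀ e ∈ E, e.card = r + 1) → N₀ ≤ Fintype.card V →
      Cod E r Finset.univ ((1 / 2 + γ) * Fintype.card V) →
      ∀ W : Finset V, (W.card : ℝ) ≤ γ / 4 * Fintype.card V →
      ∃ A : List V, A.Nodup ∧ r ≤ A.length ∧ (A.length : ℝ) ≤ γ / 8 * Fintype.card V ∧
        (∀ x ∈ A, x ∉ W) ∧ ∀ L : List V, (L.length : ℝ) ≤ ν * Fintype.card V →
          ∃ A', Similar E r A A' ∧ A'.Perm (L ++ A) := by
  obtain ⟨q, hq, hfam⟩ := exists_absorber_family hr (γ := γ / 2) (by positivity) (by linarith)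
  obtain ⟨C, N₁, hjoin⟩ := exists_join hr (γ := γ / 2) (by positivity) (by linarith)
  have hr0 : (1 : ℝ) ≤ r := by exact_mod_cast hr
  have hC0 : (0 : ℝ) ≤ C := by positivity
  set α : ℝ := γ / (8 * (2 * r + C)) with hα
  have hα0 : 0 < α := by positivity
  have hαe : (2 * r + C) * α = γ / 8 := by
    rw [hα]; field_simp
  obtain ⟨N₂, hfam⟩ := hfam (α / 2) (by positivity)
  obtain ⟨N₃, h₃⟩ := exists_forall_le_mul 2 hα0
  refine ⟨q * α / 2, by positivity, max (2 * N₁) (max N₂ N₃),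
    fun {V} _ _ E hE hn hcod W hW => ?_⟩
  simp only [max_le_iff] at hn
  obtain ⟨hn1, hn2, hn3⟩ := hn
  set n := Fintype.card V with hndef
  have hn0 : (0 : ℝ) ≤ n := by positivity
  have hαn := h₃ n hn3
  set M := ⌊α * n⌋₊ with hM
  have hM1 : α * n / 2 ≤ (M : ℝ) := le_floor_of_two_le hαn
  have hM2 : (M : ℝ) ≤ α * n := Nat.floor_le (by positivity)
  have hMr : (2 * r + C) * (M : ℝ) ≤ γ / 8 * n := by
    calc (2 * r + C) * (M : ℝ) ≤ (2 * r + C) * (α * n) := by gcongr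
      _ = _ := by rw [← mul_assoc, hαe]
  have hM0 : (0 : ℝ) ≤ M := by positivity
  have hCM : 0 ≤ C * (M : ℝ) := by positivity
  have hrM : 0 ≤ r * (M : ℝ) := by positivity
  obtain ⟨hc1, hc2⟩ := hcod.compl hγ (by linarith) (W := W) (by nlinarith)
  have hc2' : (n : ℝ) ≤ 2 * (Finset.univ \ W).card := by exact_mod_cast hc2
  obtain ⟨segs, hs1, hs2, hs3, hs4, hs5⟩ := hfam E hn2 (Finset.univ \ W) M hc2 (by linarith)
    (by nlinarith) hc1
  have hlen : segs.flatten.length = 2 * r * M := by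
    rw [List.length_flatten, List.map_congr_left (g := fun _ => 2 * r) fun s hs => (hs4 s hs).1,
      List.map_const', List.sum_replicate, hs1, smul_eq_mul, mul_comm]
  have hlen' : (segs.flatten.length : ℝ) = 2 * r * M := by rw [hlen]; push_cast; ring
  have hWc : ((W ∪ segs.flatten.toFinset).card : ℝ) ≤ W.card + 2 * r * M := by
    rw [← hlen', ← List.toFinset_card_of_nodup hs2]
    exact_mod_cast Finset.card_union_le _ _
  obtain ⟨hd1, hd2⟩ := hcod.compl hγ (by linarith) (W := W ∪ segs.flatten.toFinset) (by nlinarith)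
  have hd2' : (n : ℝ) ≤ 2 * (Finset.univ \ (W ∪ segs.flatten.toFinset)).card := by
    exact_mod_cast hd2
  obtain _ | ⟨s, ts⟩ := segs
  · have : (M : ℝ) = 0 := by rw [← hs1]; simp
    linarith
  have hts : (ts.length : ℝ) ≤ M := by
    rw [← hs1, List.length_cons]; push_cast; linarith
  obtain ⟨cs, hcs1, hcs2, hcs3, hcs4, hcs5⟩ := hjoin E hE _ (by omega) hd1 ts s (fun x hx =>
    ⟨by have := (hs4 x hx).1; omega, hs2.sublist (infix_flatten_of_mem hx).sublist⟩) (by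
      calc C * (ts.length : ℝ) ≤ C * M := by gcongr
        _ ≤ γ / 8 * n := by nlinarith
        _ ≤ _ := by nlinarith)
  have hperm := join_perm s ts cs hcs1
  refine ⟨join s ts cs, ?_, ?_, ?_, ?_, ?_⟩
  · rw [hperm.nodup_iff, List.nodup_append]
    refine ⟨hs2, hcs2, ?_⟩
    rintro a ha b hb rfl
    have := hcs3 a hb
    simp only [Finset.mem_sdiff, Finset.mem_union, List.mem_toFinset] at this
    tauto
  · have h1 := (prefix_join s ts cs).length_le
    have h2 := (hs4 s (by simp)).1
    omega
  · rw [hperm.length_eq, List.length_append, hcs4]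
    push_cast
    rw [hlen']
    have : C * (ts.length : ℝ) ≤ C * M := by gcongr
    linarith
  · intro x hx
    rw [hperm.mem_iff, List.mem_append] at hx
    rcases hx with hx | hx
    · have := hs3 x hx
      simpa using this
    · have := hcs3 x hx
      simp only [Finset.mem_sdiff, Finset.mem_union, List.mem_toFinset] at this
      tauto
  · intro L hL
    obtain ⟨segs', hf, hp⟩ := exists_absorb (s :: ts) L hs4 (fun v _ => by
      have h1 := hs5 v
      have h2 : (L.length : ℝ) ≤ q * M := by
        refine hL.trans ?_
        nlinarith
      exact_mod_cast h2.trans h1)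
    obtain ⟨s', ts', h1, h2, rfl⟩ := List.forall₂_cons_left_iff.mp hf
    refine ⟨join s' ts' cs, hcs5 s' ts' h1 h2, ?_⟩
    have h3 := join_perm s' ts' cs (by rw [hcs1, h2.length_eq])
    refine h3.trans ((hp.append_right _).trans ?_)
    rw [List.append_assoc]
    exact hperm.symm.append_left L

/-- A tight Hamilton path with prescribed beginning and end. -/
theorem exists_hamilton (hr : 1 ≤ r) {γ : ℝ} (hγ : 0 < γ) (hγ1 : γ ≤ 1 / 2) :
    ∃ N₀ : ℕ, ∀ {V : Type} [Fintype V] [DecidableEq V] (E : Finset (Finset V)),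
      (∀ e ∈ E, e.card = r + 1) → N₀ ≤ Fintype.card V →
      Cod E r Finset.univ ((1 / 2 + γ) * Fintype.card V) →
      ∀ S T : List V, S.length = r → T.length = r → (S ++ T).Nodup →
      ∃ F : List V, F.Nodup ∧ (∀ x, x ∈ F) ∧ Tight E r F ∧ S <+: F ∧ T <:+ F := by
  obtain ⟨ν, hν, N₁, habs⟩ := exists_absorbing_path hr hγ hγ1
  obtain ⟨C, N₂, hjoin⟩ := exists_join hr (γ := γ / 4) (by positivity) (by linarith)
  obtain ⟨β, hβ, hβγ, hβν⟩ : ∃ β : ℝ, 0 < β ∧ β ≤ γ / 16 ∧ β ≤ ν / 2 :=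
    ⟨min (γ / 16) (ν / 2), by positivity, min_le_left _ _, min_le_right _ _⟩
  obtain ⟨N₃, hres⟩ := exists_reservoir r (γ := γ / 2) (ρ := β / 2) (by positivity) (by linarith)
    (by positivity)
  obtain ⟨K, hK⟩ := exists_forall_le_mul (32 * C) (d := γ * β) (by positivity)
  replace hK := hK (K + r) (by omega)
  obtain ⟨N₄, hcover⟩ := exists_path_cover hr (K := K + r) (by omega) (γ := γ / 2) (ε := β)
    (by positivity) hβ
  obtain ⟨N₅, h₅⟩ := exists_forall_le_mul 2 hβ
  obtain ⟨N₆, h₆⟩ := exists_forall_le_mul (2 * C) (d := γ * β / 32) (by positivity)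
  obtain ⟨N₇, h₇⟩ := exists_forall_le_mul (2 * r) (d := γ / 8) (by positivity)
  obtain ⟨N₈, h₈⟩ := exists_forall_le_mul N₂ (d := β / 2) (by positivity)
  refine ⟨N₁ + N₃ + 2 * N₄ + N₅ + N₆ + N₇ + N₈, fun {V} _ _ E hE hn hcod S T hS hT hST => ?_⟩
  set n := Fintype.card V with hndef
  have hn0 : (0 : ℝ) ≤ n := by positivity
  have hβn := h₅ n (by omega)
  have hCn := h₆ n (by omega)
  have hrn := h₇ n (by omega)
  have hN₂ := h₈ n (by omega)
  have hγn : 0 ≤ γ * n := by positivity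
  set W₀ : Finset V := (S ++ T).toFinset with hW₀
  have hW₀c : (W₀.card : ℝ) ≤ γ / 8 * n := by
    rw [hW₀, List.toFinset_card_of_nodup hST, List.length_append, hS, hT]
    push_cast
    linarith
  obtain ⟨A, hA1, hA2, hA3, hA4, hA5⟩ := habs E hE (by omega) hcod W₀ (by linarith)
  set W₁ : Finset V := W₀ ∪ A.toFinset with hW₁
  have hW₁c : (W₁.card : ℝ) ≤ γ / 4 * n := by
    have : (W₁.card : ℝ) ≤ W₀.card + A.length := by
      rw [← List.toFinset_card_of_nodup hA1]
      exact_mod_cast Finset.card_union_le _ _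
    linarith
  obtain ⟨hc1, hc2⟩ := hcod.compl hγ (by linarith) (W := W₁) (by linarith)
  have hc2' : (n : ℝ) ≤ 2 * (Finset.univ \ W₁).card := by exact_mod_cast hc2
  set M := ⌊β * n⌋₊ with hM
  have hM1 : β * n / 2 ≤ (M : ℝ) := le_floor_of_two_le hβn
  have hM2 : (M : ℝ) ≤ β * n := Nat.floor_le (by positivity)
  have hβn' : β * n ≤ γ / 16 * n := by gcongr
  obtain ⟨R, hR1, hR2, hR3⟩ := hres E (by omega) (Finset.univ \ W₁) M (by linarith)
    (by nlinarith) hc1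
  set W₂ : Finset V := W₁ ∪ R with hW₂
  have hW₂c : (W₂.card : ℝ) ≤ γ / 2 * n := by
    have : (W₂.card : ℝ) ≤ W₁.card + M := by
      rw [← hR2]
      exact_mod_cast Finset.card_union_le _ _
    linarith
  obtain ⟨hd1, hd2⟩ := hcod.compl hγ (by linarith) (W := W₂) hW₂c
  obtain ⟨Ps, hP1, hP2, hP3, hP4⟩ := hcover E hE (Finset.univ \ W₂) (by omega) hd1
  have hPlen : (Ps.length : ℝ) * ((K + r : ℕ) : ℝ) ≤ n := by
    have h1 : Ps.length * (K + r) ≤ Ps.flatten.length := by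
      rw [List.length_flatten, ← smul_eq_mul, ← List.length_map List.length]
      refine List.card_nsmul_le_sum _ _ fun x hx => ?_
      obtain ⟨Q, hQ, rfl⟩ := List.mem_map.mp hx
      exact (hP3 Q hQ).2
    have h2 : Ps.flatten.length ≤ n := by
      rw [← List.toFinset_card_of_nodup hP1]
      exact Finset.card_le_univ _
    exact_mod_cast h1.trans h2
  have hCP : C * (Ps.length : ℝ) ≤ γ * β / 32 * n := by
    have h1 : 32 * C * (Ps.length : ℝ) ≤ γ * β * ((K + r : ℕ) : ℝ) * Ps.length := by gcongr
    have h2 : γ * β * ((Ps.length : ℝ) * ((K + r : ℕ) : ℝ)) ≤ γ * β * n := by gcongr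
    linarith
  obtain ⟨hS', hT', hdis⟩ := List.nodup_append.mp hST
  have hmemP : ∀ Q ∈ Ps, ∀ x ∈ Q, x ∈ Ps.flatten := fun Q hQ x hx =>
    List.mem_flatten.mpr ⟨Q, hQ, hx⟩
  obtain ⟨cs, hcs1, hcs2, hcs3, -, hcs5⟩ := hjoin E hE R (by
      rw [hR2]
      exact_mod_cast hN₂.trans (by linarith : β / 2 * n ≤ (M : ℝ))) (by
      rw [hR2]; convert hR3 using 2; ring) ((A :: Ps) ++ [T]) S (by
      intro x hx
      simp only [List.mem_cons, List.mem_append, List.not_mem_nil, or_false] at hx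
      rcases hx with rfl | (rfl | hx) | rfl
      · exact ⟨hS.ge, hS'⟩
      · exact ⟨hA2, hA1⟩
      · exact ⟨by have := (hP3 x hx).2; omega, hP1.sublist (infix_flatten_of_mem hx).sublist⟩
      · exact ⟨hT.ge, hT'⟩) (by
      rw [hR2]
      simp only [List.length_append, List.length_cons, List.length_nil]
      push_cast
      have : γ * (β * n / 2) ≤ γ * M := by gcongr
      linarith)
  have hperm := join_perm S ((A :: Ps) ++ [T]) cs hcs1
  set F₀ := join S ((A :: Ps) ++ [T]) cs with hF₀
  have hF₀n : F₀.Nodup := by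
    have hAW : ∀ x ∈ A, x ∉ S ∧ x ∉ T := fun x hx => by
      have := hA4 x hx
      simpa [hW₀] using this
    have hPW : ∀ x ∈ Ps.flatten, x ∉ S ∧ x ∉ T ∧ x ∉ A ∧ x ∉ R := fun x hx => by
      have := hP2 x hx
      simp only [hW₂, hW₁, hW₀, Finset.mem_sdiff, Finset.mem_union, List.mem_toFinset,
        List.mem_append] at this
      tauto
    have hcW : ∀ x ∈ cs.flatten, x ∈ R ∧ x ∉ S ∧ x ∉ T ∧ x ∉ A := fun x hx => by
      have h1 := hcs3 x hx
      have := hR1 h1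
      simp only [hW₁, hW₀, Finset.mem_sdiff, Finset.mem_union, List.mem_toFinset,
        List.mem_append] at this
      tauto
    rw [hperm.nodup_iff]
    simp only [List.flatten_cons, List.flatten_append, List.flatten_nil, List.append_nil,
      List.nodup_append', List.disjoint_left, List.mem_append]
    refine ⟨⟨hS', ⟨⟨hA1, hP1, ?_⟩, hT', ?_⟩, ?_⟩, hcs2, ?_⟩
    · intro x h1 h2
      exact (hPW x h2).2.2.1 h1
    · rintro x (h1 | h1) h2
      exacts [(hAW x h1).2 h2, (hPW x h1).2.1 h2]
    · rintro x h1 ((h2 | h2) | h2)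
      exacts [(hAW x h2).1 h1, (hPW x h2).1 h1, hdis x h1 x h2 rfl]
    · rintro x (h1 | (h1 | h1) | h1) h2
      exacts [(hcW x h2).2.1 h1, (hcW x h2).2.2.2 h1, (hPW x h1).2.2.2 (hcW x h2).1,
        (hcW x h2).2.2.1 h1]
  set Lf := (Finset.univ \ F₀.toFinset).toList with hLf
  have hLfc : (Lf.length : ℝ) ≤ ν * n := by
    have h1 : Finset.univ \ F₀.toFinset ⊆ R ∪ ((Finset.univ \ W₂) \ Ps.flatten.toFinset) := by
      intro x hx
      simp only [Finset.mem_sdiff, Finset.mem_univ, true_and, List.mem_toFinset, hperm.mem_iff,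
        List.flatten_cons, List.flatten_append, List.flatten_nil, List.append_nil,
        List.mem_append] at hx
      simp only [hW₂, hW₁, hW₀, Finset.mem_sdiff, Finset.mem_union, Finset.mem_univ, true_and,
        List.mem_toFinset, List.mem_append]
      tauto
    have h2 : (Lf.length : ℝ) ≤
        R.card + ((Finset.univ \ W₂) \ Ps.flatten.toFinset).card := by
      rw [hLf, Finset.length_toList]
      exact_mod_cast (Finset.card_le_card h1).trans (Finset.card_union_le _ _)
    have h3 : β * ((Finset.univ \ W₂).card : ℝ) ≤ β * n := by
      gcongr
      exact Finset.card_le_univ _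
    have h4 : β * n ≤ ν / 2 * n := by gcongr
    rw [hR2] at h2
    linarith
  obtain ⟨A', hA'1, hA'2⟩ := hA5 Lf hLfc
  have hlen : cs.length = ((A' :: Ps) ++ [T]).length := by rw [hcs1]; simp
  have hperm' := join_perm S ((A' :: Ps) ++ [T]) cs hlen
  have hFp : (join S ((A' :: Ps) ++ [T]) cs).Perm (Lf ++ F₀) := by
    rw [List.perm_iff_count] at hperm hperm' hA'2 ⊢
    intro a
    have h1 := hperm a
    have h2 := hperm' a
    have h3 := hA'2 a
    simp only [List.flatten_cons, List.cons_append, List.count_append] at h1 h2 h3 ⊢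
    omega
  refine ⟨join S ((A' :: Ps) ++ [T]) cs, ?_, ?_, ?_, prefix_join _ _ _, ?_⟩
  · rw [hFp.nodup_iff, List.nodup_append']
    refine ⟨Finset.nodup_toList _, hF₀n, ?_⟩
    intro x h1 h2
    simp only [hLf, Finset.mem_toList, Finset.mem_sdiff, List.mem_toFinset] at h1
    exact h1.2 h2
  · intro x
    rw [hFp.mem_iff, List.mem_append]
    simp only [hLf, Finset.mem_toList, Finset.mem_sdiff, List.mem_toFinset, Finset.mem_univ,
      true_and]
    tauto
  · refine (hcs5 S _ (Similar.refl (tight_of_length_le hS.le) hS.ge) ?_).1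
    refine List.rel_append (List.Forall₂.cons hA'1 (List.forall₂_same.mpr fun Q hQ => ?_))
      (List.Forall₂.cons (Similar.refl (tight_of_length_le hT.le) hT.ge) List.Forall₂.nil)
    exact Similar.refl (hP3 Q hQ).1 (by have := (hP3 Q hQ).2; omega)
  · exact suffix_join _ _ _ _ (by rw [hlen]; simp)

end Hamilton

theorem card_filter_superset_le {V : Type} [Fintype V] [DecidableEq V] {E : Finset (Finset V)}
    {r : ℕ} (hE : ∀ e ∈ E, e.card = r + 1) {A : Finset V} (hA : A.card = r) :
    (E.filter fun e => A ⊆ e).card ≤ (nb E A).card := by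
  refine Finset.card_le_card_of_surjOn (fun x => insert x A) fun e he => ?_
  simp only [Finset.coe_filter, Set.mem_ofPred_eq] at he
  obtain ⟨x, hx, rfl⟩ := (Finset.covBy_iff_exists_insert).mp
    (Finset.covBy_iff_card_sdiff_eq_one.mpr ⟨he.2, by
      rw [Finset.card_sdiff_of_subset he.2, hE e he.1, hA]; omega⟩)
  exact ⟨x, by simpa [mem_nb] using ⟨hx, he.1⟩, rfl⟩

end TightHamilton

/-- Lemma 3.5 (tight Hamilton-connectedness of Dirac hypergraphs). A tight Hamilton
path connecting the ordered `(k−1)`-tuples `S` and `T` is encoded by a bijective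
enumeration `v` of all `n` vertices such that every `k` consecutive vertices form an
edge, the first `k−1` vertices are `S` (in order) and the last `k−1` vertices are `T`
in reverse order, i.e. the second end `(v_{n-1}, v_{n-2}, …)` equals `T`. -/
theorem stmt_4 :
    ∀ k : ℕ, 2 ≤ k → ∀ γ : ℝ, 0 < γ →
    ∃ n₀ : ℕ, ∀ n : ℕ, n₀ ≤ n →
    ∀ E : Finset (Finset (Fin n)),
      (∀ e ∈ E, e.card = k) →
      (∀ S : Finset (Fin n), S.card = k - 1 →
        (1/2 + γ) * (n : ℝ) ≤ ((E.filter (fun e => S ⊆ e)).card : ℝ)) →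
    ∀ S T : Fin (k-1) → Fin n,
      Function.Injective S → Function.Injective T →
      (∀ i j, S i ≠ T j) →
      ∃ v : Fin n → Fin n, Function.Bijective v ∧
        (∀ i : ℕ, ∀ _h : i + k ≤ n,
          Finset.image (fun j : Fin k => v ⟨i + (j : ℕ), by have := j.isLt; omega⟩)
            Finset.univ ∈ E) ∧
        (∀ j : Fin (k-1),
          (List.ofFn v)[(j : ℕ)]? = some (S j) ∧
          (List.ofFn v)[n - 1 - (j : ℕ)]? = some (T j)) := by
  intro k hk γ hγ
  obtain ⟨r, rfl⟩ : ∃ r, k = r + 1 := ⟨k - 1, by omega⟩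
  obtain ⟨N, hN⟩ := TightHamilton.exists_hamilton (r := r) (by omega) (γ := min γ (1 / 2))
    (by positivity) (min_le_right _ _)
  refine ⟨N, fun n hn E hE hdeg S T hS hT hST => ?_⟩
  obtain ⟨F, h1, h2, h3, h4, h5⟩ := hN E hE (by simpa using hn) (fun A hA => by
    have h1 := hdeg A hA
    have h2 : (E.filter fun e => A ⊆ e).card ≤ (TightHamilton.nb E A).card := by
      convert TightHamilton.card_filter_superset_le hE hA
    have h3 : ((E.filter fun e => A ⊆ e).card : ℝ) ≤ (TightHamilton.nb E A).card := by
      exact_mod_cast h2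
    have h4 : (1 / 2 + min γ (1 / 2)) * (n : ℝ) ≤ (1 / 2 + γ) * n := by
      gcongr
      exact min_le_left _ _
    rw [Finset.inter_univ, Fintype.card_fin]
    refine h4.trans (h1.trans (le_trans (le_of_eq ?_) h3))
    congr!) (List.ofFn S) (List.ofFn T).reverse (by simp) (by simp) (by
      rw [List.nodup_append', List.nodup_reverse, List.nodup_ofFn, List.nodup_ofFn]
      refine ⟨hS, hT, ?_⟩
      intro x hx hx'
      rw [List.mem_reverse, List.mem_ofFn] at hx'
      rw [List.mem_ofFn] at hx
      obtain ⟨i, rfl⟩ := hx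
      obtain ⟨j, hj⟩ := hx'
      exact hST i j hj.symm)
  have hlen : F.length = n := by
    have h6 : F.toFinset = Finset.univ := by
      ext x
      simp [h2]
    rw [← List.toFinset_card_of_nodup h1, h6, Finset.card_univ, Fintype.card_fin]
  have hv : List.ofFn (fun i : Fin n => F.get (i.cast hlen.symm)) = F := by
    rw [List.ofFn_congr hlen.symm]
    exact List.ofFn_get F
  refine ⟨fun i => F.get (i.cast hlen.symm), ⟨?_, ?_⟩, ?_, ?_⟩
  · exact (List.nodup_iff_injective_get.mp h1).comp (Fin.cast_injective _)
  · intro x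
    obtain ⟨i, rfl⟩ := List.get_of_mem (h2 x)
    exact ⟨i.cast hlen, rfl⟩
  · intro i hi
    convert TightHamilton.tight_iff.mp h3 i (by omega) using 1
    ext x
    simp only [Finset.mem_image, Finset.mem_univ, true_and, List.mem_toFinset, List.mem_iff_getElem,
      List.length_take, List.length_drop, List.getElem_take, List.getElem_drop, List.get_eq_getElem]
    constructor
    · rintro ⟨j, rfl⟩
      exact ⟨j, by have := j.isLt; omega, rfl⟩
    · rintro ⟨j, hj, rfl⟩
      exact ⟨⟨j, by omega⟩, rfl⟩
  · intro j
    have hj : (j : ℕ) < r := j.isLt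
    rw [hv]
    obtain ⟨x, hx⟩ := h4
    obtain ⟨y, hy⟩ := h5
    constructor
    · rw [← hx, List.getElem?_append_left (by simp [hj])]
      simp [hj]
    · have hl : y.length + r = n := by
        have := congrArg List.length hy
        simpa [hlen] using this
      rw [← hy, List.getElem?_append_right (by omega), List.getElem?_reverse (by simp; omega),
        show (List.ofFn T).length - 1 - (n - 1 - (j : ℕ) - y.length) = j by
          rw [List.length_ofFn]; omega]
      simp [hj]
end

section
/- For every integer k ≥ 2 and every constant γ > 0 there exist C > 0 and n₀ ∈ ℕ such that for all n ≥ n₀ with k ∣ n the following holds. Let G be an (n,k,γ)-graph and let M be a perfect matching of G chosen uniformly at random (G has at least one perfect matching). Then for each edge e ∈ E(G), 1/(C n^{k−1}) ≤ ℙ[e ∈ M] ≤ C/n^{k−1}. -/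
open scoped Classical

/-- The set of perfect matchings of the hypergraph on vertex set `Fin n` with edge set
`E`: collections of pairwise disjoint edges covering every vertex. -/
noncomputable def perfectMatchings (n : ℕ) (E : Finset (Finset (Fin n))) :
    Finset (Finset (Finset (Fin n))) :=
  E.powerset.filter (fun M =>
    (M : Set (Finset (Fin n))).PairwiseDisjoint id ∧ M.biUnion id = Finset.univ)

section
open Finset

lemma exp_neg_le_one_sub_add_sq {y : ℝ} (hy : 0 ≤ y) : Real.exp (-y) ≤ 1 - y + y ^ 2 := by
  rw [Real.exp_neg, inv_le_iff_one_le_mul₀ (Real.exp_pos y)]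
  have h1 := Real.add_one_le_exp y
  nlinarith [pow_nonneg hy 3, sq_nonneg (y - 1/2),
    mul_le_mul_of_nonneg_left h1 (show 0 ≤ 1 - y + y ^ 2 by nlinarith [sq_nonneg (y - 1/2)])]

/-- A Chernoff bound for the lower tail of a sum of independent samples. -/
lemma card_sum_lt_le {ι X : Type*} [Fintype ι] [DecidableEq ι] [Fintype X] (f : X → ℝ)
    (h0 : ∀ x, 0 ≤ f x) (h1 : ∀ x, f x ≤ 1) {μ γ : ℝ} (hγ : 0 < γ)
    (hμ : μ * Fintype.card X ≤ ∑ x, f x) :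
    ((univ.filter fun ω : ι → X => ∑ i, f (ω i) < (μ - γ / 2) * Fintype.card ι).card : ℝ) ≤
      Real.exp (-(γ ^ 2 / 16) * Fintype.card ι) * (Fintype.card X : ℝ) ^ Fintype.card ι := by
  set c : ℝ := γ / 4 with hc
  set N : ℝ := ((Fintype.card ι : ℕ) : ℝ) with hN
  have hc0 : 0 < c := by positivity
  have step1 : ∑ x, Real.exp (-(c * f x)) ≤
      Fintype.card X * Real.exp (-c * μ + c ^ 2) := by
    calc ∑ x, Real.exp (-(c * f x)) ≤ ∑ x, (1 + c ^ 2 - c * f x) := by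
          refine sum_le_sum fun x _ => ?_
          have := exp_neg_le_one_sub_add_sq (mul_nonneg hc0.le (h0 x))
          have h2 : (c * f x) ^ 2 ≤ c ^ 2 := by
            rw [mul_pow]
            nlinarith [sq_nonneg c, h0 x, h1 x, pow_le_one₀ (n := 2) (h0 x) (h1 x)]
          linarith
      _ = (1 + c ^ 2) * Fintype.card X - c * ∑ x, f x := by
          rw [sum_sub_distrib, ← mul_sum]; simp; ring
      _ ≤ Fintype.card X * ((-c * μ + c ^ 2) + 1) := by nlinarith
      _ ≤ _ := mul_le_mul_of_nonneg_left (Real.add_one_le_exp _) (by positivity)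
  have step2 : ∑ ω : ι → X, Real.exp (-(c * ∑ i, f (ω i))) =
      (∑ x, Real.exp (-(c * f x))) ^ Fintype.card ι := by
    rw [← Finset.card_univ, ← Finset.prod_const, Finset.prod_univ_sum, Fintype.piFinset_univ]
    refine sum_congr rfl fun ω _ => ?_
    rw [← Real.exp_sum, mul_sum, sum_neg_distrib]
  have step3 : ((univ.filter fun ω : ι → X => ∑ i, f (ω i) < (μ - γ / 2) * N).card : ℝ) *
      Real.exp (-(c * ((μ - γ / 2) * N))) ≤ ∑ ω : ι → X, Real.exp (-(c * ∑ i, f (ω i))) := by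
    rw [← nsmul_eq_mul]
    refine (card_nsmul_le_sum _ _ _ fun ω hω => ?_).trans
      (sum_le_sum_of_subset_of_nonneg (filter_subset _ _) fun _ _ _ => (Real.exp_pos _).le)
    rw [mem_filter] at hω
    exact Real.exp_le_exp.2 (neg_le_neg (mul_le_mul_of_nonneg_left hω.2.le hc0.le))
  have step4 : (∑ x, Real.exp (-(c * f x))) ^ Fintype.card ι ≤
      (Fintype.card X : ℝ) ^ Fintype.card ι * Real.exp (N * (-c * μ + c ^ 2)) := by
    rw [hN, Real.exp_nat_mul, ← mul_pow]
    exact pow_le_pow_left₀ (sum_nonneg fun _ _ => (Real.exp_pos _).le) step1 _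
  have h5 := step3.trans (step2.le.trans step4)
  rw [← le_div_iff₀ (Real.exp_pos _), mul_div_assoc, ← Real.exp_sub,
    mul_comm (_ ^ _)] at h5
  refine h5.trans (le_of_eq ?_)
  congr 2
  rw [hc]; ring

/-- The previous bound, where the summand may depend on one sample that is left out of the sum. -/
lemma card_sum_ne_lt_le {s : ℕ} {X : Type*} [Fintype X] (f : X → X → ℝ) (g₀ : Fin (s + 1))
    (h0 : ∀ y x, 0 ≤ f y x) (h1 : ∀ y x, f y x ≤ 1) {μ γ : ℝ} (hγ : 0 < γ)
    (hμ : ∀ y, μ * Fintype.card X ≤ ∑ x, f y x) :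
    ((univ.filter fun ω : Fin (s + 1) → X =>
        ∑ g ∈ univ.erase g₀, f (ω g₀) (ω g) < (μ - γ / 2) * s).card : ℝ) ≤
      Real.exp (-(γ ^ 2 / 16) * s) * (Fintype.card X : ℝ) ^ (s + 1) := by
  have key : (univ.filter fun ω : Fin (s + 1) → X =>
        ∑ g ∈ univ.erase g₀, f (ω g₀) (ω g) < (μ - γ / 2) * s).card =
      ∑ y : X, (univ.filter fun ω : Fin s → X =>
        ∑ g, f y (ω g) < (μ - γ / 2) * s).card := by
    simp only [card_filter]
    rw [← Fintype.sum_prod_type', ← (Fin.insertNthEquiv (fun _ => X) g₀).sum_comp]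
    refine sum_congr rfl fun p _ => ?_
    have : (univ.erase g₀ : Finset (Fin (s + 1))) = univ.map (Fin.succAboveEmb g₀) := by
      ext i
      simp [Fin.exists_succAbove_eq_iff]
    rw [this, sum_map]
    simp [Fin.insertNthEquiv]
  rw [key]
  push_cast
  calc _ ≤ ∑ y : X, Real.exp (-(γ ^ 2 / 16) * s) * (Fintype.card X : ℝ) ^ s := by
        refine sum_le_sum fun y _ => ?_
        have := card_sum_lt_le (ι := Fin s) (f y) (h0 y) (h1 y) hγ (hμ y)
        simpa using this
    _ = _ := by simp; ring

lemma card_filter_mul_card {ι V : Type*} [Fintype ι] [DecidableEq ι] [Fintype V] (i : ι)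
    (p : (ι → V) → Prop)
    [DecidablePred p] :
    (univ.filter p).card * Fintype.card V =
      ∑ x : ι → V, (univ.filter fun w => p (Function.update x i w)).card := by
  simp only [card_filter]
  have h : ∀ q : (ι → V) → ℕ, ∑ x, q x =
      ∑ w : V, ∑ z : {j // j ≠ i} → V, q ((Equiv.funSplitAt i V).symm (w, z)) := by
    intro q
    rw [← Fintype.sum_prod_type', ← (Equiv.funSplitAt i V).symm.sum_comp]
  rw [h, h]
  have h2 : ∀ (w w' : V) (z : {j // j ≠ i} → V),
      Function.update ((Equiv.funSplitAt i V).symm (w, z)) i w' =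
        (Equiv.funSplitAt i V).symm (w', z) := by
    intro w w' z
    ext j
    by_cases hj : j = i
    · subst hj; simp
    · simp [hj]
  simp only [h2]
  simp only [sum_const, smul_eq_mul, Finset.card_univ]
  rw [mul_comm, sum_comm]

lemma exists_injective_of_two_mul_degree {I : Type*} [Fintype I] (r : I → I → Prop)
    (hr : ∀ i, Fintype.card I ≤ 2 * (univ.filter fun j => r i j).card)
    (hc : ∀ j, Fintype.card I ≤ 2 * (univ.filter fun i => r i j).card) :
    ∃ σ : I → I, Function.Injective σ ∧ ∀ i, r i (σ i) := by
  suffices hall : ∀ S : Finset I, S.card ≤ (S.biUnion fun i => univ.filter fun j => r i j).card by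
    obtain ⟨σ, h1, h2⟩ := (Finset.all_card_le_biUnion_card_iff_exists_injective _).1 hall
    exact ⟨σ, h1, fun i => by simpa using h2 i⟩
  intro S
  rcases S.eq_empty_or_nonempty with rfl | ⟨i, hi⟩
  · simp
  by_cases hS : 2 * S.card ≤ Fintype.card I
  · have : (univ.filter fun j => r i j).card ≤
        (S.biUnion fun i => univ.filter fun j => r i j).card :=
      card_le_card (subset_biUnion_of_mem (fun i => univ.filter fun j => r i j) hi)
    have := hr i
    omega
  · have : S.biUnion (fun i => univ.filter fun j => r i j) = univ := by
      ext j
      simp only [mem_biUnion, mem_filter, mem_univ, true_and, iff_true]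
      by_contra! hcon
      have hdis : Disjoint S (univ.filter fun i => r i j) :=
        disjoint_left.2 fun i hi h => hcon i hi (mem_filter.1 h).2
      have h1 := card_union_of_disjoint hdis
      have h2 := card_le_univ (S ∪ univ.filter fun i => r i j)
      have := hc j
      omega
    rw [this]
    exact card_le_univ S

/-- `E` is a `k`-graph on `Fin n` all of whose codegrees are at least `θ * n`. -/
def HasCodegree (k n : ℕ) (θ : ℝ) (E : Finset (Finset (Fin n))) : Prop :=
  (∀ e ∈ E, e.card = k) ∧ ∀ S : Finset (Fin n), S.card = k - 1 →
    θ * (n : ℝ) ≤ ((E.filter (fun e => S ⊆ e)).card : ℝ)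

/-- A tuple which, if its entries are distinct, spans an edge. -/
def Legal {k n : ℕ} (E : Finset (Finset (Fin n))) (h : Fin k → Fin n) : Prop :=
  Function.Injective h → univ.image h ∈ E

lemma HasCodegree.le_card_legal_update {k n : ℕ} {θ : ℝ} {E : Finset (Finset (Fin n))}
    (hE : HasCodegree k n θ E) (hθ : θ ≤ 1) (h : Fin k → Fin n) (b : Fin k) :
    θ * n ≤ ((univ.filter fun w => Legal E (Function.update h b w)).card : ℝ) := by
  have hk : 1 ≤ k := Fin.pos b
  by_cases hinj : Set.InjOn h (univ.erase b : Finset (Fin k))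
  · set S := (univ.erase b).image h with hS
    have hScard : S.card = k - 1 := by
      rw [hS, card_image_of_injOn hinj, card_erase_of_mem (mem_univ _)]; simp
    refine (hE.2 S hScard).trans ?_
    have hsub : E.filter (fun e => S ⊆ e) ⊆
        (univ.filter fun w => Legal E (Function.update h b w)).image fun w => insert w S := by
      intro e he
      rw [mem_filter] at he
      have hcard := hE.1 e he.1
      obtain ⟨w, hw, rfl⟩ := exists_eq_insert_iff.2 ⟨he.2, by omega⟩
      refine mem_image.2 ⟨w, mem_filter.2 ⟨mem_univ _, fun _ => ?_⟩, rfl⟩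
      convert he.1
      ext v
      simp only [mem_image, mem_univ, true_and, mem_insert, hS, mem_erase, and_true]
      constructor
      · rintro ⟨a, rfl⟩
        by_cases hab : a = b
        · subst hab; simp
        · right; exact ⟨a, hab, by simp [hab]⟩
      · rintro (rfl | ⟨a, hab, rfl⟩)
        · exact ⟨b, by simp⟩
        · exact ⟨a, by simp [hab]⟩
    exact_mod_cast (card_le_card hsub).trans card_image_le
  · have : (univ.filter fun w => Legal E (Function.update h b w)) = univ := by
      refine filter_true_of_mem fun w _ hw => (hinj ?_).elim
      intro a ha a' ha' haa
      apply hw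
      simp only [coe_erase, coe_univ, Set.mem_sdiff, Set.mem_univ, Set.mem_singleton_iff,
        true_and] at ha ha'
      simp [ha, ha', haa]
    rw [this]
    simpa using mul_le_mul_of_nonneg_right hθ (Nat.cast_nonneg (α := ℝ) n)

lemma le_sum_card_filter_div {k n : ℕ} (hk : 0 < k) (hn : 0 < n) {θ : ℝ}
    (q : Fin k → (Fin k → Fin n) → Prop) (κ : Fin k → Fin k)
    (hq : ∀ c y, θ * n ≤ ((univ.filter fun w => q c (Function.update y (κ c) w)).card : ℝ)) :
    θ * Fintype.card (Fin k → Fin n) ≤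
      ∑ y : Fin k → Fin n, ((univ.filter fun c => q c y).card : ℝ) / k := by
  have hc : ∀ c, θ * Fintype.card (Fin k → Fin n) ≤ ((univ.filter (q c)).card : ℝ) := by
    intro c
    have h1 := card_filter_mul_card (κ c) (q c)
    have h2 : (Fintype.card (Fin k → Fin n) : ℝ) * (θ * n) ≤
        ((univ.filter (q c)).card : ℝ) * n := by
      have : ((univ.filter (q c)).card : ℝ) * n = ∑ y : Fin k → Fin n,
          ((univ.filter fun w => q c (Function.update y (κ c) w)).card : ℝ) := by
        rw [Fintype.card_fin] at h1
        exact_mod_cast h1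
      rw [this, ← nsmul_eq_mul, ← Finset.card_univ]
      exact card_nsmul_le_sum _ _ _ fun y _ => hq c y
    have hn' : (0 : ℝ) < n := by exact_mod_cast hn
    nlinarith
  have hk' : (0 : ℝ) < k := by exact_mod_cast hk
  rw [← sum_div, le_div_iff₀ hk']
  have hswap : ∑ y : Fin k → Fin n, ((univ.filter fun c => q c y).card : ℝ) =
      ∑ c, ((univ.filter (q c)).card : ℝ) := by
    simp only [card_filter]
    push_cast
    exact sum_comm
  rw [hswap]
  have := card_nsmul_le_sum univ (fun c => ((univ.filter (q c)).card : ℝ)) _ fun c _ => hc c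
  simp only [Finset.card_univ, Fintype.card_fin, nsmul_eq_mul] at this ⊢
  linarith

lemma card_low_degree_le {k n s : ℕ} (hk : 0 < k) (hn : 0 < n) {γ : ℝ} (hγ : 0 < γ)
    (q : (Fin k → Fin n) → Fin k → (Fin k → Fin n) → Prop) (κ : Fin k → Fin k)
    (g₀ : Fin (s + 1))
    (hq : ∀ y₀ c y,
      (1 / 2 + γ) * n ≤ ((univ.filter fun w => q y₀ c (Function.update y (κ c) w)).card : ℝ)) :
    ((univ.filter fun ω : Fin (s + 1) × Fin k → Fin n =>
        ((univ.filter fun p : Fin (s + 1) × Fin k => p.1 ≠ g₀ ∧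
          q (fun a => ω (g₀, a)) p.2 (fun a => ω (p.1, a))).card : ℝ) <
            (1 / 2 + γ / 2) * (k * s)).card : ℝ) ≤
      Real.exp (-(γ ^ 2 / 16) * s) * (n : ℝ) ^ ((s + 1) * k) := by
  have hk' : (0 : ℝ) < k := by exact_mod_cast hk
  have main := card_sum_ne_lt_le (s := s)
    (fun y x : Fin k → Fin n => ((univ.filter fun c => q y c x).card : ℝ) / k) g₀
    (fun y x => by positivity)
    (fun y x => by
      rw [div_le_one hk']
      have := card_le_univ (univ.filter fun c => q y c x)
      rw [Fintype.card_fin] at this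
      exact_mod_cast this) hγ
    (fun y => le_sum_card_filter_div hk hn (q y) κ (hq y))
  refine le_trans (le_of_eq ?_) (main.trans (le_of_eq ?_))
  · congr 1
    refine card_equiv (Equiv.curry _ _ _) fun ω => ?_
    simp only [mem_filter, mem_univ, true_and]
    rw [← sum_div, div_lt_iff₀ hk']
    have : (univ.filter fun p : Fin (s + 1) × Fin k => p.1 ≠ g₀ ∧
          q (fun a => ω (g₀, a)) p.2 (fun a => ω (p.1, a))).card =
        ∑ g ∈ univ.erase g₀, (univ.filter fun c =>
          q (fun a => ω (g₀, a)) c (fun a => ω (g, a))).card := by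
      simp only [card_filter]
      rw [Fintype.sum_prod_type, ← Finset.add_sum_erase _ _ (mem_univ g₀)]
      simp only [ne_eq, not_true_eq_false, false_and, if_false, sum_const_zero, zero_add]
      refine sum_congr rfl fun g hg => sum_congr rfl fun c _ => ?_
      simp [(mem_erase.1 hg).1]
    rw [this]
    push_cast
    have h2 : (1 / 2 + γ / 2) * ((k : ℝ) * s) = (1 / 2 + γ - γ / 2) * s * k := by ring
    rw [h2]
    rfl
  · simp [mul_comm, ← pow_mul]

/-- `P` is a partition of `Fin n` into sets of size `k`. -/
def IsKPartition (k n : ℕ) (P : Finset (Finset (Fin n))) : Prop :=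
  (∀ p ∈ P, p.card = k) ∧ (P : Set (Finset (Fin n))).PairwiseDisjoint id ∧
    P.biUnion id = Finset.univ

/-- Every partition into `k`-sets is the orbit partition of a free cyclic action; `x v b` is the
`b`-th translate of `v`, and `pt v` is the part of `v`. -/
structure IsRotation {k n : ℕ} [NeZero k] (P : Finset (Finset (Fin n)))
    (x : Fin n → Fin k → Fin n) (pt : Fin n → Finset (Fin n)) : Prop where
  pt_mem : ∀ v, pt v ∈ P
  mem_pt : ∀ v, v ∈ pt v
  card_pt : ∀ v, (pt v).card = k
  pt_eq : ∀ v, ∀ w ∈ pt v, pt w = pt v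
  image_eq : ∀ v, univ.image (x v) = pt v
  inj : ∀ v, Function.Injective (x v)
  bij : ∀ b, Function.Bijective fun v => x v b

lemma IsKPartition.exists_isRotation {k n : ℕ} [NeZero k] {P : Finset (Finset (Fin n))}
    (hP : IsKPartition k n P) :
    ∃ (x : Fin n → Fin k → Fin n) (pt : Fin n → Finset (Fin n)), IsRotation P x pt := by
  rcases Nat.eq_zero_or_pos n with rfl | hn
  · exact ⟨fun v => v.elim0, fun v => v.elim0, fun v => v.elim0, fun v => v.elim0,
      fun v => v.elim0, fun v => v.elim0, fun v => v.elim0, fun v => v.elim0,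
      fun _ => ⟨fun v => v.elim0, fun v => v.elim0⟩⟩
  obtain ⟨hcard, hdis, hcov⟩ := hP
  have h1 : ∀ v : Fin n, ∃ p ∈ P, v ∈ p := fun v => by
    have : v ∈ P.biUnion id := hcov ▸ mem_univ v
    simpa using this
  choose pt hptP hvpt using h1
  have huniq : ∀ v, ∀ p ∈ P, v ∈ p → pt v = p := fun v p hp hv =>
    hdis.elim_finset (hptP v) hp v (hvpt v) hv
  have h2 : ∀ p : Finset (Fin n), ∃ en : Fin k → Fin n, p ∈ P →
      Function.Injective en ∧ univ.image en = p := by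
    intro p
    by_cases hp : p ∈ P
    · refine ⟨p.orderEmbOfFin (hcard p hp), fun _ => ⟨(p.orderEmbOfFin _).injective, ?_⟩⟩
      ext v
      simp
    · exact ⟨fun _ => ⟨0, hn⟩, fun h => (hp h).elim⟩
  choose en hen using h2
  have h3 : ∀ v, ∃ a, en (pt v) a = v := fun v => by
    have := hvpt v
    rw [← (hen _ (hptP v)).2] at this
    simpa using this
  choose idx hidx using h3
  have hmem : ∀ v b, en (pt v) b ∈ pt v := fun v b =>
    (Finset.ext_iff.1 (hen _ (hptP v)).2 _).1 (mem_image_of_mem _ (mem_univ b))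
  refine ⟨fun v b => en (pt v) (idx v + b), pt, hptP, hvpt, fun v => hcard _ (hptP v),
    fun v w hw => huniq w _ (hptP v) hw, fun v => ?_, fun v => ?_, fun b => ?_⟩
  · conv_rhs => rw [← (hen _ (hptP v)).2]
    ext w
    simp only [mem_image, mem_univ, true_and]
    constructor
    · rintro ⟨b, hb⟩; exact ⟨_, hb⟩
    · rintro ⟨b, hb⟩; exact ⟨b - idx v, by simpa using hb⟩
  · exact fun b b' h => add_left_cancel ((hen _ (hptP v)).1 h)
  · refine Finite.injective_iff_bijective.1 fun v v' h => ?_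
    change en (pt v) (idx v + b) = en (pt v') (idx v' + b) at h
    have hpt : pt v = pt v' := by
      have h4 := huniq _ _ (hptP v) (hmem v (idx v + b))
      have h5 := huniq _ _ (hptP v') (hmem v' (idx v' + b))
      rw [← h4, h, h5]
    rw [hpt] at h
    have := add_right_cancel ((hen _ (hptP v')).1 h)
    rw [← hidx v, ← hidx v', hpt, this]

/-- The grid of vertices used for a switching: rows indexed by `inl (g, c)` are filled by the
translates of the sample `y` of group `g`, rows indexed by `inr j` are prescribed. -/
def gridRow {k n r s : ℕ} [NeZero k] (x : Fin n → Fin k → Fin n) (ρ : Fin r → Fin k → Fin n) :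
    (Fin (s + 1) × Fin k) ⊕ Fin r → (Fin k → Fin n) → Fin k → Fin n
  | .inl p, y, b => x (y (p.2 + b)) b
  | .inr j, _, b => ρ j b

def gridGroup {k r s : ℕ} : (Fin (s + 1) × Fin k) ⊕ Fin r → Fin (s + 1)
  | .inl p => p.1
  | .inr _ => 0

def grid {k n r s : ℕ} [NeZero k] (x : Fin n → Fin k → Fin n) (ρ : Fin r → Fin k → Fin n)
    (ω : Fin (s + 1) × Fin k → Fin n) (i : (Fin (s + 1) × Fin k) ⊕ Fin r) : Fin k → Fin n :=
  gridRow x ρ i fun a => ω (gridGroup i, a)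

/-- The first vertex of row `i` together with the rest of row `j` is an edge, unless degenerate. -/
def GridAdj {k n r s : ℕ} [NeZero k] (E : Finset (Finset (Fin n)))
    (x : Fin n → Fin k → Fin n) (ρ : Fin r → Fin k → Fin n)
    (ω : Fin (s + 1) × Fin k → Fin n) (i j : (Fin (s + 1) × Fin k) ⊕ Fin r) : Prop :=
  Legal E fun b => if b = 0 then grid x ρ ω i b else grid x ρ ω j b

section
variable {k n r s : ℕ} [NeZero k] {γ : ℝ} {E P : Finset (Finset (Fin n))}
  {x : Fin n → Fin k → Fin n} {pt : Fin n → Finset (Fin n)}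

lemma card_filter_comp_bijective {V : Type*} [Fintype V] {f : V → V} (hf : f.Bijective)
    (p : V → Prop) : (univ.filter fun w => p (f w)).card = (univ.filter p).card := by
  refine card_bij (fun w _ => f w) (fun w hw => by simpa using hw)
    (fun _ _ _ _ h => hf.1 h) fun w hw => ?_
  obtain ⟨v, rfl⟩ := hf.2 w
  exact ⟨v, by simpa using hw, rfl⟩

lemma card_low_row_le (hk : 2 ≤ k) (hn : 0 < n) (hγ : 0 < γ) (hγ' : γ ≤ 1 / 2)
    (hE : HasCodegree k n (1 / 2 + γ) E) (hx : IsRotation P x pt) (ρ : Fin r → Fin k → Fin n)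
    (hs : ((s + 1) * k + r : ℝ) ≤ 2 * ((1 / 2 + γ / 2) * (k * s)))
    (i : (Fin (s + 1) × Fin k) ⊕ Fin r) :
    ((univ.filter fun ω : Fin (s + 1) × Fin k → Fin n =>
      2 * (univ.filter fun j => GridAdj E x ρ ω i j).card < (s + 1) * k + r).card : ℝ) ≤
      Real.exp (-(γ ^ 2 / 16) * s) * (n : ℝ) ^ ((s + 1) * k) := by
  have h10 : (1 : Fin k) ≠ 0 := by
    intro h
    have := congrArg Fin.val h
    rw [Fin.val_one', Fin.val_zero, Nat.mod_eq_of_lt (by omega)] at this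
    omega
  refine le_trans ?_ (card_low_degree_le (by omega) hn hγ
    (fun y₀ c y => Legal E fun b => if b = 0 then gridRow x ρ i y₀ b else x (y (c + b)) b)
    (fun c => c + 1) (gridGroup i) ?_)
  · refine Nat.cast_le.2 (card_le_card fun ω hω => ?_)
    simp only [mem_filter, mem_univ, true_and] at hω ⊢
    have hle : (univ.filter fun p : Fin (s + 1) × Fin k => p.1 ≠ gridGroup i ∧
        Legal E fun b => if b = 0 then gridRow x ρ i (fun a => ω (gridGroup i, a)) b
          else x (ω (p.1, p.2 + b)) b).card ≤ (univ.filter fun j => GridAdj E x ρ ω i j).card :=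
      card_le_card_of_injOn Sum.inl (fun p hp => by
        simp only [coe_filter, mem_univ, true_and, Set.mem_ofPred_eq] at hp ⊢
        exact hp.2) Sum.inl_injective.injOn
    have h1 : (2 * (univ.filter fun j => GridAdj E x ρ ω i j).card : ℝ) < (s + 1) * k + r := by
      exact_mod_cast hω
    have h2 : ((univ.filter fun p : Fin (s + 1) × Fin k => p.1 ≠ gridGroup i ∧
        Legal E fun b => if b = 0 then gridRow x ρ i (fun a => ω (gridGroup i, a)) b
          else x (ω (p.1, p.2 + b)) b).card : ℝ) ≤
            (univ.filter fun j => GridAdj E x ρ ω i j).card := by exact_mod_cast hle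
    linarith
  · intro y₀ c y
    refine (hE.le_card_legal_update (by linarith)
      (fun b => if b = 0 then gridRow x ρ i y₀ b else x (y (c + b)) b) 1).trans ?_
    rw [← card_filter_comp_bijective (hx.bij 1)]
    refine Nat.cast_le.2 (card_le_card fun w hw => ?_)
    simp only [mem_filter, mem_univ, true_and] at hw ⊢
    convert hw using 1
    funext b
    by_cases hb : b = 1
    · subst hb; simp [h10]
    · simp [hb]

lemma card_low_col_le (hk : 2 ≤ k) (hn : 0 < n) (hγ : 0 < γ) (hγ' : γ ≤ 1 / 2)
    (hE : HasCodegree k n (1 / 2 + γ) E) (hx : IsRotation P x pt) (ρ : Fin r → Fin k → Fin n)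
    (hs : ((s + 1) * k + r : ℝ) ≤ 2 * ((1 / 2 + γ / 2) * (k * s)))
    (j : (Fin (s + 1) × Fin k) ⊕ Fin r) :
    ((univ.filter fun ω : Fin (s + 1) × Fin k → Fin n =>
      2 * (univ.filter fun i => GridAdj E x ρ ω i j).card < (s + 1) * k + r).card : ℝ) ≤
      Real.exp (-(γ ^ 2 / 16) * s) * (n : ℝ) ^ ((s + 1) * k) := by
  refine le_trans ?_ (card_low_degree_le (by omega) hn hγ
    (fun y₀ c y => Legal E fun b => if b = 0 then x (y (c + b)) b else gridRow x ρ j y₀ b)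
    id (gridGroup j) ?_)
  · refine Nat.cast_le.2 (card_le_card fun ω hω => ?_)
    simp only [mem_filter, mem_univ, true_and] at hω ⊢
    have hle : (univ.filter fun p : Fin (s + 1) × Fin k => p.1 ≠ gridGroup j ∧
        Legal E fun b => if b = 0 then x (ω (p.1, p.2 + b)) b
          else gridRow x ρ j (fun a => ω (gridGroup j, a)) b).card ≤
        (univ.filter fun i => GridAdj E x ρ ω i j).card :=
      card_le_card_of_injOn Sum.inl (fun p hp => by
        simp only [coe_filter, mem_univ, true_and, Set.mem_ofPred_eq] at hp ⊢
        exact hp.2) Sum.inl_injective.injOn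
    have h1 : (2 * (univ.filter fun i => GridAdj E x ρ ω i j).card : ℝ) < (s + 1) * k + r := by
      exact_mod_cast hω
    have h2 := (Nat.cast_le (α := ℝ)).2 hle
    linarith
  · intro y₀ c y
    refine (hE.le_card_legal_update (by linarith)
      (fun b => if b = 0 then x (y (c + b)) b else gridRow x ρ j y₀ b) 0).trans ?_
    rw [← card_filter_comp_bijective (hx.bij 0)]
    refine Nat.cast_le.2 (card_le_card fun w hw => ?_)
    simp only [mem_filter, mem_univ, true_and] at hw ⊢
    convert hw using 1
    funext b
    by_cases hb : b = 0
    · subst hb; simp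
    · simp [hb]

lemma card_same_part_le {ι : Type*} [Fintype ι] [DecidableEq ι] (hx : IsRotation P x pt)
    {i j : ι} (hij : j ≠ i) :
    (univ.filter fun ω : ι → Fin n => pt (ω i) = pt (ω j)).card * n ≤ n ^ Fintype.card ι * k := by
  have := card_filter_mul_card (V := Fin n) i fun ω : ι → Fin n => pt (ω i) = pt (ω j)
  rw [Fintype.card_fin] at this
  rw [this]
  refine (sum_le_card_nsmul _ _ k fun ω _ => ?_).trans (by simp)
  rw [← hx.card_pt (ω j)]
  refine card_le_card fun w hw => ?_
  have hw : pt w = pt (ω j) := by simpa [hij] using hw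
  exact hw ▸ hx.mem_pt w

lemma card_mem_le {ι : Type*} [Fintype ι] [DecidableEq ι] (i : ι) (B : Finset (Fin n)) :
    (univ.filter fun ω : ι → Fin n => ω i ∈ B).card * n ≤ n ^ Fintype.card ι * B.card := by
  have := card_filter_mul_card (V := Fin n) i fun ω : ι → Fin n => ω i ∈ B
  rw [Fintype.card_fin] at this
  rw [this]
  refine (sum_le_card_nsmul _ _ B.card fun ω _ => ?_).trans (by simp)
  exact card_le_card fun w hw => by simpa using hw

end

section
variable {k n r s : ℕ} [NeZero k] {γ : ℝ} {E P : Finset (Finset (Fin n))}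
  {x : Fin n → Fin k → Fin n} {pt : Fin n → Finset (Fin n)}

/-- A sample whose vertices lie in distinct parts, outside `B`, and for which every row and every
column of `GridAdj` is at least half full. -/
structure GoodSample (E : Finset (Finset (Fin n))) (x : Fin n → Fin k → Fin n)
    (pt : Fin n → Finset (Fin n)) (ρ : Fin r → Fin k → Fin n) (B : Finset (Fin n))
    (ω : Fin (s + 1) × Fin k → Fin n) : Prop where
  pt_inj : Function.Injective fun p => pt (ω p)
  notMem : ∀ p, ω p ∉ B
  row : ∀ i, (s + 1) * k + r ≤ 2 * (univ.filter fun j => GridAdj E x ρ ω i j).card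
  col : ∀ j, (s + 1) * k + r ≤ 2 * (univ.filter fun i => GridAdj E x ρ ω i j).card

lemma half_le_card_goodSample (hk : 2 ≤ k) (hn : 0 < n) (hγ : 0 < γ) (hγ' : γ ≤ 1 / 2)
    (hE : HasCodegree k n (1 / 2 + γ) E) (hx : IsRotation P x pt) (ρ : Fin r → Fin k → Fin n)
    (hs : ((s + 1) * k + r : ℝ) ≤ 2 * ((1 / 2 + γ / 2) * (k * s)))
    (hs' : 2 * ((s + 1) * k + r : ℝ) * Real.exp (-(γ ^ 2 / 16) * s) ≤ 1 / 4)
    (B : Finset (Fin n))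
    (hnB : 4 * (((s + 1) * k) ^ 2 * k + (s + 1) * k * B.card) ≤ n) :
    (n : ℝ) ^ ((s + 1) * k) / 2 ≤
      ((univ.filter fun ω : Fin (s + 1) × Fin k → Fin n => GoodSample E x pt ρ B ω).card : ℝ) := by
  set t := (s + 1) * k with ht
  have hcι : Fintype.card (Fin (s + 1) × Fin k) = t := by simp [ht]
  have hn' : (0 : ℝ) < n := by exact_mod_cast hn
  set S₁ := univ.biUnion fun i => univ.filter fun ω : Fin (s + 1) × Fin k → Fin n =>
      2 * (univ.filter fun j => GridAdj E x ρ ω i j).card < (s + 1) * k + r with hS₁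
  set S₂ := univ.biUnion fun j => univ.filter fun ω : Fin (s + 1) × Fin k → Fin n =>
      2 * (univ.filter fun i => GridAdj E x ρ ω i j).card < (s + 1) * k + r with hS₂
  set S₃ := (univ.offDiag : Finset ((Fin (s + 1) × Fin k) × (Fin (s + 1) × Fin k))).biUnion
    fun q => univ.filter fun ω : Fin (s + 1) × Fin k → Fin n => pt (ω q.1) = pt (ω q.2) with hS₃
  set S₄ := univ.biUnion fun p => univ.filter fun ω : Fin (s + 1) × Fin k → Fin n => ω p ∈ B
    with hS₄
  have h1 : (S₁.card : ℝ) ≤ (t + r) * (Real.exp (-(γ ^ 2 / 16) * s) * (n : ℝ) ^ t) := by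
    refine (Nat.cast_le.2 card_biUnion_le).trans ?_
    push_cast
    refine (sum_le_card_nsmul _ _ _ fun i _ => card_low_row_le hk hn hγ hγ' hE hx ρ hs i).trans ?_
    simp [ht]
  have h2 : (S₂.card : ℝ) ≤ (t + r) * (Real.exp (-(γ ^ 2 / 16) * s) * (n : ℝ) ^ t) := by
    refine (Nat.cast_le.2 card_biUnion_le).trans ?_
    push_cast
    refine (sum_le_card_nsmul _ _ _ fun i _ => card_low_col_le hk hn hγ hγ' hE hx ρ hs i).trans ?_
    simp [ht]
  have h3 : S₃.card * n ≤ t ^ 2 * (n ^ t * k) := by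
    refine (Nat.mul_le_mul_right _ card_biUnion_le).trans ?_
    rw [sum_mul]
    refine (sum_le_card_nsmul _ _ (n ^ t * k) fun q hq => ?_).trans ?_
    · rw [← hcι]
      exact card_same_part_le hx (mem_offDiag.1 hq).2.2.symm
    · rw [smul_eq_mul]
      refine Nat.mul_le_mul_right _ ?_
      rw [offDiag_card, Finset.card_univ, hcι, sq]
      omega
  have h4 : S₄.card * n ≤ t * (n ^ t * B.card) := by
    refine (Nat.mul_le_mul_right _ card_biUnion_le).trans ?_
    rw [sum_mul]
    refine (sum_le_card_nsmul _ _ (n ^ t * B.card) fun q hq => ?_).trans ?_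
    · rw [← hcι]
      exact card_mem_le q B
    · rw [smul_eq_mul, Finset.card_univ, hcι]
  have h34 : ((S₃.card : ℝ) + S₄.card) ≤ (n : ℝ) ^ t / 4 := by
    have h5 : 4 * (S₃.card + S₄.card) * n ≤ n ^ t * n := by
      calc 4 * (S₃.card + S₄.card) * n = 4 * (S₃.card * n + S₄.card * n) := by ring
        _ ≤ 4 * (t ^ 2 * (n ^ t * k) + t * (n ^ t * B.card)) := by gcongr
        _ = n ^ t * (4 * (t ^ 2 * k + t * B.card)) := by ring
        _ ≤ _ := Nat.mul_le_mul_left _ hnB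
    have h6 : 4 * (S₃.card + S₄.card) ≤ n ^ t := Nat.le_of_mul_le_mul_right h5 hn
    have h7 : 4 * ((S₃.card : ℝ) + S₄.card) ≤ (n : ℝ) ^ t := by exact_mod_cast h6
    linarith
  have h12 : (S₁.card : ℝ) + S₂.card ≤ (n : ℝ) ^ t / 4 := by
    have h8 : ((2 : ℝ) * ((s + 1) * k + r) * Real.exp (-(γ ^ 2 / 16) * s)) * (n : ℝ) ^ t ≤
      1 / 4 * (n : ℝ) ^ t := by gcongr
    have h9 : (t : ℝ) = (s + 1) * k := by rw [ht]; push_cast; ring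
    rw [h9] at h1 h2
    linarith
  have hcov : (univ : Finset (Fin (s + 1) × Fin k → Fin n)) ⊆
      (univ.filter fun ω : Fin (s + 1) × Fin k → Fin n => GoodSample E x pt ρ B ω) ∪
        ((S₁ ∪ S₂) ∪ (S₃ ∪ S₄)) := by
    intro ω _
    by_contra hω
    simp only [mem_union, not_or, hS₁, hS₂, hS₃, hS₄, mem_biUnion, mem_filter, mem_univ, true_and,
      not_exists, not_and, mem_offDiag, not_lt] at hω
    obtain ⟨hg, ⟨ha, hb⟩, hc, hd⟩ := hω
    refine hg ⟨fun p q hpq => ?_, hd, ha, hb⟩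
    by_contra hne
    exact hc (p, q) hne hpq
  have hfin := card_le_card hcov
  rw [Finset.card_univ, Fintype.card_fun, hcι, Fintype.card_fin] at hfin
  have hfin' := hfin.trans ((card_union_le _ _).trans (Nat.add_le_add_left
    ((card_union_le _ _).trans (Nat.add_le_add (card_union_le _ _) (card_union_le _ _))) _))
  have := (Nat.cast_le (α := ℝ)).2 hfin'
  push_cast at this
  linarith

lemma grid_injective (hx : IsRotation P x pt) {ρ : Fin r → Fin k → Fin n}
    (hρ : Function.Injective (Function.uncurry ρ)) {B : Finset (Fin n)}
    (hρB : ∀ j b, ρ j b ∈ B) (hB : ∀ v ∈ B, pt v ⊆ B) {ω : Fin (s + 1) × Fin k → Fin n}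
    (hω : GoodSample E x pt ρ B ω) : Function.Injective (Function.uncurry (grid x ρ ω)) := by
  have hmem : ∀ v b, x v b ∈ pt v := fun v b =>
    hx.image_eq v ▸ mem_image_of_mem _ (mem_univ b)
  have hout : ∀ v b, v ∉ B → x v b ∉ B := fun v b hv h => by
    have h1 := hB _ h
    rw [hx.pt_eq _ _ (hmem v b)] at h1
    exact hv (h1 (hx.mem_pt v))
  rintro ⟨i, b⟩ ⟨j, b'⟩ h
  rcases i with ⟨g, c⟩ | i <;> rcases j with ⟨g', c'⟩ | j
  · change x (ω (g, c + b)) b = x (ω (g', c' + b')) b' at h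
    have h1 : pt (ω (g, c + b)) = pt (ω (g', c' + b')) := by
      rw [← hx.pt_eq _ _ (hmem _ b), h, hx.pt_eq _ _ (hmem _ b')]
    have h2 := hω.pt_inj h1
    rw [h2] at h
    have h3 := hx.inj _ h
    subst h3
    simp only [Prod.mk.injEq, add_left_inj] at h2
    rw [h2.1, h2.2]
  · exact (hout _ b (hω.notMem (g, c + b)) (by
      change x (ω (g, c + b)) b = ρ j b' at h
      rw [h]; exact hρB _ _)).elim
  · exact (hout _ b' (hω.notMem (g', c' + b')) (by
      change ρ i b = x (ω (g', c' + b')) b' at h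
      rw [← h]; exact hρB _ _)).elim
  · have h1 : (i, b) = (j, b') := hρ h
    simp only [Prod.mk.injEq] at h1
    rw [h1.1, h1.2]

lemma image_grid (hx : IsRotation P x pt) (ρ : Fin r → Fin k → Fin n)
    (ω : Fin (s + 1) × Fin k → Fin n) :
    univ.image (Function.uncurry (grid x ρ ω)) =
      univ.image (Function.uncurry ρ) ∪ (univ.image fun p => pt (ω p)).biUnion id := by
  ext v
  simp only [mem_image, mem_univ, true_and, mem_union, mem_biUnion, id]
  constructor
  · rintro ⟨⟨⟨g, c⟩ | i, b⟩, rfl⟩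
    · right
      refine ⟨_, ⟨(g, c + b), rfl⟩, ?_⟩
      rw [← hx.image_eq]
      exact mem_image_of_mem _ (mem_univ b)
    · exact Or.inl ⟨(i, b), rfl⟩
  · rintro (⟨⟨i, b⟩, rfl⟩ | ⟨_, ⟨⟨g, a⟩, rfl⟩, hv⟩)
    · exact ⟨(.inr i, b), rfl⟩
    · rw [← hx.image_eq] at hv
      obtain ⟨b, -, rfl⟩ := mem_image.1 hv
      refine ⟨(.inl (g, a - b), b), ?_⟩
      change x (ω (g, a - b + b)) b = x (ω (g, a)) b
      rw [sub_add_cancel]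

/-- The rows of an injective grid, after permuting the rest of the rows against the first
entries, form a matching. -/
lemma exists_matching_of_goodSample (hx : IsRotation P x pt) {ρ : Fin r → Fin k → Fin n}
    (hρ : Function.Injective (Function.uncurry ρ)) {B : Finset (Fin n)}
    (hρB : ∀ j b, ρ j b ∈ B) (hB : ∀ v ∈ B, pt v ⊆ B) {ω : Fin (s + 1) × Fin k → Fin n}
    (hω : GoodSample E x pt ρ B ω) :
    ∃ Q ⊆ E, (Q : Set (Finset (Fin n))).PairwiseDisjoint id ∧
      Q.biUnion id = univ.image (Function.uncurry ρ) ∪ (univ.image fun p => pt (ω p)).biUnion id ∧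
      ∀ f ∈ Q, ∀ j j', ρ j 0 ∈ f → ρ j' 0 ∈ f → j = j' := by
  have hinj := grid_injective hx hρ hρB hB hω
  have hcard : Fintype.card ((Fin (s + 1) × Fin k) ⊕ Fin r) = (s + 1) * k + r := by simp
  obtain ⟨σ, hσ, hadj⟩ := exists_injective_of_two_mul_degree (GridAdj E x ρ ω)
    (fun i => hcard ▸ hω.row i) (fun j => hcard ▸ hω.col j)
  have hσs : Function.Surjective σ := Finite.injective_iff_surjective.1 hσ
  set Ψ : (Fin (s + 1) × Fin k) ⊕ Fin r → Fin k → Fin n :=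
    fun i b => grid x ρ ω (if b = 0 then i else σ i) b with hΨ
  have hΨinj : ∀ i b i' b', Ψ i b = Ψ i' b' → i = i' ∧ b = b' := by
    intro i b i' b' h
    have h1 := @hinj (if b = 0 then i else σ i, b) (if b' = 0 then i' else σ i', b') h
    simp only [Prod.mk.injEq] at h1
    obtain ⟨h2, rfl⟩ := h1
    refine ⟨?_, rfl⟩
    split_ifs at h2
    · exact h2
    · exact hσ h2
  refine ⟨univ.image fun i => univ.image (Ψ i), ?_, ?_, ?_, ?_⟩
  · intro f hf
    obtain ⟨i, -, rfl⟩ := mem_image.1 hf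
    have h1 := hadj i
    have h2 : (fun b => if b = 0 then grid x ρ ω i b else grid x ρ ω (σ i) b) = Ψ i := by
      funext b
      simp only [hΨ]
      split_ifs <;> rfl
    rw [GridAdj, h2] at h1
    exact h1 fun b b' h => (hΨinj _ _ _ _ h).2
  · intro f hf f' hf' hne
    simp only [coe_image, coe_univ, Set.image_univ, Set.mem_range] at hf hf'
    obtain ⟨i, rfl⟩ := hf
    obtain ⟨i', rfl⟩ := hf'
    refine disjoint_left.2 fun v hv hv' => hne ?_
    obtain ⟨b, -, rfl⟩ := mem_image.1 hv
    obtain ⟨b', -, h⟩ := mem_image.1 hv'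
    rw [(hΨinj _ _ _ _ h).1]
  · rw [← image_grid hx]
    ext v
    simp only [mem_biUnion, mem_image, mem_univ, true_and, id, exists_exists_eq_and]
    constructor
    · rintro ⟨i, b, rfl⟩
      exact ⟨(_, b), rfl⟩
    · rintro ⟨⟨i, b⟩, rfl⟩
      by_cases hb : b = 0
      · exact ⟨i, b, by simp [hΨ, hb]⟩
      · obtain ⟨j, rfl⟩ := hσs i
        exact ⟨j, b, by simp [hΨ, hb]⟩
  · intro f hf j j' hj hj'
    obtain ⟨i, -, rfl⟩ := mem_image.1 hf
    have h0 : ∀ j : Fin r, ρ j 0 = Ψ (.inr j) 0 := fun j => rfl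
    rw [h0] at hj hj'
    obtain ⟨b, -, h⟩ := mem_image.1 hj
    obtain ⟨b', -, h'⟩ := mem_image.1 hj'
    have := (hΨinj _ _ _ _ h).1.symm.trans (hΨinj _ _ _ _ h').1
    exact Sum.inr_injective this

end

lemma exists_grid_enumeration {k n r : ℕ} [NeZero k] {A R : Finset (Fin n)} (hAR : A ⊆ R)
    (hA : A.card = r) (hR : R.card = k * r) :
    ∃ ρ : Fin r → Fin k → Fin n, Function.Injective (Function.uncurry ρ) ∧
      univ.image (Function.uncurry ρ) = R ∧ ∀ v ∈ A, ∃ j, ρ j 0 = v := by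
  have h1 : Fintype.card A = Fintype.card (Fin r) := by simp [hA]
  have h2 : Fintype.card ((R \ A : Finset (Fin n)) : Type) =
      Fintype.card (Fin r × {b : Fin k // b ≠ 0}) := by
    rw [Fintype.card_coe, card_sdiff_of_subset hAR, hA, hR, Fintype.card_prod,
      Fintype.card_subtype_compl]
    simp only [Fintype.card_fin, Fintype.card_unique]
    rw [Nat.mul_sub, mul_one, mul_comm]
  let eA := Fintype.equivOfCardEq h1
  let eR := Fintype.equivOfCardEq h2
  let ρ : Fin r → Fin k → Fin n := fun j b =>
    if h : b = 0 then eA.symm j else eR.symm (j, ⟨b, h⟩)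
  have hinj : Function.Injective (Function.uncurry ρ) := by
    rintro ⟨j, b⟩ ⟨j', b'⟩ h
    simp only [Function.uncurry, ρ] at h
    split_ifs at h with hb hb' hb'
    · rw [hb, hb', eA.symm.injective (Subtype.ext h)]
    · have h3 := (mem_sdiff.1 (eR.symm (j', ⟨b', hb'⟩)).2).2
      exact (h3 (h ▸ (eA.symm j).2)).elim
    · have h3 := (mem_sdiff.1 (eR.symm (j, ⟨b, hb⟩)).2).2
      exact (h3 (h ▸ (eA.symm j').2)).elim
    · have := eR.symm.injective (Subtype.ext h)
      simp only [Prod.mk.injEq, Subtype.mk.injEq] at this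
      rw [this.1, this.2]
  refine ⟨ρ, hinj, ?_, fun v hv => ⟨eA ⟨v, hv⟩, by simp [ρ]⟩⟩
  refine eq_of_subset_of_card_le (fun v hv => ?_) ?_
  · obtain ⟨⟨j, b⟩, -, rfl⟩ := mem_image.1 hv
    simp only [Function.uncurry, ρ]
    split_ifs
    · exact hAR (eA.symm j).2
    · exact (mem_sdiff.1 (eR.symm _).2).1
  · rw [card_image_of_injective _ hinj, hR]
    simp [mul_comm]

lemma exists_group_number {k : ℕ} {γ : ℝ} (hγ : 0 < γ) :
    ∃ s : ℕ, 2 ≤ γ * s ∧ 2 * ((s + 2) * k : ℝ) * Real.exp (-(γ ^ 2 / 16) * s) ≤ 1 / 4 := by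
  set q := Real.exp (-(γ ^ 2 / 16)) with hq
  have hq1 : q < 1 := Real.exp_lt_one_iff.2 (by have := pow_pos hγ 2; linarith)
  have h1 := tendsto_self_mul_const_pow_of_lt_one (Real.exp_pos _).le hq1
  have h2 : ∀ᶠ s : ℕ in Filter.atTop, (s : ℝ) * q ^ s < 1 / (24 * (k + 1)) :=
    h1.eventually_lt_const (by positivity)
  have h3 : ∀ᶠ s : ℕ in Filter.atTop, 2 / γ ≤ (s : ℝ) :=
    tendsto_natCast_atTop_atTop.eventually_ge_atTop _
  obtain ⟨s, ⟨hs2, hs3⟩, hs1⟩ := ((h2.and h3).and (Filter.eventually_ge_atTop 1)).exists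
  refine ⟨s, by rw [div_le_iff₀ hγ] at hs3; linarith, ?_⟩
  have h4 : Real.exp (-(γ ^ 2 / 16) * s) = q ^ s := by
    rw [hq, ← Real.exp_nat_mul, mul_comm]
  rw [h4]
  have hs1' : (1 : ℝ) ≤ s := by exact_mod_cast hs1
  have hqs : 0 ≤ q ^ s := pow_nonneg (Real.exp_pos _).le _
  rw [lt_div_iff₀ (by positivity)] at hs2
  have hk : (0 : ℝ) ≤ k := Nat.cast_nonneg k
  have h5 : 2 * ((s + 2) * k : ℝ) * q ^ s ≤ 2 * ((3 * s) * (k + 1)) * q ^ s := by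
    gcongr <;> linarith
  linarith

/-- The `t`-subsets `D` of `P \ D₀` which together with `R` can be rearranged into edges splitting
the set `A`. -/
noncomputable def switchings {n : ℕ} (t : ℕ) (E P D₀ : Finset (Finset (Fin n)))
    (A R : Finset (Fin n)) : Finset (Finset (Finset (Fin n))) :=
  (powersetCard t (P \ D₀)).filter fun D => ∃ Q ⊆ E,
    (Q : Set (Finset (Fin n))).PairwiseDisjoint id ∧
    Q.biUnion id = R ∪ D.biUnion id ∧ ∀ f ∈ Q, (f ∩ A).card ≤ 1

/-- For every partition into `k`-sets and all bounded sets `A ⊆ R` of fitting sizes, there are at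
least `c * n ^ t` switchings. -/
def Switchable (k n t : ℕ) (c : ℝ) (E : Finset (Finset (Fin n))) : Prop :=
  ∀ P D₀ : Finset (Finset (Fin n)), IsKPartition k n P → D₀ ⊆ P → D₀.card ≤ k →
    ∀ (r : ℕ) (A R : Finset (Fin n)), r ≤ k → A ⊆ R → R ⊆ D₀.biUnion id →
      A.card = r → R.card = k * r →
    c * (n : ℝ) ^ t ≤ ((switchings t E P D₀ A R).card : ℝ)

lemma exists_switchable (k : ℕ) (hk : 2 ≤ k) (γ : ℝ) (hγ : 0 < γ) (hγ' : γ ≤ 1 / 2) :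
    ∃ (t : ℕ) (c : ℝ) (n₀ : ℕ), 0 < c ∧ ∀ n, n₀ ≤ n → ∀ E : Finset (Finset (Fin n)),
      HasCodegree k n (1 / 2 + γ) E → Switchable k n t c E := by
  obtain ⟨s, hs1, hs2⟩ := exists_group_number (k := k) hγ
  have : NeZero k := ⟨by omega⟩
  set t := (s + 1) * k with ht
  have htpos : 0 < t := by positivity
  refine ⟨t, 1 / (2 * (t * k : ℝ) ^ t), 4 * (t ^ 2 * k + t * (k * k)) + 1, by positivity, ?_⟩
  intro n hn E hE P D₀ hP hD₀ hD₀k r A R hr hAR hRD hA hR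
  obtain ⟨x, pt, hx⟩ := hP.exists_isRotation
  obtain ⟨ρ, hρ, hρR, hρA⟩ := exists_grid_enumeration hAR hA hR
  set B := D₀.biUnion id with hB
  have hBcard : B.card ≤ k * k := by
    refine (card_biUnion_le_card_mul _ _ k fun p hp => (hP.1 p (hD₀ hp)).le).trans ?_
    gcongr
  have hptB : ∀ v ∈ B, pt v ∈ D₀ := by
    intro v hv
    obtain ⟨p, hp, hvp⟩ := mem_biUnion.1 hv
    rwa [hP.2.1.elim_finset (hx.pt_mem v) (hD₀ hp) v (hx.mem_pt v) hvp]
  have hkR : (0 : ℝ) < k := by exact_mod_cast (show 0 < k by omega)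
  have hrR : (r : ℝ) ≤ k := by exact_mod_cast hr
  have hmany := half_le_card_goodSample (s := s) hk (by omega : 0 < n) hγ hγ' hE hx ρ
    (by nlinarith) (by
      refine le_trans ?_ hs2
      gcongr
      linarith) B (by
      have : t * B.card ≤ t * (k * k) := Nat.mul_le_mul_left _ hBcard
      change 4 * (t ^ 2 * k + t * B.card) ≤ n
      omega)
  set Good := univ.filter fun ω : Fin (s + 1) × Fin k → Fin n => GoodSample E x pt ρ B ω
  have hfib := card_le_mul_card_image_of_maps_to (s := Good)
    (t := switchings t E P D₀ A R)
    (f := fun ω => univ.image fun p => pt (ω p)) (fun ω hω => ?_) ((t * k) ^ t) ?_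
  · have h1 := (Nat.cast_le (α := ℝ)).2 hfib
    push_cast at h1
    have h2 := hmany.trans h1
    rw [one_div, inv_mul_le_iff₀ (by positivity)]
    rw [div_le_iff₀ two_pos] at h2
    linarith
  · have hω : GoodSample E x pt ρ B ω := (mem_filter.1 hω).2
    refine mem_filter.2 ⟨mem_powersetCard.2 ⟨fun p hp => ?_, ?_⟩, ?_⟩
    · obtain ⟨i, -, rfl⟩ := mem_image.1 hp
      exact mem_sdiff.2 ⟨hx.pt_mem _, fun h =>
        hω.notMem i (mem_biUnion.2 ⟨_, h, hx.mem_pt _⟩)⟩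
    · rw [card_image_of_injective _ hω.pt_inj]
      simp [ht]
    · obtain ⟨Q, hQE, hQd, hQc, hQA⟩ := exists_matching_of_goodSample hx hρ
        (fun j b => hRD (hρR ▸ mem_image_of_mem (Function.uncurry ρ) (mem_univ (j, b))))
        (fun v hv w hw => mem_biUnion.2 ⟨_, hptB v hv, hw⟩) hω
      refine ⟨Q, hQE, hQd, by rw [hQc, hρR], fun f hf => card_le_one.2 fun a ha b hb => ?_⟩
      rw [mem_inter] at ha hb
      obtain ⟨j, rfl⟩ := hρA a ha.2
      obtain ⟨j', rfl⟩ := hρA b hb.2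
      rw [hQA f hf j j' ha.1 hb.1]
  · intro D hD
    have hD := mem_powersetCard.1 (mem_filter.1 hD).1
    have h1 : (D.biUnion id).card ≤ t * k := by
      rw [← hD.2]
      exact card_biUnion_le_card_mul _ _ k fun p hp => (hP.1 p (mem_sdiff.1 (hD.1 hp)).1).le
    calc _ ≤ (Fintype.piFinset fun _ : Fin (s + 1) × Fin k => D.biUnion id).card := by
          refine card_le_card fun ω hω => Fintype.mem_piFinset.2 fun i => ?_
          have := (mem_filter.1 hω).2
          exact mem_biUnion.2 ⟨pt (ω i), this ▸ mem_image_of_mem _ (mem_univ i), hx.mem_pt _⟩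
      _ = (D.biUnion id).card ^ t := by simp [ht]
      _ ≤ _ := Nat.pow_le_pow_left h1 t

lemma card_biUnion_id {k n : ℕ} {Q : Finset (Finset (Fin n))} (hc : ∀ f ∈ Q, f.card = k)
    (hd : (Q : Set (Finset (Fin n))).PairwiseDisjoint id) :
    (Q.biUnion id).card = k * Q.card := by
  exact (card_biUnion hd).trans ((sum_const_nat hc).trans (mul_comm _ _))

lemma IsKPartition.card_mul {k n : ℕ} {P : Finset (Finset (Fin n))} (hP : IsKPartition k n P) :
    k * P.card = n := by
  rw [← card_biUnion_id hP.1 hP.2.1, hP.2.2, card_univ, Fintype.card_fin]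

lemma IsKPartition.disjoint_biUnion {k n : ℕ} {P D : Finset (Finset (Fin n))}
    (hP : IsKPartition k n P) (hD : D ⊆ P) {f : Finset (Fin n)} (hf : f ∈ P \ D) :
    Disjoint f (D.biUnion id) := by
  rw [mem_sdiff] at hf
  exact (disjoint_biUnion_right _ _ _).2 fun g hg =>
    hP.2.1 hf.1 (hD hg) fun h => hf.2 (h ▸ hg)

lemma IsKPartition.replace {k n : ℕ} (hk : 0 < k) {P D Q : Finset (Finset (Fin n))}
    (hP : IsKPartition k n P) (hD : D ⊆ P) (hQ : ∀ f ∈ Q, f.card = k)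
    (hQd : (Q : Set (Finset (Fin n))).PairwiseDisjoint id)
    (hQD : Q.biUnion id = D.biUnion id) :
    IsKPartition k n (P \ D ∪ Q) ∧ (P \ D ∪ Q) \ Q = P \ D ∧ Q.card = D.card := by
  have hdis : ∀ f ∈ P \ D, ∀ g ∈ Q, Disjoint f g := fun f hf g hg =>
    (hP.disjoint_biUnion hD hf).mono_right (hQD ▸ subset_biUnion_of_mem id hg)
  refine ⟨⟨fun f hf => ?_, ?_, ?_⟩, ?_, ?_⟩
  · rcases mem_union.1 hf with h | h
    · exact hP.1 f (mem_sdiff.1 h).1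
    · exact hQ f h
  · rw [coe_union, Set.pairwiseDisjoint_union]
    exact ⟨hP.2.1.subset (by simp), hQd, fun f hf g hg _ => hdis f hf g hg⟩
  · rw [union_biUnion, hQD, ← union_biUnion, sdiff_union_of_subset hD, hP.2.2]
  · rw [union_sdiff_right, Finset.sdiff_eq_self_iff_disjoint]
    refine disjoint_left.2 fun f hf hfQ => ?_
    have h1 := disjoint_self.1 (hdis f hf f hfQ)
    have h2 := hQ f hfQ
    rw [h1] at h2
    simp at h2
    omega
  · have h1 := card_biUnion_id hQ hQd
    rw [hQD, card_biUnion_id (fun f hf => hP.1 f (hD hf)) (hP.2.1.subset hD)] at h1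
    exact (Nat.eq_of_mul_eq_mul_left hk h1).symm

lemma exists_isKPartition {k n : ℕ} (hkn : k ∣ n) :
    ∃ P : Finset (Finset (Fin n)), IsKPartition k n P := by
  obtain ⟨m, rfl⟩ := hkn
  let e : Fin k × Fin m ≃ Fin (k * m) := finProdFinEquiv
  refine ⟨univ.image fun i => univ.image fun b => e (b, i), ?_, ?_, ?_⟩
  · intro p hp
    obtain ⟨i, -, rfl⟩ := mem_image.1 hp
    rw [card_image_of_injective _ fun b b' h => (Prod.ext_iff.1 (e.injective h)).1]
    simp
  · intro p hp p' hp' hne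
    simp only [coe_image, coe_univ, Set.image_univ, Set.mem_range] at hp hp'
    obtain ⟨i, rfl⟩ := hp
    obtain ⟨i', rfl⟩ := hp'
    refine disjoint_left.2 fun v hv hv' => hne ?_
    obtain ⟨b, -, rfl⟩ := mem_image.1 hv
    obtain ⟨b', -, h⟩ := mem_image.1 hv'
    have h2 : i' = i := (Prod.ext_iff.1 (e.injective h)).2
    rw [h2]
  · ext v
    simp only [mem_biUnion, mem_image, mem_univ, true_and, id, exists_exists_eq_and, iff_true]
    exact ⟨(e.symm v).2, (e.symm v).1, by simp⟩

lemma mem_perfectMatchings_iff {k n : ℕ} {E M : Finset (Finset (Fin n))}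
    (hE : ∀ e ∈ E, e.card = k) :
    M ∈ perfectMatchings n E ↔ M ⊆ E ∧ IsKPartition k n M := by
  rw [perfectMatchings, mem_filter, mem_powerset]
  exact ⟨fun h => ⟨h.1, fun p hp => hE p (h.1 hp), h.2⟩, fun h => ⟨h.1, h.2.2⟩⟩

lemma perfectMatchings_nonempty {k n t : ℕ} {c : ℝ} {E : Finset (Finset (Fin n))} (hk : 0 < k)
    (hn : 0 < n) (hkn : k ∣ n) (hc : 0 < c) (hE : ∀ e ∈ E, e.card = k)
    (hsw : Switchable k n t c E) : (perfectMatchings n E).Nonempty := by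
  obtain ⟨P, hP, hmin⟩ := exists_min_image (univ.filter (IsKPartition k n))
    (fun P => (P \ E).card) ((exists_isKPartition hkn).imp fun P hP => by simpa using hP)
  have hP : IsKPartition k n P := (mem_filter.1 hP).2
  refine ⟨P, (mem_perfectMatchings_iff hE).2 ⟨?_, hP⟩⟩
  intro p hp
  by_contra hpE
  obtain ⟨v, hv⟩ : p.Nonempty := card_pos.1 (hP.1 p hp ▸ hk)
  have h1 := hsw P {p} hP (by simpa using hp) (by rw [card_singleton]; exact hk) 1 {v} p hk
    (by simpa using hv) (by simp) (by simp) (by simp [hP.1 p hp])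
  have h2 : (0 : ℝ) < (switchings t E P {p} {v} p).card :=
    lt_of_lt_of_le (by have : (0 : ℝ) < n := by exact_mod_cast hn
                       positivity) h1
  obtain ⟨D, hD⟩ := card_pos.1 (by exact_mod_cast h2 : 0 < (switchings t E P {p} {v} p).card)
  obtain ⟨hD, Q, hQE, hQd, hQc, -⟩ := mem_filter.1 hD
  have hDP : insert p D ⊆ P :=
    insert_subset hp ((mem_powersetCard.1 hD).1.trans sdiff_subset)
  obtain ⟨hP', -, -⟩ := hP.replace hk hDP (fun f hf => hE f (hQE hf)) hQd
    (by rw [hQc, biUnion_insert, id])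
  have h3 := hmin _ (mem_filter.2 ⟨mem_univ _, hP'⟩)
  refine absurd h3 (not_le.2 (card_lt_card (ssubset_iff_of_subset ?_ |>.2 ⟨p, ?_, ?_⟩)))
  · intro f hf
    grind
  · grind
  · grind

lemma card_powersetCard_filter_superset_le {α : Type*} [DecidableEq α] (M X : Finset α) (d : ℕ) :
    ((powersetCard d M).filter fun D => X ⊆ D).card ≤ M.card ^ (d - X.card) := by
  refine le_trans (card_le_card_of_injOn (t := powersetCard (d - X.card) M) (fun D => D \ X)
    (fun D hD => ?_) fun D hD D' hD' h => ?_)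
    ((card_powersetCard _ _).trans_le (Nat.choose_le_pow _ _))
  · simp only [coe_filter, mem_powersetCard, Set.mem_ofPred_eq] at hD
    exact mem_coe.2 (mem_powersetCard.2 ⟨sdiff_subset.trans hD.1.1, by
      rw [card_sdiff_of_subset hD.2, hD.1.2]⟩)
  · simp only [coe_filter, Set.mem_ofPred_eq] at hD hD'
    rw [← sdiff_union_of_subset hD.2, ← sdiff_union_of_subset hD'.2]
    exact congrArg (· ∪ X) h

/-- Double counting of switchings: replacing `D₀ ∪ D` in `M` by `D'` in `M'` is bounded-to-one. -/
lemma card_mul_le_of_switching {n u : ℕ} (𝒜 ℬ : Finset (Finset (Finset (Fin n))))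
    (G : Finset (Finset (Fin n)) → Finset (Σ _ : Finset (Finset (Fin n)), Finset (Finset (Fin n))))
    (H : Finset (Finset (Fin n)) → Finset (Finset (Finset (Fin n)))) {a b : ℝ}
    (hGH : ∀ M ∈ 𝒜, ∀ q ∈ G M, q.1 ∪ q.2 ⊆ M ∧ ∃ M' ∈ ℬ, ∃ D' ∈ H M',
      M' \ D' = M \ (q.1 ∪ q.2) ∧ D'.biUnion id = (q.1 ∪ q.2).biUnion id)
    (hu : ∀ M' ∈ ℬ, ∀ D' ∈ H M', (D'.biUnion id).card ≤ u)
    (ha : ∀ M ∈ 𝒜, a ≤ ((G M).card : ℝ)) (hb : ∀ M' ∈ ℬ, ((H M').card : ℝ) ≤ b) :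
    𝒜.card * a ≤ ((2 : ℝ) ^ 2 ^ u) ^ 2 * (ℬ.card * b) := by
  have hex : ∀ z : Σ _ : Finset (Finset (Fin n)),
      Σ _ : Finset (Finset (Fin n)), Finset (Finset (Fin n)),
      ∃ y : Σ _ : Finset (Finset (Fin n)), Finset (Finset (Fin n)), z ∈ 𝒜.sigma G →
        z.2.1 ∪ z.2.2 ⊆ z.1 ∧ y ∈ ℬ.sigma H ∧ y.1 \ y.2 = z.1 \ (z.2.1 ∪ z.2.2) ∧
          y.2.biUnion id = (z.2.1 ∪ z.2.2).biUnion id := by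
    intro z
    by_cases hz : z ∈ 𝒜.sigma G
    · obtain ⟨hz1, hz2⟩ := mem_sigma.1 hz
      obtain ⟨h1, M', hM', D', hD', h2, h3⟩ := hGH _ hz1 _ hz2
      exact ⟨⟨M', D'⟩, fun _ => ⟨h1, mem_sigma.2 ⟨hM', hD'⟩, h2, h3⟩⟩
    · exact ⟨⟨∅, ∅⟩, fun h => (hz h).elim⟩
  choose F hF using hex
  have hcount : (𝒜.sigma G).card ≤ (2 ^ 2 ^ u) ^ 2 * (ℬ.sigma H).card := by
    refine card_le_mul_card_image_of_maps_to (fun z hz => (hF z hz).2.1) _ fun y hy => ?_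
    obtain ⟨hy1, hy2⟩ := mem_sigma.1 hy
    set W := (y.2.biUnion id).powerset.powerset with hW
    have hWc : W.card ≤ 2 ^ 2 ^ u := by
      rw [hW, card_powerset, card_powerset]
      exact Nat.pow_le_pow_right two_pos (Nat.pow_le_pow_right two_pos (hu _ hy1 _ hy2))
    refine (card_le_card_of_injOn (t := W ×ˢ W) (fun z => (z.2.1, z.2.2)) ?_ ?_).trans ?_
    · intro z hz
      simp only [coe_filter, Set.mem_ofPred_eq] at hz
      obtain ⟨hz, rfl⟩ := hz
      have h := (hF z hz).2.2.2
      have hsub : ∀ D ⊆ z.2.1 ∪ z.2.2, D ∈ W := fun D hD =>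
        mem_powerset.2 fun f hf => mem_powerset.2 (h ▸ subset_biUnion_of_mem id (hD hf))
      exact mem_coe.2 (mem_product.2 ⟨hsub _ subset_union_left, hsub _ subset_union_right⟩)
    · rintro ⟨M, D₀, D⟩ hz ⟨M₁, D₁, D₂⟩ hz' h
      simp only [coe_filter, Set.mem_ofPred_eq] at hz hz'
      simp only [Prod.mk.injEq] at h
      obtain ⟨rfl, rfl⟩ := h
      have h1 := hF _ hz.1
      have h2 := hF _ hz'.1
      rw [hz.2] at h1
      rw [hz'.2] at h2
      have h3 : M = M₁ := by
        have h4 : M \ (D₀ ∪ D) = M₁ \ (D₀ ∪ D) := h1.2.2.1.symm.trans h2.2.2.1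
        exact (sdiff_union_of_subset h1.1).symm.trans
          ((congrArg (· ∪ (D₀ ∪ D)) h4).trans (sdiff_union_of_subset h2.1))
      rw [h3]
    · rw [card_product, sq]
      exact Nat.mul_le_mul hWc hWc
  rw [card_sigma, card_sigma] at hcount
  have hcount' := (Nat.cast_le (α := ℝ)).2 hcount
  push_cast at hcount'
  have h1 := card_nsmul_le_sum 𝒜 (fun M => ((G M).card : ℝ)) a ha
  have h2 := sum_le_card_nsmul ℬ (fun M => ((H M).card : ℝ)) b hb
  rw [nsmul_eq_mul] at h1 h2
  exact h1.trans (hcount'.trans (mul_le_mul_of_nonneg_left h2 (by positivity)))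

lemma IsKPartition.sum_card_inter {k n : ℕ} {M : Finset (Finset (Fin n))}
    (hM : IsKPartition k n M) (e : Finset (Fin n)) :
    ∑ f ∈ M.filter (fun f => ¬ Disjoint f e), (f ∩ e).card = e.card := by
  rw [← card_biUnion]
  · congr 1
    ext v
    simp only [mem_biUnion, mem_filter, mem_inter]
    refine ⟨fun ⟨f, _, h⟩ => h.2, fun hv => ?_⟩
    have : v ∈ M.biUnion id := hM.2.2 ▸ mem_univ v
    obtain ⟨f, hf, hvf⟩ := mem_biUnion.1 this
    exact ⟨f, ⟨hf, not_disjoint_iff.2 ⟨v, hvf, hv⟩⟩, hvf, hv⟩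
  · intro f hf g hg hne
    exact (hM.2.1 (mem_filter.1 hf).1 (mem_filter.1 hg).1 hne).mono inter_subset_left
      inter_subset_left

lemma IsKPartition.card_le {k n : ℕ} (hk : 0 < k) {P : Finset (Finset (Fin n))}
    (hP : IsKPartition k n P) : P.card ≤ n :=
  (Nat.le_mul_of_pos_left _ hk).trans hP.card_mul.le

lemma IsKPartition.card_touching_le {k n : ℕ} {M : Finset (Finset (Fin n))}
    (hM : IsKPartition k n M) (e : Finset (Fin n)) :
    (M.filter fun f => ¬ Disjoint f e).card ≤ e.card := by
  rw [← hM.sum_card_inter e, card_eq_sum_ones]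
  exact sum_le_sum fun f hf =>
    card_pos.2 (not_disjoint_iff_nonempty_inter.1 (mem_filter.1 hf).2)

lemma IsKPartition.subset_biUnion_of_touching_subset {k n : ℕ} {M D₀ : Finset (Finset (Fin n))}
    (hM : IsKPartition k n M) {e : Finset (Fin n)}
    (hD₀ : (M.filter fun f => ¬ Disjoint f e) ⊆ D₀) : e ⊆ D₀.biUnion id := fun v hv => by
  obtain ⟨f, hf, hvf⟩ := mem_biUnion.1 (hM.2.2 ▸ mem_univ v : v ∈ M.biUnion id)
  exact mem_biUnion.2 ⟨f, hD₀ (mem_filter.2 ⟨hf, not_disjoint_iff.2 ⟨v, hvf, hv⟩⟩), hvf⟩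

lemma card_union_of_mem_switchings {n t : ℕ} {E M D₀ D : Finset (Finset (Fin n))}
    {A R : Finset (Fin n)} (hD : D ∈ switchings t E M D₀ A R) :
    (D₀ ∪ D).card = D₀.card + t := by
  have h := mem_powersetCard.1 (mem_filter.1 hD).1
  rw [card_union_of_disjoint (disjoint_sdiff.mono_right h.1), h.2]

lemma card_perfectMatchings_le {k n t : ℕ} {c : ℝ} {E : Finset (Finset (Fin n))} (hk : 0 < k)
    (hkn : k * k ≤ n) (hE : ∀ e ∈ E, e.card = k) (hsw : Switchable k n t c E)
    {e : Finset (Fin n)} (he : e ∈ E) :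
    (perfectMatchings n E).card * (c * (n : ℝ) ^ t) ≤ ((2 : ℝ) ^ 2 ^ (k * (k + t))) ^ 2 *
      (((perfectMatchings n E).filter fun M => e ∈ M).card * (n : ℝ) ^ (k + t - 1)) := by
  have hex : ∀ M : Finset (Finset (Fin n)), ∃ D₀ : Finset (Finset (Fin n)),
      ∃ A : Finset (Fin n), M ∈ perfectMatchings n E →
        (M.filter fun f => ¬ Disjoint f e) ⊆ D₀ ∧ D₀ ⊆ M ∧ D₀.card = k ∧
        A ⊆ D₀.biUnion id \ e ∧ A.card = k - 1 ∧ (D₀.biUnion id \ e).card = k * (k - 1) := by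
    intro M
    by_cases hM : M ∈ perfectMatchings n E
    · obtain ⟨-, hM⟩ := (mem_perfectMatchings_iff hE).1 hM
      obtain ⟨D₀, h1, h2, h3⟩ := exists_subsuperset_card_eq
        (filter_subset (fun f => ¬ Disjoint f e) M)
        ((hM.card_touching_le e).trans (hE e he).le)
        (Nat.le_of_mul_le_mul_left (hkn.trans hM.card_mul.ge) hk)
      have h4 : (D₀.biUnion id \ e).card = k * (k - 1) := by
        rw [card_sdiff_of_subset (hM.subset_biUnion_of_touching_subset h1), hE e he,
          card_biUnion_id (fun f hf => hM.1 f (h2 hf)) (hM.2.1.subset h2), h3, Nat.mul_sub_one]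
      obtain ⟨A, hA, hAc⟩ := exists_subset_card_eq
        (h4 ▸ Nat.le_mul_of_pos_left _ hk : k - 1 ≤ (D₀.biUnion id \ e).card)
      exact ⟨D₀, A, fun _ => ⟨h1, h2, h3, hA, hAc, h4⟩⟩
    · exact ⟨∅, ∅, fun h => (hM h).elim⟩
  choose D₀ A hDA using hex
  refine card_mul_le_of_switching (u := k * (k + t)) (perfectMatchings n E) _
    (fun M => ({D₀ M} : Finset (Finset (Finset (Fin n)))).sigma fun D₀ =>
      switchings t E M D₀ (A M) (D₀.biUnion id \ e))
    (fun M' => (powersetCard (k + t) M').filter fun D' => {e} ⊆ D') ?_ ?_ ?_ ?_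
  · rintro M hM ⟨D₁, D⟩ hq
    obtain ⟨hq1, hq⟩ := mem_sigma.1 hq
    obtain rfl : D₁ = D₀ M := mem_singleton.1 hq1
    obtain ⟨h1, h2, h3, -⟩ := hDA M hM
    obtain ⟨hME, hM⟩ := (mem_perfectMatchings_iff hE).1 hM
    have heR := hM.subset_biUnion_of_touching_subset h1
    have hcard := card_union_of_mem_switchings hq
    obtain ⟨hD, Q, hQE, hQd, hQc, -⟩ := mem_filter.1 hq
    have hD := (mem_powersetCard.1 hD).1
    have hsub : D₀ M ∪ D ⊆ M := union_subset h2 (hD.trans sdiff_subset)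
    have hQe : ∀ f ∈ Q, Disjoint e f := by
      intro f hf
      refine Disjoint.mono_right (hQc ▸ subset_biUnion_of_mem id hf) ?_
      refine disjoint_union_right.2 ⟨disjoint_sdiff,
        (disjoint_biUnion_right _ _ _).2 fun g hg => ?_⟩
      exact ((hM.disjoint_biUnion h2 (hD hg)).mono_right heR).symm
    obtain ⟨hM', h5, h6⟩ := hM.replace (Q := insert e Q) hk hsub
      (fun f hf => hE f (insert_subset he hQE hf))
      (by
        rw [coe_insert]
        exact hQd.insert fun f hf _ => hQe f hf)
      (by
        rw [biUnion_insert, hQc, union_biUnion, ← union_assoc]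
        exact congrArg (· ∪ _) (union_sdiff_of_subset heR))
    refine ⟨hsub, _, mem_filter.2 ⟨(mem_perfectMatchings_iff hE).2
      ⟨union_subset (sdiff_subset.trans hME) (insert_subset he hQE), hM'⟩,
      mem_union_right _ (mem_insert_self _ _)⟩, insert e Q,
      mem_filter.2 ⟨mem_powersetCard.2 ⟨subset_union_right, by rw [h6, hcard, h3]⟩, by simp⟩,
      h5, ?_⟩
    rw [biUnion_insert, hQc, union_biUnion, ← union_assoc]
    exact congrArg (· ∪ _) (union_sdiff_of_subset heR)
  · intro M' hM' D' hD'
    obtain ⟨-, hM'⟩ := (mem_perfectMatchings_iff hE).1 (mem_filter.1 hM').1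
    obtain ⟨h1, h2⟩ := mem_powersetCard.1 (mem_filter.1 hD').1
    rw [card_biUnion_id (fun f hf => hM'.1 f (h1 hf)) (hM'.2.1.subset h1), h2]
  · intro M hM
    obtain ⟨h1, h2, h3, h4, h5, h6⟩ := hDA M hM
    rw [card_sigma, sum_singleton]
    exact hsw M _ ((mem_perfectMatchings_iff hE).1 hM).2 h2 h3.le (k - 1) _ _ (Nat.sub_le _ _) h4
      sdiff_subset h5 h6
  · intro M' hM'
    have hM' := ((mem_perfectMatchings_iff hE).1 (mem_filter.1 hM').1).2
    refine le_trans (Nat.cast_le.2 (card_powersetCard_filter_superset_le M' {e} (k + t))) ?_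
    rw [card_singleton]
    exact_mod_cast Nat.pow_le_pow_left (hM'.card_le hk) _

lemma card_filter_mem_perfectMatchings_le {k n t : ℕ} {c : ℝ} {E : Finset (Finset (Fin n))}
    (hk : 0 < k) (hc : 0 < c) (hkn : 2 * (k * k) ≤ n) (hE : ∀ e ∈ E, e.card = k)
    (hsw : Switchable k n t c E) {e : Finset (Fin n)} (he : e ∈ E) :
    ((perfectMatchings n E).filter fun M => e ∈ M).card *
        ((((2 * k : ℝ) ^ (k - 1) * (k - 1).factorial)⁻¹ * (n : ℝ) ^ (k - 1)) *
          (c * (n : ℝ) ^ t)) ≤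
      ((2 : ℝ) ^ 2 ^ (k * (k + t))) ^ 2 * ((perfectMatchings n E).card * (n : ℝ) ^ t) := by
  refine card_mul_le_of_switching (u := k * (k + t)) _ (perfectMatchings n E)
    (fun M => ((powersetCard k M).filter fun D₀ => e ∈ D₀).sigma fun D₀ =>
      switchings t E M D₀ e (D₀.biUnion id))
    (fun M' => (powersetCard (k + t) M').filter fun D' =>
      (M'.filter fun f => ¬ Disjoint f e) ⊆ D' ∧ (M'.filter fun f => ¬ Disjoint f e).card = k)
    ?_ ?_ ?_ ?_
  · rintro M hM ⟨D₀, D⟩ hq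
    obtain ⟨hq1, hq⟩ := mem_sigma.1 hq
    obtain ⟨hq1, heD⟩ := mem_filter.1 hq1
    obtain ⟨h2, h3⟩ := mem_powersetCard.1 hq1
    change D₀ ⊆ M at h2
    change D₀.card = k at h3
    change e ∈ D₀ at heD
    obtain ⟨hM, -⟩ := mem_filter.1 hM
    obtain ⟨hME, hM⟩ := (mem_perfectMatchings_iff hE).1 hM
    have hcard := card_union_of_mem_switchings hq
    obtain ⟨hD, Q, hQE, hQd, hQc, hQe⟩ := mem_filter.1 hq
    have hD := (mem_powersetCard.1 hD).1
    have hsub : D₀ ∪ D ⊆ M := union_subset h2 (hD.trans sdiff_subset)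
    obtain ⟨hM', h5, h6⟩ := hM.replace (Q := Q) hk hsub (fun f hf => hE f (hQE hf)) hQd
      (by rw [hQc, union_biUnion])
    have htouch : (M \ (D₀ ∪ D) ∪ Q).filter (fun f => ¬ Disjoint f e) ⊆ Q := by
      intro f hf
      obtain ⟨hf, hfe⟩ := mem_filter.1 hf
      refine (mem_union.1 hf).resolve_left fun hf => hfe ?_
      exact (hM.disjoint_biUnion hsub hf).mono_right
        (subset_biUnion_of_mem id (mem_union_left _ heD))
    refine ⟨hsub, _, (mem_perfectMatchings_iff hE).2
      ⟨union_subset (sdiff_subset.trans hME) hQE, hM'⟩, Q,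
      mem_filter.2 ⟨mem_powersetCard.2 ⟨subset_union_right, by rw [h6, hcard, h3]⟩, htouch, ?_⟩,
      h5, by rw [hQc, union_biUnion]⟩
    rw [← hE e he, ← hM'.sum_card_inter e, card_eq_sum_ones]
    exact sum_congr rfl fun f hf => le_antisymm
      (card_pos.2 (not_disjoint_iff_nonempty_inter.1 (mem_filter.1 hf).2)) (hQe f (htouch hf))
  · intro M' hM' D' hD'
    obtain ⟨-, hM'⟩ := (mem_perfectMatchings_iff hE).1 hM'
    obtain ⟨h1, h2⟩ := mem_powersetCard.1 (mem_filter.1 hD').1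
    rw [card_biUnion_id (fun f hf => hM'.1 f (h1 hf)) (hM'.2.1.subset h1), h2]
  · intro M hM
    obtain ⟨hM, heM⟩ := mem_filter.1 hM
    obtain ⟨-, hM⟩ := (mem_perfectMatchings_iff hE).1 hM
    have hmany : (((2 * k : ℝ) ^ (k - 1) * (k - 1).factorial)⁻¹ * (n : ℝ) ^ (k - 1)) ≤
        (((powersetCard k M).filter fun D₀ => e ∈ D₀).card : ℝ) := by
      have h1 : (M.card - 1).choose (k - 1) ≤
          ((powersetCard k M).filter fun D₀ => e ∈ D₀).card := by
        rw [← card_erase_of_mem heM, ← card_powersetCard]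
        refine card_le_card_of_injOn (insert e) (fun D hD => ?_) fun D hD D' hD' h => ?_
        · obtain ⟨hD, hDc⟩ := mem_powersetCard.1 hD
          refine mem_coe.2 (mem_filter.2 ⟨mem_powersetCard.2 ⟨insert_subset heM
            (hD.trans (erase_subset _ _)), ?_⟩, mem_insert_self _ _⟩)
          rw [card_insert_of_notMem fun h => notMem_erase e M (hD h), hDc]
          omega
        · have hD := (mem_powersetCard.1 hD).1
          have hD' := (mem_powersetCard.1 hD').1
          rw [← erase_insert fun h => notMem_erase e M (hD h), h,
            erase_insert fun h => notMem_erase e M (hD' h)]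
      have h2 := Nat.pow_le_choose (α := ℝ) (k - 1) (M.card - 1)
      refine le_trans (le_trans ?_ h2) (Nat.cast_le.2 h1)
      have hn := hM.card_mul
      have h3 : 2 * k ≤ M.card := by
        rw [← hn, mul_left_comm] at hkn
        exact Nat.le_of_mul_le_mul_left hkn hk
      have h4 : (n : ℝ) / (2 * k) ≤ ((M.card - 1 + 1 - (k - 1) : ℕ) : ℝ) := by
        rw [div_le_iff₀ (by positivity)]
        have : n ≤ (M.card - 1 + 1 - (k - 1)) * (2 * k) := by
          calc n = k * M.card := hn.symm
            _ ≤ k * ((M.card - 1 + 1 - (k - 1)) * 2) := Nat.mul_le_mul_left _ (by omega)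
            _ = _ := by ring
        exact_mod_cast this
      have h5 := pow_le_pow_left₀ (by positivity) h4 (k - 1)
      rw [div_pow] at h5
      rw [mul_inv, mul_assoc, mul_left_comm, mul_comm, ← div_eq_mul_inv,
        ← div_eq_inv_mul]
      gcongr
    rw [card_sigma, Nat.cast_sum]
    refine le_trans (mul_le_mul_of_nonneg_right hmany (by positivity)) ?_
    rw [← nsmul_eq_mul]
    refine card_nsmul_le_sum _ _ _ fun D₀ hD₀ => ?_
    obtain ⟨hD₀, heD⟩ := mem_filter.1 hD₀
    obtain ⟨h1, h2⟩ := mem_powersetCard.1 hD₀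
    exact hsw M D₀ hM h1 h2.le k e _ le_rfl (subset_biUnion_of_mem id heD) subset_rfl (hE e he)
      (by rw [card_biUnion_id (fun f hf => hM.1 f (h1 hf)) (hM.2.1.subset h1), h2])
  · intro M' hM'
    have hM' := ((mem_perfectMatchings_iff hE).1 hM').2
    by_cases hT : (M'.filter fun f => ¬ Disjoint f e).card = k
    · simp only [hT, and_true]
      refine le_trans (Nat.cast_le.2 (card_powersetCard_filter_superset_le M' _ (k + t))) ?_
      rw [hT, Nat.add_sub_cancel_left]
      exact_mod_cast Nat.pow_le_pow_left (hM'.card_le hk) _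
    · simp only [hT, and_false, filter_false, card_empty, Nat.cast_zero]
      positivity

end

/-- Lemma 4.1: for a uniformly random perfect matching `M` of an `(n,k,γ)`-graph `G`
(such a matching exists) and any edge `e`,
`1/(C n^{k−1}) ≤ ℙ[e ∈ M] ≤ C/n^{k−1}`, where `ℙ[e ∈ M]` is the fraction of perfect
matchings of `G` containing `e`. -/
theorem stmt_5 :
    ∀ k : ℕ, 2 ≤ k → ∀ γ : ℝ, 0 < γ →
    ∃ C : ℝ, 0 < C ∧ ∃ n₀ : ℕ, ∀ n : ℕ, n₀ ≤ n → k ∣ n →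
    ∀ E : Finset (Finset (Fin n)),
      (∀ e ∈ E, e.card = k) →
      (∀ S : Finset (Fin n), S.card = k - 1 →
        (1/2 + γ) * (n : ℝ) ≤ ((E.filter (fun e => S ⊆ e)).card : ℝ)) →
      -- G has at least one perfect matching
      0 < (perfectMatchings n E).card ∧
      -- probability bounds for each edge
      ∀ e ∈ E,
        1 / (C * (n : ℝ) ^ (k - 1)) ≤
          (((perfectMatchings n E).filter (fun M => e ∈ M)).card : ℝ) /
            ((perfectMatchings n E).card : ℝ) ∧
        (((perfectMatchings n E).filter (fun M => e ∈ M)).card : ℝ) /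
            ((perfectMatchings n E).card : ℝ) ≤ C / (n : ℝ) ^ (k - 1) := by
  intro k hk γ hγ
  obtain ⟨t, c, n₁, hc, h⟩ := exists_switchable k hk (min γ (1 / 2)) (by positivity)
    (min_le_right _ _)
  have hk0 : 0 < k := by omega
  set K : ℝ := ((2 : ℝ) ^ 2 ^ (k * (k + t))) ^ 2 with hK
  set c' : ℝ := ((2 * k : ℝ) ^ (k - 1) * (k - 1).factorial)⁻¹ with hc'
  have hK0 : 0 < K := by positivity
  have hc'0 : 0 < c' := by positivity
  refine ⟨K / c + K / (c * c'), by positivity, max n₁ (2 * (k * k)), fun n hn hkn E hE hdeg => ?_⟩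
  obtain ⟨hn1, hn2⟩ := max_le_iff.1 hn
  have hn0 : 0 < n := lt_of_lt_of_le (by positivity) hn2
  have hsw : Switchable k n t c E := h n hn1 E ⟨hE, fun S hS => le_trans
    (by gcongr; exact min_le_left _ _) (hdeg S hS)⟩
  have hpos : 0 < (perfectMatchings n E).card :=
    Finset.card_pos.2 (perfectMatchings_nonempty hk0 hn0 hkn hc hE hsw)
  refine ⟨hpos, fun e he => ?_⟩
  have h1 := card_perfectMatchings_le hk0 (by omega) hE hsw he
  have h2 := card_filter_mem_perfectMatchings_le hk0 hc hn2 hE hsw he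
  rw [← hK] at h1 h2
  rw [← hc'] at h2
  have hpos' : (0 : ℝ) < (perfectMatchings n E).card := by exact_mod_cast hpos
  have hn0' : (0 : ℝ) < n := by exact_mod_cast hn0
  generalize ((perfectMatchings n E).card : ℝ) = Φ at *
  generalize (((perfectMatchings n E).filter fun M => e ∈ M).card : ℝ) = N at *
  have hx : (0 : ℝ) < (n : ℝ) ^ (k - 1) := by positivity
  have hy : (0 : ℝ) < (n : ℝ) ^ t := by positivity
  rw [show k + t - 1 = (k - 1) + t by omega, pow_add] at h1
  generalize (n : ℝ) ^ (k - 1) = x at *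
  generalize (n : ℝ) ^ t = y at *
  have h1' : Φ * c ≤ K * (N * x) := le_of_mul_le_mul_right (by linarith) hy
  have h2' : N * (c' * x * c) ≤ K * Φ := le_of_mul_le_mul_right (by linarith) hy
  have hN : 0 ≤ N := by
    by_contra! hN
    have := mul_pos hpos' hc
    have := mul_neg_of_pos_of_neg hK0 (mul_neg_of_neg_of_pos hN hx)
    linarith
  constructor
  · rw [div_le_div_iff₀ (by positivity) hpos', one_mul]
    have h3 : Φ ≤ N * (K / c * x) := by
      rw [show N * (K / c * x) = K * (N * x) / c by ring, le_div_iff₀ hc]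
      exact h1'
    refine h3.trans (mul_le_mul_of_nonneg_left (mul_le_mul_of_nonneg_right ?_ hx.le) hN)
    exact le_add_of_nonneg_right (by positivity)
  · rw [div_le_div_iff₀ hpos' hx]
    have h3 : N * x ≤ K / (c * c') * Φ := by
      rw [div_mul_eq_mul_div, le_div_iff₀ (by positivity)]
      linarith
    refine h3.trans (mul_le_mul_of_nonneg_right ?_ hpos'.le)
    exact le_add_of_nonneg_left (by positivity)
end
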